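/- Let (X,T) be a subshift of finite type on a finite alphabet and let A: X → GL(m₀,ℝ) be a Hölder continuous matrix cocycle. Then for each s ∈ [0,m₀], the map A ↦ P(A,s) is continuous: for every ε > 0 there is δ > 0 such that |P(B,s) − P(A,s)| < ε for every Hölder continuous cocycle B: X → GL(m₀,ℝ) with sup_{x∈X} ‖A(x) − B(x)‖ < δ. -/

import Mathlib

open Filter Topology Set

section Defs

variable {M : Type*} [NormedAddCommGroup M] [InnerProductSpace ℝ M] [FiniteDimensional ℝ M]

/-- The `i`-th largest singular value (for `i ≥ 1`) of a linear operator on a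
finite-dimensional real inner product space, via the Courant–Fischer min-max principle. -/
noncomputable def singVal (L : M →L[ℝ] M) (i : ℕ) : ℝ :=
  sSup {r : ℝ | ∃ V : Submodule ℝ M, Module.finrank ℝ V = i ∧ ∀ v ∈ V, r * ‖v‖ ≤ ‖L v‖}

/-- `φ^s(L) = α₁(L) ⋯ α_m(L) · α_{m+1}(L)^{s−m}` with `m = [s]`. -/
noncomputable def phiS (L : M →L[ℝ] M) (s : ℝ) : ℝ :=
  (∏ i ∈ Finset.range ⌊s⌋₊, singVal L (i + 1)) * singVal L (⌊s⌋₊ + 1) ^ (s - ⌊s⌋₊)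

variable {A : Type*} [Fintype A]

/-- The one-sided subshift of finite type determined by the transition relation `Tr`. -/
abbrev SFT (Tr : A → A → Prop) : Type _ := {x : ℕ → A // ∀ n : ℕ, Tr (x n) (x (n + 1))}

/-- The shift map on the subshift of finite type. -/
def shiftSFT (Tr : A → A → Prop) : SFT Tr → SFT Tr :=
  fun x => ⟨fun n => x.1 (n + 1), fun n => x.2 (n + 1)⟩

/-- The cocycle `A(x,n) = A(T^{n−1}x) ⋯ A(x)` induced by `Amap`. -/
noncomputable def cocycle (Tr : A → A → Prop) (Amap : SFT Tr → (M →L[ℝ] M)) :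
    ℕ → SFT Tr → (M →L[ℝ] M)
  | 0, _ => ContinuousLinearMap.id ℝ M
  | n + 1, x => (cocycle Tr Amap n (shiftSFT Tr x)).comp (Amap x)

/-- `Amap` is a Hölder continuous cocycle: `‖A(x) − A(y)‖ ≤ C θⁿ` whenever `x` and `y`
agree on their first `n` coordinates. -/
def HolderCocycle (Tr : A → A → Prop) (Amap : SFT Tr → (M →L[ℝ] M)) : Prop :=
  ∃ C : ℝ, 0 < C ∧ ∃ θ : ℝ, 0 < θ ∧ θ < 1 ∧ ∀ x y : SFT Tr, ∀ n : ℕ,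
    (∀ i < n, x.1 i = y.1 i) → ‖Amap x - Amap y‖ ≤ C * θ ^ n

/-- The sum `∑_{i ∈ X_n^*} sup_{y ∈ [i]} φ^s(A(y,n))` over allowable words of length `n`. -/
noncomputable def wordSum (Tr : A → A → Prop) (Amap : SFT Tr → (M →L[ℝ] M)) (s : ℝ)
    (n : ℕ) : ℝ := by
  classical
  exact ∑ w ∈ (Finset.univ : Finset (Fin n → A)).filter
      (fun w => ∀ (i : ℕ) (hi : i + 1 < n), Tr (w ⟨i, Nat.lt_of_succ_lt hi⟩) (w ⟨i + 1, hi⟩)),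
    sSup ((fun y => phiS (cocycle Tr Amap n y) s) ''
      {y : SFT Tr | ∀ i : Fin n, y.1 i = w i})

/-- The sub-additive topological pressure `P(A,s)` of the singular valued potential `φ^s`
for the cocycle `Amap` over the subshift. -/
noncomputable def cocPressure (Tr : A → A → Prop) (Amap : SFT Tr → (M →L[ℝ] M))
    (s : ℝ) : ℝ :=
  Filter.limsup (fun n : ℕ => Real.log (wordSum Tr Amap s n) / n) Filter.atTop

end Defs

section LinearAlgebra

open Module

variable {M : Type*} [NormedAddCommGroup M] [InnerProductSpace ℝ M]

theorem norm_sq_apply_eq_sum {d : ℕ} (L : M →L[ℝ] M) (e : OrthonormalBasis (Fin d) ℝ M)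
    (horth : ∀ i j, i ≠ j → inner ℝ (L (e i)) (L (e j)) = 0) (v : M) :
    ‖L v‖ ^ 2 = ∑ i, ‖L (e i)‖ ^ 2 * inner ℝ (e i) v ^ 2 := by
  have hv : L v = ∑ i, inner ℝ (e i) v • L (e i) := by
    conv_lhs => rw [← e.sum_repr' v]
    simp
  rw [← real_inner_self_eq_norm_sq, hv, sum_inner]
  refine Finset.sum_congr rfl fun i _ => ?_
  rw [inner_sum, Finset.sum_eq_single i]
  · rw [inner_smul_left, inner_smul_right, real_inner_self_eq_norm_sq]
    simp
    ring
  · intro j _ hj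
    rw [inner_smul_left, inner_smul_right, horth i j (Ne.symm hj)]
    simp
  · simp

theorem inner_eq_zero_of_mem_span {d : ℕ} (e : OrthonormalBasis (Fin d) ℝ M) (S : Set (Fin d))
    {v : M} (hv : v ∈ Submodule.span ℝ (Set.range fun i : S => e i)) {j : Fin d} (hj : j ∉ S) :
    inner ℝ (e j) v = 0 := by
  induction hv using Submodule.span_induction with
  | mem x hx =>
    obtain ⟨i, rfl⟩ := hx
    refine e.orthonormal.2 ?_
    rintro rfl
    exact hj i.2
  | zero => simp
  | add x y _ _ hx hy => rw [inner_add_right, hx, hy, add_zero]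
  | smul a x _ hx => rw [inner_smul_right, hx, mul_zero]

theorem finrank_span_subfamily {d : ℕ} (e : OrthonormalBasis (Fin d) ℝ M) (S : Set (Fin d))
    [Fintype S] :
    finrank ℝ (Submodule.span ℝ (Set.range fun i : S => e i)) = Fintype.card S := by
  apply finrank_span_eq_card
  exact e.orthonormal.linearIndependent.comp _ Subtype.val_injective

variable [FiniteDimensional ℝ M]

theorem exists_singular_basis (L : M →L[ℝ] M) {d : ℕ} (hd : finrank ℝ M = d) :
    ∃ e : OrthonormalBasis (Fin d) ℝ M,
      (∀ i j, i ≠ j → inner ℝ (L (e i)) (L (e j)) = 0) ∧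
      (∀ i : Fin d, singVal L (i + 1) = ‖L (e i)‖) ∧
      (∀ i j : Fin d, i ≤ j → ‖L (e j)‖ ≤ ‖L (e i)‖) := by
  set T := (LinearMap.adjoint L.toLinearMap) ∘ₗ L.toLinearMap with hTdef
  have hT : T.IsSymmetric := L.toLinearMap.isSymmetric_adjoint_comp_self
  set e := hT.eigenvectorBasis hd with he
  have hin : ∀ i j, inner ℝ (L (e i)) (L (e j)) = hT.eigenvalues hd i * inner ℝ (e i) (e j) := by
    intro i j
    have h1 : inner ℝ (T (e i)) (e j) = inner ℝ (L (e i)) (L (e j)) := by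
      simp only [hTdef, LinearMap.comp_apply]
      rw [LinearMap.adjoint_inner_left]
      rfl
    rw [← h1, hT.apply_eigenvectorBasis hd i, inner_smul_left]
    simp [he]
  have horth : ∀ i j, i ≠ j → inner ℝ (L (e i)) (L (e j)) = 0 := by
    intro i j hij
    rw [hin, e.orthonormal.2 hij, mul_zero]
  have hnorm : ∀ i, ‖L (e i)‖ ^ 2 = hT.eigenvalues hd i := by
    intro i
    rw [← real_inner_self_eq_norm_sq, hin, real_inner_self_eq_norm_sq, e.orthonormal.1 i]
    simp
  have hanti : ∀ i j : Fin d, i ≤ j → ‖L (e j)‖ ≤ ‖L (e i)‖ := by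
    intro i j hij
    have := hT.eigenvalues_antitone hd hij
    rw [← hnorm, ← hnorm] at this
    exact le_of_sq_le_sq this (norm_nonneg _)
  refine ⟨e, horth, fun i => ?_, hanti⟩
  have hexp : ∀ v : M, ‖v‖ ^ 2 = ∑ i, inner ℝ (e i) v ^ 2 := by
    intro v
    rw [← e.sum_sq_norm_inner_right v]
    simp
  refine IsGreatest.csSup_eq ⟨?_, ?_⟩
  · refine ⟨Submodule.span ℝ (Set.range fun j : Set.Iic i => e j), ?_, ?_⟩
    · rw [finrank_span_subfamily]
      simp
    · intro v hv
      refine le_of_sq_le_sq ?_ (norm_nonneg _)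
      rw [mul_pow, hexp v, norm_sq_apply_eq_sum L e horth v, Finset.mul_sum]
      refine Finset.sum_le_sum fun j _ => ?_
      by_cases hj : j ∈ Set.Iic i
      · have := hanti j i hj
        gcongr
      · rw [inner_eq_zero_of_mem_span e _ hv hj]
        simp
  · rintro r ⟨V, hV, hr⟩
    set W := Submodule.span ℝ (Set.range fun j : Set.Ici i => e j) with hW
    have hWd : finrank ℝ W = d - i := by
      rw [hW, finrank_span_subfamily]
      simp
    have hle := Submodule.finrank_sup_add_finrank_inf_eq V W
    have hsup : finrank ℝ (V ⊔ W : Submodule ℝ M) ≤ d := hd ▸ Submodule.finrank_le _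
    have hpos : 0 < finrank ℝ (V ⊓ W : Submodule ℝ M) := by
      have := i.2
      omega
    obtain ⟨⟨v, hv⟩, hv0⟩ := Module.finrank_pos_iff_exists_ne_zero.1 hpos
    have hv0' : v ≠ 0 := fun h => hv0 (Subtype.ext h)
    have h1 := hr v hv.1
    have h2 : ‖L v‖ ≤ ‖L (e i)‖ * ‖v‖ := by
      refine le_of_sq_le_sq ?_ (by positivity)
      rw [mul_pow, hexp v, norm_sq_apply_eq_sum L e horth v, Finset.mul_sum]
      refine Finset.sum_le_sum fun j _ => ?_
      by_cases hj : j ∈ Set.Ici i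
      · have := hanti i j hj
        gcongr
      · rw [inner_eq_zero_of_mem_span e _ hv.2 hj]
        simp
    exact le_of_mul_le_mul_right (h1.trans h2) (norm_pos_iff.2 hv0')

theorem singVal_nonneg (L : M →L[ℝ] M) (i : ℕ) (hi : i < finrank ℝ M) : 0 ≤ singVal L (i + 1) := by
  obtain ⟨e, -, h, -⟩ := exists_singular_basis L rfl
  exact (h ⟨i, hi⟩).symm ▸ norm_nonneg _

theorem singVal_antitone (L : M →L[ℝ] M) {i j : ℕ} (hij : i ≤ j) (hj : j < finrank ℝ M) :
    singVal L (j + 1) ≤ singVal L (i + 1) := by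
  obtain ⟨e, -, h, h2⟩ := exists_singular_basis L rfl
  have := h2 ⟨i, hij.trans_lt hj⟩ ⟨j, hj⟩ hij
  rwa [← h, ← h] at this

theorem singVal_pos (L : M →L[ℝ] M) (hL : IsUnit L) {i : ℕ} (hi : i < finrank ℝ M) :
    0 < singVal L (i + 1) := by
  obtain ⟨e, -, h, -⟩ := exists_singular_basis L rfl
  rw [h ⟨i, hi⟩, norm_pos_iff]
  obtain ⟨u, rfl⟩ := hL
  intro h0
  have : (↑u⁻¹ : M →L[ℝ] M) ((u : M →L[ℝ] M) (e ⟨i, hi⟩)) = e ⟨i, hi⟩ := by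
    rw [← mul_apply_eq_comp]
    simp
  rw [h0, map_zero] at this
  exact e.orthonormal.ne_zero _ this.symm

end LinearAlgebra

section ExteriorPowers

open Module

theorem prod_le_prod_range_of_card {σ : ℕ → ℝ} {d : ℕ} (h0 : ∀ i < d, 0 ≤ σ i)
    (hanti : ∀ i j, i ≤ j → j < d → σ j ≤ σ i) (k : ℕ) :
    ∀ S : Finset ℕ, S ⊆ Finset.range d → S.card = k → ∏ i ∈ S, σ i ≤ ∏ i ∈ Finset.range k, σ i := by
  induction k with
  | zero =>
    intro S _ hS
    rw [Finset.card_eq_zero.1 hS]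
    simp
  | succ k ih =>
    intro S hSd hS
    have hne : S.Nonempty := Finset.card_pos.1 (by omega)
    set m := S.max' hne with hm
    have hmS : m ∈ S := S.max'_mem hne
    have hmd : m < d := Finset.mem_range.1 (hSd hmS)
    have hkm : k ≤ m := by
      have : S ⊆ Finset.range (m + 1) := fun x hx =>
        Finset.mem_range.2 (Nat.lt_succ_of_le (S.le_max' x hx))
      have := Finset.card_le_card this
      simp at this
      omega
    rw [← Finset.prod_erase_mul S σ hmS, Finset.prod_range_succ]
    have hsub : S.erase m ⊆ Finset.range d := (Finset.erase_subset _ _).trans hSd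
    refine mul_le_mul (ih _ hsub (by rw [Finset.card_erase_of_mem hmS]; omega))
      (hanti k m hkm hmd) (h0 m hmd) (Finset.prod_nonneg fun i hi => h0 i ?_)
    have := Finset.mem_range.1 hi
    omega

theorem prod_le_prod_range_mul_of_card {σ : ℕ → ℝ} {d : ℕ} (h0 : ∀ i < d, 0 ≤ σ i)
    (hanti : ∀ i j, i ≤ j → j < d → σ j ≤ σ i) (k : ℕ) (S : Finset ℕ) (hSd : S ⊆ Finset.range d)
    (hS : S.card = k + 1) (hex : ∃ i ∈ S, k + 1 ≤ i) :
    ∏ i ∈ S, σ i ≤ (∏ i ∈ Finset.range k, σ i) * σ (k + 1) := by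
  obtain ⟨i, hi, hki⟩ := hex
  have hid : i < d := Finset.mem_range.1 (hSd hi)
  rw [← Finset.prod_erase_mul S σ hi]
  have hsub : S.erase i ⊆ Finset.range d := (Finset.erase_subset _ _).trans hSd
  refine mul_le_mul (prod_le_prod_range_of_card h0 hanti k _ hsub
    (by rw [Finset.card_erase_of_mem hi]; omega))
    (hanti _ _ hki hid) (h0 i hid) (Finset.prod_nonneg fun j hj => h0 j ?_)
  have := Finset.mem_range.1 hj
  omega

variable {M : Type*} [NormedAddCommGroup M] [InnerProductSpace ℝ M]

/-- The action of an operator on alternating forms of degree `k`, by pull-back. -/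
noncomputable def extPull (k : ℕ) (L : M →L[ℝ] M) :
    (M [⋀^Fin k]→L[ℝ] ℝ) →L[ℝ] (M [⋀^Fin k]→L[ℝ] ℝ) :=
  ContinuousAlternatingMap.compContinuousLinearMapCLM L

theorem extPull_apply (k : ℕ) (L : M →L[ℝ] M) (ω : M [⋀^Fin k]→L[ℝ] ℝ) (v : Fin k → M) :
    extPull k L ω v = ω (fun i => L (v i)) := rfl

theorem extPull_comp (k : ℕ) (L K : M →L[ℝ] M) :
    extPull k (L.comp K) = (extPull k K).comp (extPull k L) := rfl

theorem extPull_id (k : ℕ) :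
    extPull k (ContinuousLinearMap.id ℝ M) = ContinuousLinearMap.id ℝ _ := rfl

theorem norm_extPull_le (k : ℕ) (L : M →L[ℝ] M) : ‖extPull k L‖ ≤ ‖L‖ ^ k := by
  refine ContinuousLinearMap.opNorm_le_bound _ (by positivity) fun ω => ?_
  have := ContinuousAlternatingMap.norm_compContinuousLinearMap_le ω L
  rw [Fintype.card_fin, mul_comm] at this
  exact this

/-- The determinant form of a tuple of vectors. -/
noncomputable def detForm {k : ℕ} (u : Fin k → M) : M [⋀^Fin k]→L[ℝ] ℝ :=
  { (Matrix.detRowAlternating (n := Fin k) (R := ℝ)).compLinearMap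
      (LinearMap.pi fun i => (innerSL ℝ (u i)).toLinearMap) with
    cont := by
      have : Continuous fun v : Fin k → M =>
          Matrix.det (Matrix.of fun j i => (inner ℝ (u i) (v j) : ℝ)) := by
        refine Continuous.matrix_det ?_
        refine continuous_matrix fun i j => ?_
        simp only [Matrix.of_apply]
        fun_prop
      exact this }

theorem detForm_apply {k : ℕ} (u v : Fin k → M) :
    detForm u v = Matrix.det (Matrix.of fun j i => inner ℝ (u i) (v j)) := rfl

theorem norm_detForm_le {k : ℕ} (u : Fin k → M) (hu : ∀ i, ‖u i‖ ≤ 1) :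
    ‖detForm u‖ ≤ (k.factorial : ℝ) := by
  refine ContinuousAlternatingMap.opNorm_le_bound _ (Nat.cast_nonneg _) fun v => ?_
  rw [detForm_apply, Matrix.det_apply, Real.norm_eq_abs]
  refine (Finset.abs_sum_le_sum_abs _ _).trans ?_
  have : ∀ τ ∈ (Finset.univ : Finset (Equiv.Perm (Fin k))),
      |Equiv.Perm.sign τ • ∏ i, Matrix.of (fun j i => inner ℝ (u i) (v j)) (τ i) i| ≤
        ∏ i, ‖v i‖ := by
    intro τ _
    rw [Units.smul_def, zsmul_eq_mul, abs_mul]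
    have h1 : |((Equiv.Perm.sign τ : ℤ) : ℝ)| = 1 := by
      rcases Int.units_eq_one_or (Equiv.Perm.sign τ) with h | h <;> simp [h]
    rw [h1, one_mul, Finset.abs_prod, ← Equiv.prod_comp τ (fun i => ‖v i‖)]
    refine Finset.prod_le_prod (fun _ _ => abs_nonneg _) fun i _ => ?_
    refine (abs_real_inner_le_norm _ _).trans ?_
    exact mul_le_of_le_one_left (norm_nonneg _) (hu i)
  refine (Finset.sum_le_sum this).trans ?_
  simp [Fintype.card_perm]

theorem map_apply_eq_sum {d k : ℕ} (e : OrthonormalBasis (Fin d) ℝ M) (L : M →L[ℝ] M)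
    (ω : M [⋀^Fin k]→L[ℝ] ℝ) (v : Fin k → M) (c : Fin k → Fin d → ℝ)
    (hv : ∀ i, v i = ∑ j, c i j • e j) :
    ω (fun i => L (v i)) = ∑ f : Fin k → Fin d, (∏ i, c i (f i)) * ω (fun i => L (e (f i))) := by
  have h1 : (fun i => L (v i)) = fun i => ∑ j, c i j • L (e j) := by
    ext i
    rw [hv i]
    simp
  rw [h1]
  have h2 := ω.toMultilinearMap.map_sum (fun i j => c i j • L (e j))
  refine h2.trans (Finset.sum_congr rfl fun f _ => ?_)
  exact ω.toMultilinearMap.map_smul_univ (fun i => c i (f i)) (fun i => L (e (f i)))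

theorem map_linearCombination_eq {k : ℕ} (ω : M [⋀^Fin k]→L[ℝ] ℝ) (u v : Fin k → M) :
    ω (fun i => ∑ j, inner ℝ (u j) (v i) • u j) = ω u * detForm u v := by
  set g : (Fin k → ℝ) [⋀^Fin k]→ₗ[ℝ] ℝ :=
    ω.toAlternatingMap.compLinearMap (Fintype.linearCombination ℝ u) with hg
  have h := AlternatingMap.eq_smul_basis_det (Pi.basisFun ℝ (Fin k)) g
  have h2 := congrArg (fun q => q (fun i j => (inner ℝ (u j) (v i) : ℝ))) h
  simp only [AlternatingMap.smul_apply, Pi.basisFun_det_apply, smul_eq_mul] at h2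
  have h3 : g (Pi.basisFun ℝ (Fin k)) = ω u := by
    simp only [hg, AlternatingMap.compLinearMap_apply]
    show ω _ = ω u
    congr 1
    ext i
    simp [Fintype.linearCombination_apply]
  rw [h3] at h2
  rw [detForm_apply]
  refine Eq.trans ?_ h2
  simp only [hg, AlternatingMap.compLinearMap_apply]
  rfl

theorem norm_extPull_sub_le_of_basis {d k : ℕ} (e : OrthonormalBasis (Fin d) ℝ M) (L : M →L[ℝ] M)
    (p : Fin d → Prop) [DecidablePred p] {D : ℝ} (hD : 0 ≤ D)
    (h : ∀ f : Fin k → Fin d, Function.Injective f → (∃ i, ¬ p (f i)) →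
      ∏ i, ‖L (e (f i))‖ ≤ D) (v : Fin k → M) (ω : M [⋀^Fin k]→L[ℝ] ℝ) :
    |ω (fun i => L (v i)) -
      ω (fun i => L (∑ j, (if p j then inner ℝ (e j) (v i) else 0) • e j))| ≤
      (d : ℝ) ^ k * D * ‖ω‖ * ∏ i, ‖v i‖ := by
  rw [map_apply_eq_sum e L ω v (fun i j => inner ℝ (e j) (v i)) (fun i => (e.sum_repr' _).symm),
    map_apply_eq_sum e L ω (fun i => ∑ j, (if p j then inner ℝ (e j) (v i) else 0) • e j)
      (fun i j => if p j then inner ℝ (e j) (v i) else 0) (fun i => rfl), ← Finset.sum_sub_distrib]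
  refine (Finset.abs_sum_le_sum_abs _ _).trans ?_
  have hterm : ∀ f ∈ (Finset.univ : Finset (Fin k → Fin d)),
      |(∏ i, inner ℝ (e (f i)) (v i)) * ω (fun i => L (e (f i))) -
        (∏ i, if p (f i) then inner ℝ (e (f i)) (v i) else 0) * ω (fun i => L (e (f i)))| ≤
      D * ‖ω‖ * ∏ i, ‖v i‖ := by
    intro f _
    have hnn : 0 ≤ D * ‖ω‖ * ∏ i, ‖v i‖ :=
      mul_nonneg (mul_nonneg hD (norm_nonneg _)) (Finset.prod_nonneg fun _ _ => norm_nonneg _)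
    by_cases hinj : Function.Injective f
    · by_cases hp : ∃ i, ¬ p (f i)
      · obtain ⟨i, hi⟩ := hp
        rw [Finset.prod_eq_zero (i := i) (f := fun i => if p (f i) then _ else _)
          (Finset.mem_univ _) (if_neg hi), zero_mul, sub_zero, abs_mul, Finset.abs_prod]
        have h1 : |ω (fun i => L (e (f i)))| ≤ ‖ω‖ * D :=
          (ω.le_opNorm _).trans (mul_le_mul_of_nonneg_left (h f hinj ⟨i, hi⟩) (norm_nonneg _))
        have h2 : ∏ i, |(inner ℝ (e (f i)) (v i) : ℝ)| ≤ ∏ i, ‖v i‖ := by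
          refine Finset.prod_le_prod (fun _ _ => abs_nonneg _) fun i _ => ?_
          refine (abs_real_inner_le_norm _ _).trans ?_
          rw [e.orthonormal.1, one_mul]
        calc _ ≤ (∏ i, ‖v i‖) * (‖ω‖ * D) := by gcongr
          _ = _ := by ring
      · push Not at hp
        rw [Finset.prod_congr rfl (fun i _ => if_pos (hp i)), sub_self, abs_zero]
        exact hnn
    · have : ω (fun i => L (e (f i))) = 0 := by
        simp only [Function.Injective, not_forall] at hinj
        obtain ⟨i, j, hij, hne⟩ := hinj
        exact ω.map_eq_zero_of_eq _ (by simp only [hij]) hne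
      rw [this]
      simpa using hnn
  refine (Finset.sum_le_sum hterm).trans (le_of_eq ?_)
  simp [Fintype.card_pi]
  ring

theorem norm_extPull_le_of_basis {d k : ℕ} (e : OrthonormalBasis (Fin d) ℝ M) (L : M →L[ℝ] M)
    {D : ℝ} (hD : 0 ≤ D)
    (h : ∀ f : Fin k → Fin d, Function.Injective f → ∏ i, ‖L (e (f i))‖ ≤ D) (hk : 0 < k) :
    ‖extPull k L‖ ≤ (d : ℝ) ^ k * D := by
  refine ContinuousLinearMap.opNorm_le_bound _ (by positivity) fun ω => ?_
  refine ContinuousAlternatingMap.opNorm_le_bound _ (by positivity) fun v => ?_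
  have := norm_extPull_sub_le_of_basis e L (fun _ => False) hD (fun f hf _ => h f hf) v ω
  have h0 : ω (fun i => L (∑ j, (if False then inner ℝ (e j) (v i) else 0) • e j)) = 0 :=
    ω.toMultilinearMap.map_coord_zero ⟨0, hk⟩ (by simp)
  rw [h0, sub_zero] at this
  exact this

theorem exists_rankOne_extPull_of_basis {d k : ℕ} (hkd : k ≤ d)
    (e : OrthonormalBasis (Fin d) ℝ M) (L : M →L[ℝ] M) {D : ℝ} (hD : 0 ≤ D)
    (h : ∀ f : Fin k → Fin d, Function.Injective f → (∃ i, k ≤ (f i : ℕ)) →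
      ∏ i, ‖L (e (f i))‖ ≤ D) :
    ∃ (ξ : (M [⋀^Fin k]→L[ℝ] ℝ) →L[ℝ] ℝ) (a : M [⋀^Fin k]→L[ℝ] ℝ),
      ‖extPull k L - ξ.smulRight a‖ ≤ (d : ℝ) ^ k * D := by
  set u : Fin k → M := fun i => e (Fin.castLE hkd i) with hu
  have hc : Continuous fun ω : M [⋀^Fin k]→L[ℝ] ℝ => ω (fun i => L (u i)) := by
    fun_prop
  refine ⟨⟨⟨⟨fun ω => ω (fun i => L (u i)), fun _ _ => rfl⟩, fun _ _ => rfl⟩, hc⟩, detForm u, ?_⟩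
  refine ContinuousLinearMap.opNorm_le_bound _ (by positivity) fun ω => ?_
  refine ContinuousAlternatingMap.opNorm_le_bound _ (by positivity) fun v => ?_
  have hm := norm_extPull_sub_le_of_basis e L (fun j => (j : ℕ) < k) hD
    (fun f hf hex => h f hf (by simpa using hex)) v ω
  have hP : ∀ i, (∑ j : Fin d, (if (j : ℕ) < k then (inner ℝ (e j) (v i) : ℝ) else 0) • e j) =
      ∑ j : Fin k, (inner ℝ (u j) (v i) : ℝ) • u j := by
    intro i
    simp only [ite_smul, zero_smul]
    rw [← Finset.sum_filter]
    symm
    refine Finset.sum_bij (fun j _ => Fin.castLE hkd j) (by simp) ?_ ?_ (by simp [hu])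
    · intro a _ b _ hab
      exact Fin.castLE_injective hkd hab
    · intro b hb
      exact ⟨⟨b, (Finset.mem_filter.1 hb).2⟩, Finset.mem_univ _, rfl⟩
  simp only [hP] at hm
  have h2 := map_linearCombination_eq (extPull k L ω) u v
  rw [extPull_apply, extPull_apply] at h2
  rw [h2] at hm
  exact hm

end ExteriorPowers

section SingularValueProducts

open Module

variable {M : Type*} [NormedAddCommGroup M] [InnerProductSpace ℝ M]

theorem norm_extPull_sub_le (k : ℕ) (L L' : M →L[ℝ] M) {R : ℝ} (hR : 1 ≤ R) (hL : ‖L‖ ≤ R)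
    (hL' : ‖L'‖ ≤ R) : ‖extPull k L - extPull k L'‖ ≤ k * R ^ k * ‖L - L'‖ := by
  refine ContinuousLinearMap.opNorm_le_bound _ (by positivity) fun ω => ?_
  refine ContinuousAlternatingMap.opNorm_le_bound _ (by positivity) fun v => ?_
  have h := ω.norm_image_sub_le' (fun i => L (v i)) (fun i => L' (v i))
  have h1 : ∀ i : Fin k, (∏ j, if j = i then ‖L (v i) - L' (v i)‖
      else max ‖L (v j)‖ ‖L' (v j)‖) ≤ R ^ k * ‖L - L'‖ * ∏ j, ‖v j‖ := by
    intro i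
    have h2 : (∏ j, if j = i then ‖L (v i) - L' (v i)‖ else max ‖L (v j)‖ ‖L' (v j)‖) ≤
        ∏ j, ((if j = i then ‖L - L'‖ else R) * ‖v j‖) := by
      refine Finset.prod_le_prod (fun j _ => ?_) fun j _ => ?_
      · split_ifs <;> positivity
      · split_ifs with hj
        · subst hj
          exact (L - L').le_opNorm (v j)
        · exact max_le ((L.le_opNorm _).trans (by gcongr)) ((L'.le_opNorm _).trans (by gcongr))
    refine h2.trans ?_
    rw [Finset.prod_mul_distrib]
    refine mul_le_mul_of_nonneg_right ?_ (Finset.prod_nonneg fun _ _ => norm_nonneg _)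
    rw [← Finset.mul_prod_erase _ _ (Finset.mem_univ i), if_pos rfl, mul_comm]
    refine mul_le_mul_of_nonneg_right ?_ (norm_nonneg _)
    rw [Finset.prod_congr rfl (g := fun _ => R)
      (fun j hj => if_neg (Finset.ne_of_mem_erase hj)), Finset.prod_const]
    refine pow_le_pow_right₀ hR ?_
    simp
  calc _ ≤ _ := h
    _ ≤ ‖ω‖ * ∑ _i : Fin k, R ^ k * ‖L - L'‖ * ∏ j, ‖v j‖ := by
        gcongr with i _
        exact h1 i
    _ = _ := by simp; ring

variable [FiniteDimensional ℝ M]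

instance finiteDimensional_alternating (k : ℕ) : FiniteDimensional ℝ (M [⋀^Fin k]→L[ℝ] ℝ) := by
  let e := stdOrthonormalBasis ℝ M
  let g : (M [⋀^Fin k]→L[ℝ] ℝ) →ₗ[ℝ] ((Fin k → Fin (finrank ℝ M)) → ℝ) :=
    { toFun := fun ω f => ω (fun i => e (f i))
      map_add' := fun _ _ => rfl
      map_smul' := fun _ _ => rfl }
  refine FiniteDimensional.of_injective g ?_
  rw [← LinearMap.ker_eq_bot, LinearMap.ker_eq_bot']
  intro ω hω
  ext v
  have h := map_apply_eq_sum e (ContinuousLinearMap.id ℝ M) ω v (fun i j => inner ℝ (e j) (v i))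
    (fun i => (e.sum_repr' _).symm)
  refine h.trans ?_
  refine Finset.sum_eq_zero fun f _ => ?_
  have : ω (fun i => e (f i)) = 0 := congrFun hω f
  simp [this]

/-- The product of the `k` largest singular values. -/
noncomputable def singProd (L : M →L[ℝ] M) (k : ℕ) : ℝ :=
  ∏ i ∈ Finset.range k, singVal L (i + 1)

theorem singProd_pos {L : M →L[ℝ] M} (hL : IsUnit L) {k : ℕ} (hk : k ≤ finrank ℝ M) :
    0 < singProd L k :=
  Finset.prod_pos fun i hi => singVal_pos L hL (by have := Finset.mem_range.1 hi; omega)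

theorem norm_extPull_le_singProd (L : M →L[ℝ] M) {k : ℕ} (hk : k ≤ finrank ℝ M) :
    ‖extPull k L‖ ≤ ((finrank ℝ M : ℕ) : ℝ) ^ k * singProd L k := by
  obtain ⟨e, horth, hs, hanti⟩ := exists_singular_basis L rfl
  have h0 : ∀ i < finrank ℝ M, 0 ≤ singVal L (i + 1) := singVal_nonneg L
  have hD : 0 ≤ singProd L k :=
    Finset.prod_nonneg fun i hi => h0 i (by have := Finset.mem_range.1 hi; omega)
  rcases Nat.eq_zero_or_pos k with rfl | hpos
  · simpa [singProd] using norm_extPull_le 0 L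
  refine norm_extPull_le_of_basis e L hD (fun f hf => ?_) hpos
  have := prod_le_prod_range_of_card (σ := fun i => singVal L (i + 1)) h0
    (fun i j hij hj => singVal_antitone L hij hj) k
    (Finset.univ.image fun i => (f i : ℕ))
    (by intro x hx; obtain ⟨i, -, rfl⟩ := Finset.mem_image.1 hx; simp)
    (by rw [Finset.card_image_of_injective _ (fun a b hab => hf (Fin.val_injective hab))]; simp)
  rw [Finset.prod_image (fun a _ b _ hab => hf (Fin.val_injective hab))] at this
  simpa only [hs, singProd] using this

theorem exists_rankOne_extPull (L : M →L[ℝ] M) {k : ℕ} (hk : k + 1 < finrank ℝ M) :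
    ∃ (ξ : (M [⋀^Fin (k + 1)]→L[ℝ] ℝ) →L[ℝ] ℝ) (a : M [⋀^Fin (k + 1)]→L[ℝ] ℝ),
      ‖extPull (k + 1) L - ξ.smulRight a‖ ≤
        ((finrank ℝ M : ℕ) : ℝ) ^ (k + 1) * (singProd L k * singVal L (k + 2)) := by
  obtain ⟨e, horth, hs, hanti⟩ := exists_singular_basis L rfl
  have h0 : ∀ i < finrank ℝ M, 0 ≤ singVal L (i + 1) := singVal_nonneg L
  have hD : 0 ≤ singProd L k * singVal L (k + 2) :=
    mul_nonneg (Finset.prod_nonneg fun i hi => h0 i (by have := Finset.mem_range.1 hi; omega))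
      (h0 _ hk)
  refine exists_rankOne_extPull_of_basis hk.le e L hD fun f hf hex => ?_
  obtain ⟨i, hi⟩ := hex
  have := prod_le_prod_range_mul_of_card (σ := fun i => singVal L (i + 1)) h0
    (fun i j hij hj => singVal_antitone L hij hj) k
    (Finset.univ.image fun i => (f i : ℕ))
    (by intro x hx; obtain ⟨i, -, rfl⟩ := Finset.mem_image.1 hx; simp)
    (by rw [Finset.card_image_of_injective _ (fun a b hab => hf (Fin.val_injective hab))]; simp)
    ⟨f i, Finset.mem_image_of_mem _ (Finset.mem_univ _), hi⟩
  rw [Finset.prod_image (fun a _ b _ hab => hf (Fin.val_injective hab))] at this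
  simpa only [hs, singProd] using this

theorem exists_rankOne_extPull_extreme (L : M →L[ℝ] M) {k : ℕ} (hk : k = 0 ∨ k = finrank ℝ M) :
    ∃ (ξ : (M [⋀^Fin k]→L[ℝ] ℝ) →L[ℝ] ℝ) (a : M [⋀^Fin k]→L[ℝ] ℝ),
      extPull k L = ξ.smulRight a := by
  obtain ⟨e, horth, hs, hanti⟩ := exists_singular_basis L rfl
  obtain ⟨ξ, a, h⟩ := exists_rankOne_extPull_of_basis (k := k) (by omega) e L le_rfl
    (fun f hf hex => by
      exfalso
      obtain ⟨i, hi⟩ := hex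
      have h1 := i.2
      have h2 := (f i).2
      omega)
  rw [mul_zero] at h
  exact ⟨ξ, a, sub_eq_zero.1 (norm_le_zero_iff.1 h)⟩

theorem singProd_le_norm_extPull {L : M →L[ℝ] M} (hL : IsUnit L) {k : ℕ}
    (hk : k ≤ finrank ℝ M) : singProd L k ≤ (k.factorial : ℝ) * ‖extPull k L‖ := by
  obtain ⟨e, horth, hs, hanti⟩ := exists_singular_basis L rfl
  have hpos : ∀ i : Fin (finrank ℝ M), 0 < ‖L (e i)‖ := fun i => by
    rw [← hs]; exact singVal_pos L hL i.2
  set c : Fin k → Fin (finrank ℝ M) := Fin.castLE hk with hc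
  set u : Fin k → M := fun i => (‖L (e (c i))‖)⁻¹ • L (e (c i)) with hu
  have hu1 : ∀ i, ‖u i‖ ≤ 1 := fun i => by
    rw [hu, norm_smul, norm_inv, norm_norm, inv_mul_cancel₀ (hpos _).ne']
  have hval : detForm u (fun i => L (e (c i))) = singProd L k := by
    rw [detForm_apply]
    have : (Matrix.of fun j i => (inner ℝ (u i) (L (e (c j))) : ℝ)) =
        Matrix.diagonal fun i => ‖L (e (c i))‖ := by
      ext j i
      rw [Matrix.of_apply, hu, inner_smul_left]
      by_cases hij : j = i
      · subst hij
        rw [real_inner_self_eq_norm_sq, Matrix.diagonal_apply_eq]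
        have := (hpos (c j)).ne'
        simp
        field_simp
      · rw [Matrix.diagonal_apply_ne _ hij, horth]
        · simp
        · intro h
          exact hij (Fin.castLE_injective hk h).symm
    rw [this, Matrix.det_diagonal, singProd, ← Fin.prod_univ_eq_prod_range
        (fun i => singVal L (i + 1))]
    refine Finset.prod_congr rfl fun i _ => ?_
    rw [← hs]
    rfl
  have h1 : |extPull k L (detForm u) (fun i => e (c i))| ≤ ‖extPull k L (detForm u)‖ := by
    have := (extPull k L (detForm u)).le_opNorm (fun i => e (c i))
    simpa [e.orthonormal.1] using this
  have h2 := (extPull k L).le_opNorm (detForm u)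
  rw [extPull_apply, hval] at h1
  calc singProd L k ≤ _ := le_abs_self _
    _ ≤ _ := h1
    _ ≤ _ := h2
    _ ≤ ‖extPull k L‖ * (k.factorial : ℝ) := by gcongr; exact norm_detForm_le u hu1
    _ = _ := mul_comm _ _

theorem phiS_eq_exp {s : ℝ} (hs0 : 0 ≤ s) (hs1 : s ≤ (finrank ℝ M : ℕ)) :
    ∃ q : Fin (finrank ℝ M + 1) → ℝ, (∀ k, 0 ≤ q k) ∧ ∑ k, q k = 1 ∧
      ∀ L : M →L[ℝ] M, IsUnit L → phiS L s = Real.exp (∑ k, q k * Real.log (singProd L k)) := by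
  set d := finrank ℝ M with hd
  set m := ⌊s⌋₊ with hm
  have hms : (m : ℝ) ≤ s := Nat.floor_le hs0
  have hsm : s < m + 1 := Nat.lt_floor_add_one s
  have hmd : m ≤ d := by
    have : (m : ℝ) ≤ d := hms.trans hs1
    exact_mod_cast this
  rcases hmd.eq_or_lt with heq | hlt
  · refine ⟨fun k => if k = Fin.last d then 1 else 0, fun k =>
        by dsimp only; split_ifs <;> norm_num,
      by simp, fun L hL => ?_⟩
    have hsd : s = m := le_antisymm (by rw [heq]; exact hs1) hms
    have hexp : s - (m : ℝ) = 0 := by rw [← hsd, sub_self]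
    rw [phiS, ← hm, hexp, Real.rpow_zero, mul_one]
    simp only [ite_mul, one_mul, zero_mul, Finset.sum_ite_eq', Finset.mem_univ, if_true,
      Fin.val_last]
    rw [Real.exp_log (singProd_pos hL le_rfl), singProd, heq]
  · have hne : (⟨m, by omega⟩ : Fin (d + 1)) ≠ ⟨m + 1, by omega⟩ := by simp
    refine ⟨fun k => (if k = ⟨m, by omega⟩ then 1 - (s - m) else 0) +
      (if k = ⟨m + 1, by omega⟩ then s - m else 0), fun k => ?_, ?_, fun L hL => ?_⟩
    · dsimp only
      split_ifs <;> linarith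
    · rw [Finset.sum_add_distrib]
      simp
    · simp only [add_mul, ite_mul, zero_mul, Finset.sum_add_distrib, Finset.sum_ite_eq',
        Finset.mem_univ, if_true]
      have hp := singProd_pos hL hmd
      have hσ := singVal_pos L hL hlt
      have h1 : singProd L (m + 1) = singProd L m * singVal L (m + 1) := by
        rw [singProd, Finset.prod_range_succ]; rfl
      have h2 : phiS L s = singProd L m * singVal L (m + 1) ^ (s - (m : ℝ)) := rfl
      rw [h2, h1, Real.log_mul hp.ne' hσ.ne', Real.rpow_def_of_pos hσ]
      nth_rewrite 1 [← Real.exp_log hp]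
      rw [← Real.exp_add]
      congr 1
      ring

/-- Logarithmic concavity of the products of singular values. -/
theorem log_singProd_concave {L : M →L[ℝ] M} (hL : IsUnit L) {k : ℕ} (hk : k + 1 < finrank ℝ M) :
    Real.log (singProd L k) + Real.log (singProd L (k + 2)) ≤
        2 * Real.log (singProd L (k + 1)) := by
  have h1 : singProd L (k + 1) = singProd L k * singVal L (k + 1) := Finset.prod_range_succ _ _
  have h2 : singProd L (k + 2) = singProd L (k + 1) * singVal L (k + 2) :=
    Finset.prod_range_succ _ _
  have hp := singProd_pos hL (k := k) (by omega)
  have hp1 := singProd_pos hL (k := k + 1) (by omega)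
  have hσ1 := singVal_pos L hL (i := k) (by omega)
  have hσ2 := singVal_pos L hL (i := k + 1) (by omega)
  have hle := Real.log_le_log hσ2 (singVal_antitone L (Nat.le_succ k) hk)
  rw [h2, Real.log_mul hp1.ne' hσ2.ne', h1, Real.log_mul hp.ne' hσ1.ne']
  linarith

theorem exists_log_norm_extPull_bound (M : Type*) [NormedAddCommGroup M] [InnerProductSpace ℝ M]
    [FiniteDimensional ℝ M] :
    ∃ C : ℝ, 0 ≤ C ∧ ∀ L : M →L[ℝ] M, IsUnit L → ∀ k ≤ finrank ℝ M,
      0 < ‖extPull k L‖ ∧ |Real.log ‖extPull k L‖ - Real.log (singProd L k)| ≤ C := by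
  set d := finrank ℝ M with hd
  refine ⟨Real.log (d.factorial : ℝ) + d * Real.log (d + 1), ?_, fun L hL k hk => ?_⟩
  · have h1 : (0 : ℝ) ≤ Real.log (d.factorial : ℝ) :=
      Real.log_nonneg (by exact_mod_cast Nat.one_le_iff_ne_zero.2 d.factorial_ne_zero)
    have h2 : (0 : ℝ) ≤ Real.log (d + 1) := Real.log_nonneg
        (by linarith [Nat.cast_nonneg (α := ℝ) d])
    positivity
  have hp := singProd_pos hL hk
  have hlow := singProd_le_norm_extPull hL hk
  have hup := norm_extPull_le_singProd L hk
  have hfk : (0 : ℝ) < k.factorial := by exact_mod_cast k.factorial_pos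
  have hN : 0 < ‖extPull k L‖ := by
    by_contra hcon
    have : ‖extPull k L‖ = 0 := le_antisymm (not_lt.1 hcon) (norm_nonneg (extPull k L))
    rw [this, mul_zero] at hlow
    linarith
  refine ⟨hN, ?_⟩
  have h1 : Real.log (singProd L k) ≤ Real.log (k.factorial : ℝ) + Real.log ‖extPull k L‖ := by
    rw [← Real.log_mul hfk.ne' hN.ne']
    exact Real.log_le_log hp hlow
  have hup' : ‖extPull k L‖ ≤ ((d : ℝ) + 1) ^ d * singProd L k := by
    refine hup.trans (mul_le_mul_of_nonneg_right ?_ hp.le)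
    calc ((d : ℝ)) ^ k ≤ ((d : ℝ) + 1) ^ k := by gcongr; linarith
      _ ≤ ((d : ℝ) + 1) ^ d := pow_le_pow_right₀ (by linarith [Nat.cast_nonneg (α := ℝ) d]) hk
  have h2 : Real.log ‖extPull k L‖ ≤ d * Real.log (d + 1) + Real.log (singProd L k) := by
    rw [← Real.log_pow, ← Real.log_mul (by positivity) hp.ne']
    exact Real.log_le_log hN hup'
  have h3 : Real.log (k.factorial : ℝ) ≤ Real.log (d.factorial : ℝ) :=
    Real.log_le_log hfk (by exact_mod_cast Nat.factorial_le hk)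
  have h4 : (0 : ℝ) ≤ Real.log (d.factorial : ℝ) :=
    Real.log_nonneg (by exact_mod_cast Nat.one_le_iff_ne_zero.2 d.factorial_ne_zero)
  have h5 : (0 : ℝ) ≤ d * Real.log (d + 1) :=
    mul_nonneg (Nat.cast_nonneg _) (Real.log_nonneg (by linarith [Nat.cast_nonneg (α := ℝ) d]))
  rw [abs_le]
  constructor <;> linarith

end SingularValueProducts

section CocycleBounds

open Module

variable {M : Type*} [NormedAddCommGroup M] [InnerProductSpace ℝ M]
variable {A : Type*} {Tr : A → A → Prop}

theorem shift_iterate_apply (x : SFT Tr) (m i : ℕ) :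
    ((shiftSFT Tr)^[m] x).1 i = x.1 (m + i) := by
  induction m generalizing x with
  | zero => simp
  | succ m ih =>
    rw [Function.iterate_succ_apply, ih]
    show x.1 (m + i + 1) = x.1 (m + 1 + i)
    rw [Nat.add_right_comm]

theorem cocycle_add (Amap : SFT Tr → (M →L[ℝ] M)) (m n : ℕ) (x : SFT Tr) :
    cocycle Tr Amap (m + n) x =
      (cocycle Tr Amap n ((shiftSFT Tr)^[m] x)).comp (cocycle Tr Amap m x) := by
  induction m generalizing x with
  | zero => simp [cocycle]
  | succ m ih =>
    rw [Nat.succ_add, cocycle, ih, Function.iterate_succ_apply]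
    rfl

/-- The cocycle acting on alternating forms of degree `k`. -/
noncomputable def pullCoc (Amap : SFT Tr → (M →L[ℝ] M)) (k n : ℕ) (x : SFT Tr) :
    (M [⋀^Fin k]→L[ℝ] ℝ) →L[ℝ] (M [⋀^Fin k]→L[ℝ] ℝ) :=
  extPull k (cocycle Tr Amap n x)

theorem pullCoc_zero (Amap : SFT Tr → (M →L[ℝ] M)) (k : ℕ) (x : SFT Tr) :
    pullCoc Amap k 0 x = ContinuousLinearMap.id ℝ _ := extPull_id k

theorem pullCoc_add (Amap : SFT Tr → (M →L[ℝ] M)) (k m n : ℕ) (x : SFT Tr) :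
    pullCoc Amap k (m + n) x =
      (pullCoc Amap k m x).comp (pullCoc Amap k n ((shiftSFT Tr)^[m] x)) := by
  rw [pullCoc, cocycle_add, extPull_comp]
  rfl

/-- The logarithmic norm of the cocycle on forms of degree `k`. -/
noncomputable def logNorm (Amap : SFT Tr → (M →L[ℝ] M)) (k n : ℕ) (x : SFT Tr) : ℝ :=
  Real.log ‖pullCoc Amap k n x‖

theorem isUnit_cocycle {Amap : SFT Tr → (M →L[ℝ] M)} (h : ∀ x, IsUnit (Amap x)) (n : ℕ)
    (x : SFT Tr) : IsUnit (cocycle Tr Amap n x) := by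
  induction n generalizing x with
  | zero => exact isUnit_one
  | succ n ih => exact (ih (shiftSFT Tr x)).mul (h x)

theorem norm_cocycle_le {Amap : SFT Tr → (M →L[ℝ] M)} {R : ℝ} (hR : 0 ≤ R)
    (h : ∀ x, ‖Amap x‖ ≤ R) (n : ℕ) (x : SFT Tr) : ‖cocycle Tr Amap n x‖ ≤ R ^ n := by
  induction n generalizing x with
  | zero => simpa [cocycle] using ContinuousLinearMap.norm_id_le
  | succ n ih =>
    rw [cocycle, pow_succ]
    exact (ContinuousLinearMap.opNorm_comp_le _ _).trans
      (mul_le_mul (ih _) (h x) (norm_nonneg _) (by positivity))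

theorem norm_cocycle_sub_le {Amap Bmap : SFT Tr → (M →L[ℝ] M)} {R e : ℝ} (hR : 1 ≤ R) (he : 0 ≤ e)
    (hA : ∀ x, ‖Amap x‖ ≤ R) (hB : ∀ x, ‖Bmap x‖ ≤ R) (n : ℕ) (x y : SFT Tr)
    (h : ∀ j < n, ‖Bmap ((shiftSFT Tr)^[j] x) - Amap ((shiftSFT Tr)^[j] y)‖ ≤ e) :
    ‖cocycle Tr Bmap n x - cocycle Tr Amap n y‖ ≤ n * R ^ n * e := by
  have hR0 : 0 ≤ R := by linarith
  induction n generalizing x y with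
  | zero => simp [cocycle]
  | succ n ih =>
    have h1 : cocycle Tr Bmap (n + 1) x - cocycle Tr Amap (n + 1) y =
        (cocycle Tr Bmap n (shiftSFT Tr x) - cocycle Tr Amap n (shiftSFT Tr y)).comp (Bmap x) +
        (cocycle Tr Amap n (shiftSFT Tr y)).comp (Bmap x - Amap y) := by
      simp [cocycle]
    have h2 := ih (shiftSFT Tr x) (shiftSFT Tr y) fun j hj => by
      have := h (j + 1) (by omega)
      rwa [Function.iterate_succ_apply, Function.iterate_succ_apply] at this
    have h3 : ‖Bmap x - Amap y‖ ≤ e := h 0 (by omega)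
    rw [h1]
    calc _ ≤ _ := norm_add_le _ _
      _ ≤ (n * R ^ n * e) * R + R ^ n * e := by
        refine add_le_add ?_ ?_
        · exact (ContinuousLinearMap.opNorm_comp_le _ _).trans
            (mul_le_mul h2 (hB x) (norm_nonneg _) (by positivity))
        · exact (ContinuousLinearMap.opNorm_comp_le _ _).trans
            (mul_le_mul (norm_cocycle_le hR0 hA _ _) h3 (norm_nonneg _) (by positivity))
      _ ≤ (n * R ^ n * e) * R + R ^ n * e * R := by
        have : R ^ n * e ≤ R ^ n * e * R := le_mul_of_one_le_right (by positivity) hR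
        linarith
      _ = _ := by push_cast; ring

theorem norm_pullCoc_sub_le {Amap Bmap : SFT Tr → (M →L[ℝ] M)} {R e : ℝ} (hR : 1 ≤ R)
    (he : 0 ≤ e) (hA : ∀ x, ‖Amap x‖ ≤ R) (hB : ∀ x, ‖Bmap x‖ ≤ R) (k n : ℕ) (x y : SFT Tr)
    (h : ∀ j < n, ‖Bmap ((shiftSFT Tr)^[j] x) - Amap ((shiftSFT Tr)^[j] y)‖ ≤ e) :
    ‖pullCoc Bmap k n x - pullCoc Amap k n y‖ ≤ k * (R ^ n) ^ k * (n * R ^ n * e) := by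
  have hR0 : 0 ≤ R := by linarith
  refine (norm_extPull_sub_le k _ _ (one_le_pow₀ hR) (norm_cocycle_le hR0 hB n x)
    (norm_cocycle_le hR0 hA n y)).trans ?_
  gcongr
  exact norm_cocycle_sub_le hR he hA hB n x y h

theorem norm_pullCoc_le {Amap : SFT Tr → (M →L[ℝ] M)} {R : ℝ} (hR : 1 ≤ R)
    (hA : ∀ x, ‖Amap x‖ ≤ R) {k d : ℕ} (hk : k ≤ d) (n : ℕ) (x : SFT Tr) :
    ‖pullCoc Amap k n x‖ ≤ (R ^ d) ^ n := by
  refine (norm_extPull_le k _).trans ?_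
  calc ‖cocycle Tr Amap n x‖ ^ k ≤ (R ^ n) ^ k := by
        gcongr
        exact norm_cocycle_le (by linarith) hA n x
    _ ≤ (R ^ n) ^ d := pow_le_pow_right₀ (one_le_pow₀ hR) hk
    _ = _ := by rw [← pow_mul, ← pow_mul, mul_comm]

theorem norm_le_pullCoc {Amap : SFT Tr → (M →L[ℝ] M)} {R : ℝ} (hR : 1 ≤ R)
    (hA : ∀ x, IsUnit (Amap x)) (hinv : ∀ x, ‖Ring.inverse (Amap x)‖ ≤ R) {k d : ℕ} (hk : k ≤ d)
    (n : ℕ) (x : SFT Tr) (v : M [⋀^Fin k]→L[ℝ] ℝ) :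
    ‖v‖ ≤ (R ^ d) ^ n * ‖pullCoc Amap k n x v‖ := by
  induction n generalizing x v with
  | zero => simp [pullCoc_zero]
  | succ n ih =>
    have h1 : pullCoc Amap k (n + 1) x v =
        extPull k (Amap x) (pullCoc Amap k n (shiftSFT Tr x) v) := by
      rw [pullCoc, cocycle, extPull_comp]
      rfl
    have h2 : ∀ w : M [⋀^Fin k]→L[ℝ] ℝ, ‖w‖ ≤ R ^ d * ‖extPull k (Amap x) w‖ := by
      intro w
      have h3 : (Amap x).comp (Ring.inverse (Amap x)) = ContinuousLinearMap.id ℝ M :=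
        Ring.mul_inverse_cancel _ (hA x)
      have h4 : extPull k (Ring.inverse (Amap x)) (extPull k (Amap x) w) = w := by
        have := congrArg (fun L => extPull k L w) h3
        simpa [extPull_comp, extPull_id] using this
      calc ‖w‖ = ‖extPull k (Ring.inverse (Amap x)) (extPull k (Amap x) w)‖ := by rw [h4]
        _ ≤ ‖extPull k (Ring.inverse (Amap x))‖ * ‖extPull k (Amap x) w‖ :=
          ContinuousLinearMap.le_opNorm _ _
        _ ≤ R ^ d * ‖extPull k (Amap x) w‖ := by
          gcongr
          calc _ ≤ ‖Ring.inverse (Amap x)‖ ^ k := norm_extPull_le _ _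
            _ ≤ R ^ k := by gcongr; exact hinv x
            _ ≤ R ^ d := pow_le_pow_right₀ hR hk
    calc ‖v‖ ≤ (R ^ d) ^ n * ‖pullCoc Amap k n (shiftSFT Tr x) v‖ := ih _ _
      _ ≤ (R ^ d) ^ n * (R ^ d * ‖pullCoc Amap k (n + 1) x v‖) := by
        rw [h1]
        gcongr
        exact h2 _
      _ = _ := by rw [pow_succ]; ring

variable [FiniteDimensional ℝ M]

theorem exists_uniform_bound [Fintype A] {Amap : SFT Tr → (M →L[ℝ] M)}
    (hA : HolderCocycle Tr Amap) (hinv : ∀ x, IsUnit (Amap x)) :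
    ∃ R : ℝ, 1 ≤ R ∧ ∀ x, ‖Amap x‖ ≤ R ∧ ‖Ring.inverse (Amap x)‖ ≤ R := by
  have : CompleteSpace M := FiniteDimensional.complete ℝ M
  let : TopologicalSpace A := ⊥
  have : DiscreteTopology A := ⟨rfl⟩
  have hclosed : IsClosed {x : ℕ → A | ∀ n : ℕ, Tr (x n) (x (n + 1))} := by
    rw [Set.ofPred_forall]
    refine isClosed_iInter fun n => ?_
    have hc : Continuous fun x : ℕ → A => (x n, x (n + 1)) := by fun_prop
    exact (isClosed_discrete {p : A × A | Tr p.1 p.2}).preimage hc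
  have : CompactSpace (SFT Tr) := isCompact_iff_compactSpace.1 hclosed.isCompact
  have hcont : Continuous Amap := by
    obtain ⟨C, hC, θ, hθ0, hθ1, h⟩ := hA
    rw [continuous_iff_continuousAt]
    intro x
    rw [ContinuousAt, Metric.tendsto_nhds]
    intro ε hε
    have hlim : Tendsto (fun n : ℕ => C * θ ^ n) atTop (𝓝 (C * 0)) :=
      (tendsto_pow_atTop_nhds_zero_of_lt_one hθ0.le hθ1).const_mul C
    rw [mul_zero] at hlim
    obtain ⟨n, hn⟩ := (hlim.eventually (gt_mem_nhds hε)).exists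
    have hev : ∀ i ∈ Finset.range n, ∀ᶠ y : SFT Tr in 𝓝 x, y.1 i = x.1 i := by
      intro i _
      have hc : Continuous fun y : SFT Tr => y.1 i :=
        (continuous_apply i).comp continuous_subtype_val
      exact hc.continuousAt.eventually (eventually_mem_set.2 (mem_nhds_discrete.2 rfl) :
        ∀ᶠ a in 𝓝 (x.1 i), a ∈ ({x.1 i} : Set A))
    filter_upwards [(Finset.eventually_all (Finset.range n)).2 hev] with y hy
    rw [dist_eq_norm]
    exact (h y x n fun i hi => hy i (Finset.mem_range.2 hi)).trans_lt hn
  have hcont' : Continuous fun x => Ring.inverse (Amap x) := by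
    rw [continuous_iff_continuousAt]
    intro x
    obtain ⟨u, hu⟩ := hinv x
    exact ContinuousAt.comp (hu ▸ NormedRing.inverse_continuousAt u) hcont.continuousAt
  obtain ⟨R1, h1⟩ := isCompact_univ.exists_bound_of_continuousOn hcont.continuousOn
  obtain ⟨R2, h2⟩ := isCompact_univ.exists_bound_of_continuousOn hcont'.continuousOn
  exact ⟨max 1 (max R1 R2), le_max_left _ _, fun x =>
    ⟨(h1 x trivial).trans ((le_max_left _ _).trans (le_max_right _ _)),
      (h2 x trivial).trans ((le_max_right _ _).trans (le_max_right _ _))⟩⟩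

theorem pullCoc_norm_pos {Amap : SFT Tr → (M →L[ℝ] M)} (hA : ∀ x, IsUnit (Amap x)) {k : ℕ}
    (hk : k ≤ finrank ℝ M) (n : ℕ) (x : SFT Tr) : 0 < ‖pullCoc Amap k n x‖ := by
  obtain ⟨C, -, h⟩ := exists_log_norm_extPull_bound M
  exact (h _ (isUnit_cocycle hA n x) k hk).1

theorem abs_logNorm_le {Amap : SFT Tr → (M →L[ℝ] M)} {R : ℝ} (hR : 1 ≤ R)
    (hA : ∀ x, IsUnit (Amap x)) (hb : ∀ x, ‖Amap x‖ ≤ R ∧ ‖Ring.inverse (Amap x)‖ ≤ R) {k : ℕ}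
    (hk : k ≤ finrank ℝ M) (n : ℕ) (x : SFT Tr) :
    |logNorm Amap k n x| ≤ n * Real.log (R ^ finrank ℝ M) := by
  have hpos := pullCoc_norm_pos hA hk n x
  set R' := R ^ finrank ℝ M
  have hR' : 1 ≤ R' := one_le_pow₀ hR
  have hR'0 : 0 < R' := by linarith
  have h1 := norm_pullCoc_le hR (fun x => (hb x).1) hk n x
  obtain ⟨v, hv⟩ : ∃ v, pullCoc Amap k n x v ≠ 0 := by
    by_contra hcon
    push Not at hcon
    refine hpos.not_ge (ContinuousLinearMap.opNorm_le_bound _ le_rfl fun v => ?_)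
    rw [hcon v, zero_mul]
    exact norm_zero.le
  have hv0 : 0 < ‖v‖ := norm_pos_iff.2 fun h => hv (by rw [h, map_zero])
  have h2 := norm_le_pullCoc hR hA (fun x => (hb x).2) hk n x v
  have h3 : 1 ≤ R' ^ n * ‖pullCoc Amap k n x‖ := by
    have : ‖v‖ ≤ (R' ^ n * ‖pullCoc Amap k n x‖) * ‖v‖ := by
      calc ‖v‖ ≤ _ := h2
        _ ≤ R' ^ n * (‖pullCoc Amap k n x‖ * ‖v‖) := by
          gcongr
          exact ContinuousLinearMap.le_opNorm _ _
        _ = _ := by ring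
    exact le_of_mul_le_mul_right (by linarith) hv0
  rw [abs_le, logNorm, ← Real.log_pow]
  constructor
  · have := Real.log_nonneg h3
    rw [Real.log_mul (by positivity) hpos.ne'] at this
    linarith
  · exact Real.log_le_log hpos h1

theorem logNorm_add_le {Amap : SFT Tr → (M →L[ℝ] M)} (hA : ∀ x, IsUnit (Amap x)) {k : ℕ}
    (hk : k ≤ finrank ℝ M) (m n : ℕ) (x : SFT Tr) :
    logNorm Amap k (m + n) x ≤ logNorm Amap k m x + logNorm Amap k n ((shiftSFT Tr)^[m] x) := by
  have h0 := pullCoc_norm_pos hA hk (m + n) x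
  have h1 := pullCoc_norm_pos hA hk m x
  have h2 := pullCoc_norm_pos hA hk n ((shiftSFT Tr)^[m] x)
  rw [logNorm, logNorm, logNorm, ← Real.log_mul h1.ne' h2.ne']
  refine Real.log_le_log h0 ?_
  rw [pullCoc_add]
  exact ContinuousLinearMap.opNorm_comp_le _ _

end CocycleBounds

section WordSums

variable {A : Type*} {Tr : A → A → Prop}

/-- The cylinder of a word. -/
def cyl (Tr : A → A → Prop) {n : ℕ} (w : Fin n → A) : Set (SFT Tr) :=
  {y | ∀ i : Fin n, y.1 i = w i}

theorem bddAbove_image_cyl {ψ : SFT Tr → ℝ} (hb : BddAbove (range ψ)) {n : ℕ} (w : Fin n → A) :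
    BddAbove (ψ '' cyl Tr w) := hb.mono (image_subset_range _ _)

theorem sSup_cyl_nonneg {ψ : SFT Tr → ℝ} (h0 : ∀ x, 0 ≤ ψ x) {n : ℕ} (w : Fin n → A) :
    0 ≤ sSup (ψ '' cyl Tr w) := by
  refine Real.sSup_nonneg ?_
  rintro _ ⟨x, -, rfl⟩
  exact h0 x

theorem le_sSup_cyl {ψ : SFT Tr → ℝ} (hb : BddAbove (range ψ)) {n : ℕ} {w : Fin n → A}
    {x : SFT Tr} (hx : x ∈ cyl Tr w) : ψ x ≤ sSup (ψ '' cyl Tr w) :=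
  le_csSup (bddAbove_image_cyl hb w) (mem_image_of_mem _ hx)

variable [Fintype A]

/-- The sum over words of length `n` of the suprema of a function over cylinders. -/
noncomputable def wsum (n : ℕ) (ψ : SFT Tr → ℝ) : ℝ :=
  ∑ w : Fin n → A, sSup (ψ '' cyl Tr w)

theorem wsum_nonneg {ψ : SFT Tr → ℝ} (h0 : ∀ x, 0 ≤ ψ x) (n : ℕ) : 0 ≤ wsum n ψ :=
  Finset.sum_nonneg fun w _ => sSup_cyl_nonneg h0 w

theorem wsum_le_mul {ψ ψ' : SFT Tr → ℝ} {c : ℝ} (hc : 0 ≤ c) (h0 : ∀ x, 0 ≤ ψ' x)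
    (hb : BddAbove (range ψ')) (h : ∀ x, ψ x ≤ c * ψ' x) (n : ℕ) :
    wsum n ψ ≤ c * wsum n ψ' := by
  rw [wsum, wsum, Finset.mul_sum]
  refine Finset.sum_le_sum fun w _ => Real.sSup_le ?_ (mul_nonneg hc (sSup_cyl_nonneg h0 w))
  rintro _ ⟨x, hx, rfl⟩
  exact (h x).trans (mul_le_mul_of_nonneg_left (le_sSup_cyl hb hx) hc)

theorem wsum_mono {ψ ψ' : SFT Tr → ℝ} (h0 : ∀ x, 0 ≤ ψ' x)
    (hb : BddAbove (range ψ')) (h : ∀ x, ψ x ≤ ψ' x) (n : ℕ) : wsum n ψ ≤ wsum n ψ' := by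
  simpa using wsum_le_mul zero_le_one h0 hb (fun x => by simpa using h x) n

theorem wsum_sum_le {ι : Type*} (s : Finset ι) {ψ : SFT Tr → ℝ} {f : ι → SFT Tr → ℝ}
    (h0 : ∀ i ∈ s, ∀ x, 0 ≤ f i x) (hb : ∀ i ∈ s, BddAbove (range (f i)))
    (h : ∀ x, ψ x ≤ ∑ i ∈ s, f i x) (n : ℕ) : wsum n ψ ≤ ∑ i ∈ s, wsum n (f i) := by
  simp only [wsum]
  rw [Finset.sum_comm]
  refine Finset.sum_le_sum fun w _ => Real.sSup_le ?_
    (Finset.sum_nonneg fun i hi => sSup_cyl_nonneg (h0 i hi) w)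
  rintro _ ⟨x, hx, rfl⟩
  exact (h x).trans (Finset.sum_le_sum fun i hi => le_sSup_cyl (hb i hi) hx)

theorem wsum_add_le {ψ f g : SFT Tr → ℝ} (hf : ∀ x, 0 ≤ f x) (hg : ∀ x, 0 ≤ g x)
    (hbf : BddAbove (range f)) (hbg : BddAbove (range g)) (h : ∀ x, ψ x ≤ f x + g x) (n : ℕ) :
    wsum n ψ ≤ wsum n f + wsum n g := by
  have := wsum_sum_le (Finset.univ : Finset Bool) (ψ := ψ) (f := fun b => if b then f else g)
    (by intro b _ x; cases b; exacts [hg x, hf x])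
    (by intro b _; cases b; exacts [hbg, hbf]) (by simpa using h) n
  simpa using this

theorem wsum_submul {ψ f g : SFT Tr → ℝ} (hf : ∀ x, 0 ≤ f x) (hg : ∀ x, 0 ≤ g x)
    (hbf : BddAbove (range f)) (hbg : BddAbove (range g)) (m n : ℕ)
    (h : ∀ x, ψ x ≤ f x * g ((shiftSFT Tr)^[m] x)) :
    wsum (m + n) ψ ≤ wsum m f * wsum n g := by
  rw [wsum, wsum, wsum, Finset.sum_mul_sum, ← Finset.sum_product', Finset.univ_product_univ,
    ← Equiv.sum_comp (Fin.appendEquiv m n)]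
  refine Finset.sum_le_sum fun w _ => Real.sSup_le ?_
    (mul_nonneg (sSup_cyl_nonneg hf _) (sSup_cyl_nonneg hg _))
  rintro _ ⟨x, hx, rfl⟩
  refine (h x).trans (mul_le_mul (le_sSup_cyl hbf ?_) (le_sSup_cyl hbg ?_) (hg _)
    (sSup_cyl_nonneg hf _))
  · intro i
    have := hx (Fin.castAdd n i)
    simpa [Fin.appendEquiv] using this
  · intro i
    rw [shift_iterate_apply]
    have := hx (Fin.natAdd m i)
    simpa [Fin.appendEquiv] using this

theorem wsum_le_card_mul {ψ : SFT Tr → ℝ} (E : Set (SFT Tr)) {K : ℝ} (hK : 0 ≤ K)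
    (hE : ∀ x ∉ E, ψ x = 0) (h : ∀ x ∈ E, ψ x ≤ K) (n : ℕ) (W : Finset (Fin n → A))
    (hW : ∀ x ∈ E, (fun i : Fin n => x.1 i) ∈ W) : wsum n ψ ≤ W.card * K := by
  classical
  rw [wsum, ← Finset.sum_subset (Finset.subset_univ W), ← nsmul_eq_mul]
  · refine Finset.sum_le_card_nsmul _ _ _ fun w _ => Real.sSup_le ?_ hK
    rintro _ ⟨x, -, rfl⟩
    by_cases hx : x ∈ E
    · exact h x hx
    · rw [hE x hx]
      exact hK
  · intro w _ hw
    have hz : ∀ x ∈ cyl Tr w, ψ x = 0 := by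
      intro x hx
      refine hE x fun hxE => hw ?_
      convert hW x hxE using 1
      ext i
      exact (hx i).symm
    refine le_antisymm (Real.sSup_le ?_ le_rfl) (Real.sSup_nonneg ?_)
    all_goals
      rintro _ ⟨x, hx, rfl⟩
      rw [hz x hx]

theorem card_mul_le_wsum {ψ : SFT Tr → ℝ} (h0 : ∀ x, 0 ≤ ψ x) (hb : BddAbove (range ψ)) {n : ℕ}
    {κ : Type*} [Fintype κ] (w : κ → Fin n → A) (hw : Function.Injective w) {c : ℝ}
    (h : ∀ a, ∃ x ∈ cyl Tr (w a), c ≤ ψ x) : Fintype.card κ * c ≤ wsum n ψ := by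
  classical
  calc Fintype.card κ * c = ∑ _a : κ, c := by simp
    _ ≤ ∑ a : κ, sSup (ψ '' cyl Tr (w a)) := by
        refine Finset.sum_le_sum fun a _ => ?_
        obtain ⟨x, hx, hc⟩ := h a
        exact hc.trans (le_sSup_cyl hb hx)
    _ = ∑ v ∈ Finset.univ.image w, sSup (ψ '' cyl Tr v) := by
        rw [Finset.sum_image fun a _ b _ hab => hw hab]
    _ ≤ wsum n ψ := Finset.sum_le_sum_of_subset_of_nonneg (Finset.subset_univ _)
        fun v _ _ => sSup_cyl_nonneg h0 v

theorem le_wsum {ψ : SFT Tr → ℝ} (h0 : ∀ x, 0 ≤ ψ x) (hb : BddAbove (range ψ)) (n : ℕ)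
    (x : SFT Tr) : ψ x ≤ wsum n ψ := by
  have := card_mul_le_wsum (κ := Unit) h0 hb (n := n) (fun _ i => x.1 i) (fun _ _ _ => rfl)
    (c := ψ x) (fun _ => ⟨x, fun _ => rfl, le_rfl⟩)
  simpa using this

theorem wordSum_eq_wsum {M : Type*} [NormedAddCommGroup M] [InnerProductSpace ℝ M]
    [FiniteDimensional ℝ M] (Amap : SFT Tr → (M →L[ℝ] M)) (s : ℝ) (n : ℕ) :
    wordSum Tr Amap s n = wsum n fun y => phiS (cocycle Tr Amap n y) s := by
  classical
  rw [wordSum, wsum]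
  refine (Finset.sum_subset (Finset.subset_univ _) fun w _ hw => ?_).trans ?_
  · have : {y : SFT Tr | ∀ i : Fin n, y.1 i = w i} = ∅ := by
      rw [Set.eq_empty_iff_forall_notMem]
      intro y hy
      refine hw (Finset.mem_filter.2 ⟨Finset.mem_univ _, fun i hi => ?_⟩)
      have h1 := hy ⟨i, Nat.lt_of_succ_lt hi⟩
      have h2 := hy ⟨i + 1, hi⟩
      rw [← h1, ← h2]
      exact y.2 i
    rw [this, image_empty, Real.sSup_empty]
  · rfl

end WordSums

section Growth

/-- The exponential growth rate of a sequence. -/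
noncomputable def growthRate (Z : ℕ → ℝ) : ℝ :=
  limsup (fun n : ℕ => Real.log (Z n) / n) atTop

variable {Z : ℕ → ℝ} {K : ℝ}

theorem abs_log_div_le (hK : ∀ n : ℕ, |Real.log (Z n)| ≤ K * (n + 1)) (n : ℕ) :
    |Real.log (Z n) / n| ≤ 2 * K := by
  have hK0 : 0 ≤ K := by simpa using (abs_nonneg _).trans (hK 0)
  rcases Nat.eq_zero_or_pos n with rfl | hn
  · simpa using hK0
  have h1 : (1 : ℝ) ≤ n := by exact_mod_cast hn
  rw [abs_div, Nat.abs_cast, div_le_iff₀ (by linarith)]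
  refine (hK n).trans ?_
  nlinarith

theorem le_growthRate_exp (hZ : ∀ n, 0 < Z n) (hK : ∀ n : ℕ, |Real.log (Z n)| ≤ K * (n + 1))
    {c : ℝ} (hc : 0 < c) :
    ∃ C : ℝ, 1 ≤ C ∧ ∀ n : ℕ, Z n ≤ C * Real.exp (n * (growthRate Z + c)) := by
  have hb : IsBoundedUnder (· ≤ ·) atTop (fun n : ℕ => Real.log (Z n) / n) :=
    isBoundedUnder_of ⟨2 * K, fun n => (abs_le.1 (abs_log_div_le hK n)).2⟩
  have hev : ∀ᶠ n : ℕ in atTop, Real.log (Z n) / n < growthRate Z + c :=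
    eventually_lt_of_limsup_lt (by rw [growthRate]; linarith) hb
  obtain ⟨N, hN⟩ := (hev.and (eventually_ge_atTop 1)).exists_forall_of_atTop
  have hb' : ∃ B : ℝ, ∀ n < N, Z n * Real.exp (-(n * (growthRate Z + c))) ≤ B := by
    obtain ⟨B, hB⟩ := ((Finset.range N).image
      (fun n : ℕ => Z n * Real.exp (-(n * (growthRate Z + c))))).bddAbove
    exact ⟨B, fun n hn => hB (by
      rw [Finset.mem_coe]
      exact Finset.mem_image_of_mem _ (Finset.mem_range.2 hn))⟩
  obtain ⟨B, hB⟩ := hb'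
  refine ⟨max 1 B, le_max_left _ _, fun n => ?_⟩
  rcases lt_or_ge n N with hn | hn
  · have := hB n hn
    rw [Real.exp_neg, ← div_eq_mul_inv, div_le_iff₀ (Real.exp_pos _)] at this
    exact this.trans (mul_le_mul_of_nonneg_right (le_max_right _ _) (Real.exp_pos _).le)
  · obtain ⟨h1, h2⟩ := hN n hn
    have h3 : (0 : ℝ) < n := by exact_mod_cast h2
    rw [div_lt_iff₀ h3, Real.log_lt_iff_lt_exp (hZ n), mul_comm] at h1
    refine h1.le.trans ?_
    exact le_mul_of_one_le_left (Real.exp_pos _).le (le_max_left _ _)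

theorem growthRate_le (hZ : ∀ n, 0 < Z n) (hK : ∀ n : ℕ, |Real.log (Z n)| ≤ K * (n + 1))
    {C p : ℝ} (h : ∀ n : ℕ, Z n ≤ C * Real.exp (n * p)) : growthRate Z ≤ p := by
  have hC : 0 < C := by
    have := (hZ 0).trans_le (h 0)
    simpa using this
  have hb : IsCoboundedUnder (· ≤ ·) atTop (fun n : ℕ => Real.log (Z n) / n) :=
    (isBoundedUnder_of ⟨-(2 * K), fun n => (abs_le.1 (abs_log_div_le hK n)).1⟩ :
      IsBoundedUnder (· ≥ ·) atTop (fun n : ℕ => Real.log (Z n) / n)).isCoboundedUnder_le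
  have ht : Tendsto (fun n : ℕ => Real.log C / n + p) atTop (𝓝 (0 + p)) :=
    (tendsto_const_div_atTop_nhds_zero_nat _).add_const p
  rw [zero_add] at ht
  rw [← ht.limsup_eq, growthRate]
  refine limsup_le_limsup ?_ hb ht.isBoundedUnder_le
  filter_upwards [eventually_ge_atTop 1] with n hn
  have h3 : (0 : ℝ) < n := by exact_mod_cast hn
  have := Real.log_le_log (hZ n) (h n)
  rw [Real.log_mul hC.ne' (Real.exp_pos _).ne', Real.log_exp] at this
  rw [div_add' _ _ _ h3.ne']
  gcongr
  linarith

theorem le_growthRate (hZ : ∀ n, 0 < Z n) (hK : ∀ n : ℕ, |Real.log (Z n)| ≤ K * (n + 1))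
    {c p : ℝ} {N : ℕ} (hN : 1 ≤ N) (hc : 0 < c)
    (h : ∀ m : ℕ, 1 ≤ m → c * Real.exp ((m * N : ℕ) * p) ≤ Z (m * N)) : p ≤ growthRate Z := by
  refine le_of_forall_pos_le_add fun e he => ?_
  obtain ⟨C, hC, hu⟩ := le_growthRate_exp hZ hK (half_pos he)
  have hN' : (1 : ℝ) ≤ N := by exact_mod_cast hN
  obtain ⟨m, hm⟩ := exists_nat_gt ((Real.log C - Real.log c) / (e / 2))
  have h1 := Real.log_le_log (by positivity) ((h (m + 1) (by omega)).trans (hu _))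
  rw [Real.log_mul hc.ne' (Real.exp_pos _).ne', Real.log_exp,
    Real.log_mul (by positivity) (Real.exp_pos _).ne', Real.log_exp] at h1
  rw [div_lt_iff₀ (by positivity)] at hm
  by_contra! hcon
  push_cast at h1
  have h2 : (m + 1 : ℝ) * N * (e / 2) ≤ (m + 1 : ℝ) * N * (p - growthRate Z - e / 2) := by
    gcongr
    linarith
  have h3 : (m : ℝ) * (e / 2) ≤ (m + 1 : ℝ) * N * (e / 2) := by
    have : (m : ℝ) ≤ (m + 1) * N := by nlinarith [(Nat.cast_nonneg m : (0 : ℝ) ≤ m)]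
    gcongr
  linarith

theorem growthRate_mono {Z' : ℕ → ℝ} {K' : ℝ} (hZ : ∀ n, 0 < Z n)
    (hK : ∀ n : ℕ, |Real.log (Z n)| ≤ K * (n + 1)) (hZ' : ∀ n, 0 < Z' n)
    (hK' : ∀ n : ℕ, |Real.log (Z' n)| ≤ K' * (n + 1)) {C p : ℝ} (hC : 0 ≤ C)
    (h : ∀ n : ℕ, Z n ≤ C * Real.exp (n * p) * Z' n) : growthRate Z ≤ growthRate Z' + p := by
  refine le_of_forall_pos_le_add fun e he => ?_
  obtain ⟨C', hC', hu⟩ := le_growthRate_exp hZ' hK' he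
  refine growthRate_le hZ hK (C := C * C') fun n => (h n).trans ?_
  calc C * Real.exp (n * p) * Z' n
      ≤ C * Real.exp (n * p) * (C' * Real.exp (n * (growthRate Z' + e))) := by
        gcongr
        exact hu n
    _ = C * C' * (Real.exp (n * p) * Real.exp (n * (growthRate Z' + e))) := by ring
    _ = _ := by
        rw [← Real.exp_add]
        congr 2
        ring

theorem exp_growthRate_le (hZ : ∀ n, 0 < Z n) (hK : ∀ n : ℕ, |Real.log (Z n)| ≤ K * (n + 1))
    (hsub : ∀ m n, Z (m + n) ≤ Z m * Z n) {n : ℕ} (hn : 1 ≤ n) :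
    Real.exp (n * growthRate Z) ≤ Z n := by
  have hs : Subadditive fun n => Real.log (Z n) := by
    intro m n
    rw [← Real.log_mul (hZ m).ne' (hZ n).ne']
    exact Real.log_le_log (hZ _) (hsub m n)
  have hb : BddBelow (range fun n : ℕ => Real.log (Z n) / n) := by
    refine ⟨-(2 * K), ?_⟩
    rintro _ ⟨n, rfl⟩
    exact (abs_le.1 (abs_log_div_le hK n)).1
  have h1 : growthRate Z = hs.lim := (hs.tendsto_lim hb).limsup_eq
  have h2 := hs.lim_le_div hb (by omega : n ≠ 0)
  have h3 : (0 : ℝ) < n := by exact_mod_cast hn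
  rw [← h1, le_div_iff₀ h3] at h2
  rw [← Real.le_log_iff_exp_le (hZ n)]
  linarith

end Growth

section Families

variable {A ι : Type*} [Fintype ι] {Tr : A → A → Prop}

/-- A finite family of subadditive sequences of functions over the shift, with linear bounds. -/
structure SubaddFamily (F : ι → ℕ → SFT Tr → ℝ) (C : ℝ) : Prop where
  nonneg : 0 ≤ C
  bound : ∀ k n x, |F k n x| ≤ n * C
  add_le : ∀ k m n x, F k (m + n) x ≤ F k m x + F k n ((shiftSFT Tr)^[m] x)

/-- The exponential of a linear combination of the family. -/
noncomputable def expPot (F : ι → ℕ → SFT Tr → ℝ) (q : ι → ℝ) (n : ℕ) (x : SFT Tr) : ℝ :=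
  Real.exp (∑ k, q k * F k n x)

theorem expPot_pos (F : ι → ℕ → SFT Tr → ℝ) (q : ι → ℝ) (n : ℕ) (x : SFT Tr) :
    0 < expPot F q n x := Real.exp_pos _

variable {F : ι → ℕ → SFT Tr → ℝ} {C : ℝ}

theorem SubaddFamily.abs_sum_le (hF : SubaddFamily F C) (q : ι → ℝ) (n : ℕ) (x : SFT Tr) :
    |∑ k, q k * F k n x| ≤ n * (C * ∑ k, |q k|) := by
  refine (Finset.abs_sum_le_sum_abs _ _).trans ?_
  rw [Finset.mul_sum, Finset.mul_sum]
  refine Finset.sum_le_sum fun k _ => ?_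
  rw [abs_mul]
  nlinarith [hF.bound k n x, abs_nonneg (q k)]

theorem SubaddFamily.bddAbove_expPot (hF : SubaddFamily F C) (q : ι → ℝ) (n : ℕ) :
    BddAbove (range (expPot F q n)) := by
  refine ⟨Real.exp (n * (C * ∑ k, |q k|)), ?_⟩
  rintro _ ⟨x, rfl⟩
  exact Real.exp_le_exp.2 (abs_le.1 (hF.abs_sum_le q n x)).2

theorem SubaddFamily.expPot_add_le (hF : SubaddFamily F C) {q : ι → ℝ} (hq : ∀ k, 0 ≤ q k)
    (m n : ℕ) (x : SFT Tr) :
    expPot F q (m + n) x ≤ expPot F q m x * expPot F q n ((shiftSFT Tr)^[m] x) := by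
  rw [expPot, expPot, expPot, ← Real.exp_add, ← Finset.sum_add_distrib, Real.exp_le_exp]
  refine Finset.sum_le_sum fun k _ => ?_
  rw [← mul_add]
  exact mul_le_mul_of_nonneg_left (hF.add_le k m n x) (hq k)

theorem SubaddFamily.expPot_add_vec_le (hF : SubaddFamily F C) (q v : ι → ℝ) (n : ℕ) (x : SFT Tr) :
    expPot F (q + v) n x ≤ Real.exp (n * (C * ∑ k, |v k|)) * expPot F q n x := by
  rw [expPot, expPot, ← Real.exp_add, Real.exp_le_exp]
  simp only [Pi.add_apply, add_mul, Finset.sum_add_distrib]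
  linarith [(abs_le.1 (hF.abs_sum_le v n x)).2]

variable [Fintype A]

/-- The partition sum of the family at parameter `q`. -/
noncomputable def partSum (F : ι → ℕ → SFT Tr → ℝ) (q : ι → ℝ) (n : ℕ) : ℝ :=
  wsum n (expPot F q n)

/-- The pressure of the family at parameter `q`. -/
noncomputable def famPressure (F : ι → ℕ → SFT Tr → ℝ) (q : ι → ℝ) : ℝ :=
  growthRate (partSum F q)

theorem SubaddFamily.partSum_pos [Nonempty (SFT Tr)] (hF : SubaddFamily F C) (q : ι → ℝ) (n : ℕ) :
    0 < partSum F q n := by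
  obtain ⟨x⟩ := ‹Nonempty (SFT Tr)›
  exact (expPot_pos F q n x).trans_le
    (le_wsum (fun y => (expPot_pos F q n y).le) (hF.bddAbove_expPot q n) n x)

theorem SubaddFamily.abs_log_partSum_le [Nonempty (SFT Tr)] (hF : SubaddFamily F C) (q : ι → ℝ)
    (n : ℕ) :
    |Real.log (partSum F q n)| ≤
      (C * ∑ k, |q k| + Real.log (Fintype.card A)) * (n + 1) := by
  obtain ⟨x⟩ := ‹Nonempty (SFT Tr)›
  have hS : 0 ≤ C * ∑ k, |q k| := mul_nonneg hF.nonneg (Finset.sum_nonneg fun k _ => abs_nonneg _)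
  have hA : 1 ≤ Fintype.card A := Fintype.card_pos_iff.2 ⟨x.1 0⟩
  have hA' : (1 : ℝ) ≤ Fintype.card A := by exact_mod_cast hA
  have hlA := Real.log_nonneg hA'
  have : Nonempty (SFT Tr) := ⟨x⟩
  have hpos := hF.partSum_pos q n
  have hn : (0 : ℝ) ≤ n := Nat.cast_nonneg n
  rw [abs_le]
  constructor
  · have := le_wsum (fun y => (expPot_pos F q n y).le) (hF.bddAbove_expPot q n) n x
    have := Real.log_le_log (expPot_pos F q n x) this
    rw [expPot, Real.log_exp] at this
    have h2 := (abs_le.1 (hF.abs_sum_le q n x)).1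
    change _ ≤ Real.log (partSum F q n) at this
    nlinarith
  · have : partSum F q n ≤ (Fintype.card A : ℝ) ^ n * Real.exp (n * (C * ∑ k, |q k|)) := by
      rw [partSum, wsum]
      refine (Finset.sum_le_card_nsmul _ _ (Real.exp (n * (C * ∑ k, |q k|))) fun w _ =>
        Real.sSup_le ?_ (Real.exp_pos _).le).trans ?_
      · rintro _ ⟨y, -, rfl⟩
        exact Real.exp_le_exp.2 (abs_le.1 (hF.abs_sum_le q n y)).2
      · simp
    have := Real.log_le_log hpos this
    rw [Real.log_mul (by positivity) (Real.exp_pos _).ne', Real.log_exp, Real.log_pow] at this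
    nlinarith

theorem SubaddFamily.partSum_le_exp [Nonempty (SFT Tr)] (hF : SubaddFamily F C) (q : ι → ℝ) {c : ℝ}
    (hc : 0 < c) :
    ∃ C' : ℝ, 1 ≤ C' ∧ ∀ n : ℕ, partSum F q n ≤ C' * Real.exp (n * (famPressure F q + c)) :=
  le_growthRate_exp (hF.partSum_pos q) (hF.abs_log_partSum_le q) hc

theorem SubaddFamily.exp_famPressure_le [Nonempty (SFT Tr)] (hF : SubaddFamily F C) {q : ι → ℝ}
    (hq : ∀ k, 0 ≤ q k) {n : ℕ} (hn : 1 ≤ n) :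
    Real.exp (n * famPressure F q) ≤ partSum F q n := by
  refine exp_growthRate_le (hF.partSum_pos q) (hF.abs_log_partSum_le q) (fun m n => ?_) hn
  exact wsum_submul (fun x => (expPot_pos F q m x).le) (fun x => (expPot_pos F q n x).le)
    (hF.bddAbove_expPot q m) (hF.bddAbove_expPot q n) m n fun x => hF.expPot_add_le hq m n x

theorem SubaddFamily.famPressure_add_le [Nonempty (SFT Tr)] (hF : SubaddFamily F C)
    (q v : ι → ℝ) : famPressure F (q + v) ≤ famPressure F q + C * ∑ k, |v k| := by
  refine growthRate_mono (hF.partSum_pos _) (hF.abs_log_partSum_le _) (hF.partSum_pos _)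
    (hF.abs_log_partSum_le _) zero_le_one fun n => ?_
  rw [one_mul]
  exact wsum_le_mul (Real.exp_pos _).le (fun x => (expPot_pos F q n x).le)
    (hF.bddAbove_expPot q n) (fun x => hF.expPot_add_vec_le q v n x) n

theorem SubaddFamily.abs_famPressure_sub_le [Nonempty (SFT Tr)] (hF : SubaddFamily F C)
    (q q' : ι → ℝ) : |famPressure F q - famPressure F q'| ≤ C * ∑ k, |q k - q' k| := by
  have h1 := hF.famPressure_add_le q' (q - q')
  have h2 := hF.famPressure_add_le q (q' - q)
  simp only [add_sub_cancel, Pi.sub_apply] at h1 h2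
  have h3 : ∑ k, |q' k - q k| = ∑ k, |q k - q' k| :=
    Finset.sum_congr rfl fun k _ => abs_sub_comm _ _
  rw [h3] at h2
  rw [abs_le]
  constructor <;> linarith

theorem SubaddFamily.lipschitz_famPressure [Nonempty (SFT Tr)] (hF : SubaddFamily F C) :
    LipschitzWith (C * Fintype.card ι).toNNReal (famPressure F) := by
  refine LipschitzWith.of_dist_le_mul fun q q' => ?_
  rw [Real.coe_toNNReal _ (mul_nonneg hF.nonneg (Nat.cast_nonneg _)), Real.dist_eq, mul_assoc]
  refine (hF.abs_famPressure_sub_le q q').trans (mul_le_mul_of_nonneg_left ?_ hF.nonneg)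
  refine (Finset.sum_le_card_nsmul _ _ (dist q q') fun k _ => ?_).trans ?_
  · rw [← Real.dist_eq]
    exact dist_le_pi_dist q q' k
  · simp

/-- Parameters with positive coordinates at which the pressure is differentiable are dense near
the nonnegative orthant. -/
theorem SubaddFamily.exists_differentiableAt [Nonempty (SFT Tr)] (hF : SubaddFamily F C)
    {q₀ : ι → ℝ} (hq₀ : ∀ k, 0 ≤ q₀ k) {e : ℝ} (he : 0 < e) :
    ∃ q : ι → ℝ, (∀ k, 0 < q k) ∧ (∀ k, |q k - q₀ k| < e) ∧
      DifferentiableAt ℝ (famPressure F) q := by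
  have hae := hF.lipschitz_famPressure.ae_differentiableAt (μ := MeasureTheory.volume)
  have hopen : IsOpen (Set.pi univ fun k => Ioo (q₀ k) (q₀ k + e)) :=
    isOpen_set_pi finite_univ fun k _ => isOpen_Ioo
  have hne : (Set.pi univ fun k => Ioo (q₀ k) (q₀ k + e)).Nonempty :=
    ⟨fun k => q₀ k + e / 2, fun k _ => ⟨by linarith, by linarith⟩⟩
  have hd := MeasureTheory.Measure.dense_of_ae hae
  obtain ⟨q, hq, hq'⟩ := hd.inter_open_nonempty _ hopen hne
  have hqk := fun k => hq k (mem_univ k)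
  refine ⟨q, fun k => (hq₀ k).trans_lt (hqk k).1, fun k => ?_, hq'⟩
  rw [abs_lt]
  constructor <;> linarith [(hqk k).1, (hqk k).2]

end Families

section Deviations

variable {A ι : Type*} [Fintype ι] {Tr : A → A → Prop}
  {F : ι → ℕ → SFT Tr → ℝ} {C : ℝ}

theorem SubaddFamily.bddAbove_indicator (hF : SubaddFamily F C) (q : ι → ℝ) (n : ℕ)
    (S : Set (SFT Tr)) : BddAbove (range (S.indicator (expPot F q n))) := by
  obtain ⟨B, hB⟩ := hF.bddAbove_expPot q n
  refine ⟨B, ?_⟩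
  rintro _ ⟨x, rfl⟩
  exact (indicator_le_self' (fun y _ => (expPot_pos F q n y).le) x).trans (hB (mem_range_self x))

theorem indicator_expPot_nonneg (q : ι → ℝ) (n : ℕ) (S : Set (SFT Tr)) (x : SFT Tr) :
    0 ≤ S.indicator (expPot F q n) x :=
  indicator_nonneg (fun y _ => (expPot_pos F q n y).le) x

variable [Fintype A]

theorem SubaddFamily.exists_upper_deviation_bound [Nonempty (SFT Tr)] (hF : SubaddFamily F C)
    {q : ι → ℝ} (hd : DifferentiableAt ℝ (famPressure F) q) (v : ι → ℝ) {η : ℝ} (hη : 0 < η) :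
    ∃ c : ℝ, 0 < c ∧ ∃ C' : ℝ, 1 ≤ C' ∧ ∀ n : ℕ,
      wsum n ({x | n * (fderiv ℝ (famPressure F) q v + η) < ∑ k, v k * F k n x}.indicator
        (expPot F q n)) ≤ C' * Real.exp (n * (famPressure F q - c)) := by
  set Λ := fderiv ℝ (famPressure F) q v
  have h0 : HasDerivAt (fun t : ℝ => famPressure F (q + t • v)) Λ 0 :=
    hd.hasFDerivAt.hasLineDerivAt v
  have h1 := h0.tendsto_slope_zero_right
  simp only [zero_add, zero_smul, add_zero, smul_eq_mul] at h1
  obtain ⟨τ, h2, h3⟩ := ((h1.eventually_lt_const (by linarith : Λ < Λ + η / 4)).and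
    self_mem_nhdsWithin).exists
  have hτ : 0 < τ := h3
  rw [inv_mul_lt_iff₀ hτ] at h2
  obtain ⟨C', hC', hu⟩ := hF.partSum_le_exp (q + τ • v) (c := τ * (η / 4)) (by positivity)
  refine ⟨τ * (η / 2), by positivity, C', hC', fun n => ?_⟩
  calc _ ≤ Real.exp (-(n * (τ * (Λ + η)))) * partSum F (q + τ • v) n := by
        refine wsum_le_mul (Real.exp_pos _).le (fun x => (expPot_pos F _ n x).le)
          (hF.bddAbove_expPot _ n) (fun x => ?_) n
        refine indicator_le' (fun x hx => ?_)
          (fun x _ => mul_nonneg (Real.exp_pos _).le (expPot_pos F _ n x).le) x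
        rw [expPot, expPot, ← Real.exp_add, Real.exp_le_exp]
        simp only [Pi.add_apply, Pi.smul_apply, smul_eq_mul, add_mul, Finset.sum_add_distrib,
          mul_assoc, ← Finset.mul_sum]
        have hx' : n * (Λ + η) < ∑ k, v k * F k n x := hx
        nlinarith
    _ ≤ Real.exp (-(n * (τ * (Λ + η)))) *
        (C' * Real.exp (n * (famPressure F (q + τ • v) + τ * (η / 4)))) := by
        gcongr
        exact hu n
    _ = C' * Real.exp (-(n * (τ * (Λ + η))) + n * (famPressure F (q + τ • v) + τ * (η / 4))) := by
        rw [Real.exp_add]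
        ring
    _ ≤ _ := by
        gcongr
        have hn : (0 : ℝ) ≤ n := Nat.cast_nonneg n
        nlinarith

/-- The points at which some member of the family deviates from its expected value. -/
def devSet (F : ι → ℕ → SFT Tr → ℝ) (Λ : ι → ℝ) (η : ℝ) (n : ℕ) : Set (SFT Tr) :=
  {x | ∃ k, n * η < |F k n x - n * Λ k|}

theorem SubaddFamily.exists_deviation_bound [Nonempty (SFT Tr)] (hF : SubaddFamily F C)
    {q : ι → ℝ} (hd : DifferentiableAt ℝ (famPressure F) q) :
    ∃ Λ : ι → ℝ, ∀ η : ℝ, 0 < η → ∃ c : ℝ, 0 < c ∧ ∃ C' : ℝ, 1 ≤ C' ∧ ∀ n : ℕ,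
      wsum n ((devSet F Λ η n).indicator (expPot F q n)) ≤
        C' * Real.exp (n * (famPressure F q - c)) := by
  classical
  set D := fderiv ℝ (famPressure F) q
  let v : ι × Bool → ι → ℝ := fun p => if p.2 then Pi.single p.1 1 else -Pi.single p.1 1
  refine ⟨fun k => D (Pi.single k 1), fun η hη => ?_⟩
  choose c hc C' hC' hu using fun p => hF.exists_upper_deviation_bound hd (v p) hη
  obtain ⟨c₀, hc₀, hcm⟩ : ∃ c₀ : ℝ, 0 < c₀ ∧ ∀ p, c₀ ≤ c p := by
    rcases isEmpty_or_nonempty (ι × Bool) with h | h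
    · exact ⟨1, one_pos, fun p => h.elim p⟩
    · obtain ⟨p, hp⟩ := Finite.exists_min c
      exact ⟨c p, hc p, hp⟩
  refine ⟨c₀, hc₀, 1 + ∑ p, C' p, ?_, fun n => ?_⟩
  · linarith [Finset.sum_nonneg fun p (_ : p ∈ Finset.univ) => zero_le_one.trans (hC' p)]
  have h1 := wsum_sum_le (Finset.univ : Finset (ι × Bool))
    (ψ := (devSet F (fun k => D (Pi.single k 1)) η n).indicator (expPot F q n))
    (f := fun p => {x | n * (D (v p) + η) < ∑ k, v p k * F k n x}.indicator (expPot F q n))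
    (fun p _ x => indicator_expPot_nonneg q n _ x) (fun p _ => hF.bddAbove_indicator q n _) ?_ n
  · refine h1.trans ?_
    calc _ ≤ ∑ p, C' p * Real.exp (n * (famPressure F q - c₀)) := by
          refine Finset.sum_le_sum fun p _ => (hu p n).trans ?_
          have := zero_le_one.trans (hC' p)
          gcongr
          exact hcm p
      _ ≤ _ := by
          rw [← Finset.sum_mul]
          gcongr
          linarith
  · intro x
    by_cases hx : x ∈ devSet F (fun k => D (Pi.single k 1)) η n
    swap
    · rw [indicator_of_notMem hx]
      exact Finset.sum_nonneg fun p _ => indicator_expPot_nonneg q n _ x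
    rw [indicator_of_mem hx]
    obtain ⟨k, hk⟩ := hx
    have key : ∃ p : ι × Bool, x ∈ {x | n * (D (v p) + η) < ∑ k, v p k * F k n x} := by
      rcases lt_abs.1 hk with h | h
      · exact ⟨(k, true), by
          simp only [v, if_true, mem_ofPred_eq, Pi.single_apply, ite_mul, one_mul, zero_mul,
            Finset.sum_ite_eq', Finset.mem_univ]
          linarith⟩
      · exact ⟨(k, false), by
          simp only [v, mem_ofPred_eq, Pi.single_apply, ite_mul, one_mul, zero_mul, Pi.neg_apply,
            Finset.sum_ite_eq', Finset.mem_univ, if_true, Bool.false_eq_true, if_false, neg_mul,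
            Finset.sum_neg_distrib, map_neg]
          linarith⟩
    obtain ⟨p, hp⟩ := key
    refine le_trans (le_of_eq ?_) (Finset.single_le_sum
      (fun p _ => indicator_expPot_nonneg q n _ x) (Finset.mem_univ p))
    exact (indicator_of_mem hp _).symm

end Deviations

section GoodPoints

variable {A ι : Type*} [Fintype ι] {Tr : A → A → Prop}
  {F : ι → ℕ → SFT Tr → ℝ} {C : ℝ}

theorem SubaddFamily.apply_zero (hF : SubaddFamily F C) (k : ι) (x : SFT Tr) : F k 0 x = 0 := by
  have := hF.bound k 0 x
  simpa using this

theorem SubaddFamily.mul_le_sum (hF : SubaddFamily F C) (k : ι) (n ℓ : ℕ) (x : SFT Tr) :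
    F k (n * ℓ) x ≤ ∑ j ∈ Finset.range n, F k ℓ ((shiftSFT Tr)^[j * ℓ] x) := by
  induction n with
  | zero => simp [hF.apply_zero]
  | succ n ih =>
    rw [Finset.sum_range_succ, Nat.succ_mul]
    exact (hF.add_le k _ _ x).trans (by linarith)

theorem SubaddFamily.expPot_mul_le (hF : SubaddFamily F C) {q : ι → ℝ} (hq : ∀ k, 0 ≤ q k)
    (n ℓ : ℕ) (x : SFT Tr) :
    expPot F q (n * ℓ) x ≤ ∏ j ∈ Finset.range n, expPot F q ℓ ((shiftSFT Tr)^[j * ℓ] x) := by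
  simp only [expPot]
  rw [← Real.exp_sum, Real.exp_le_exp, Finset.sum_comm]
  refine Finset.sum_le_sum fun k _ => ?_
  rw [← Finset.mul_sum]
  exact mul_le_mul_of_nonneg_left (hF.mul_le_sum k n ℓ x) (hq k)

open Classical in
/-- The points with almost maximal expected growth along `n` blocks of length `ℓ`, most of whose
blocks do not deviate. -/
def goodSet (F : ι → ℕ → SFT Tr → ℝ) (Λ : ι → ℝ) (η ζ : ℝ) (ℓ n : ℕ) : Set (SFT Tr) :=
  {y | (∀ k, ((n * ℓ : ℕ) : ℝ) * (Λ k - η) ≤ F k (n * ℓ) y) ∧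
    (((Finset.range n).filter fun j => (shiftSFT Tr)^[j * ℓ] y ∈ devSet F Λ η ℓ).card : ℝ) ≤ ζ * n}

variable [Fintype A]

theorem wsum_zero_one_le : wsum 0 (fun _ : SFT Tr => (1 : ℝ)) ≤ 1 := by
  rw [wsum, Fintype.sum_unique]
  refine Real.sSup_le ?_ zero_le_one
  rintro _ ⟨x, -, rfl⟩
  exact le_rfl

theorem wsum_prod_le {f : SFT Tr → ℝ} (h0 : ∀ x, 0 ≤ f x) (hb : BddAbove (range f)) (n ℓ : ℕ) :
    wsum (n * ℓ) (fun x => ∏ j ∈ Finset.range n, f ((shiftSFT Tr)^[j * ℓ] x)) ≤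
      (wsum ℓ f) ^ n := by
  induction n with
  | zero => simpa using wsum_zero_one_le
  | succ n ih =>
    rw [pow_succ, Nat.succ_mul]
    refine (wsum_submul (f := fun x => ∏ j ∈ Finset.range n, f ((shiftSFT Tr)^[j * ℓ] x)) (g := f)
      (fun x => Finset.prod_nonneg fun j _ => h0 _) h0 ?_ hb _ _ fun x => ?_).trans
      (mul_le_mul_of_nonneg_right ih (wsum_nonneg h0 _))
    · obtain ⟨B, hB⟩ := hb
      refine ⟨B ^ n, ?_⟩
      rintro _ ⟨x, rfl⟩
      refine (Finset.prod_le_prod (fun j _ => h0 _) fun j _ => hB (mem_range_self _)).trans ?_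
      simp
    · rw [Finset.prod_range_succ]

open Classical in
theorem SubaddFamily.wsum_frequent_deviation_le [Nonempty (SFT Tr)] (hF : SubaddFamily F C)
    {q : ι → ℝ} (hq : ∀ k, 0 ≤ q k) (D : Set (SFT Tr)) {s ζ : ℝ} (hs : 0 ≤ s) (n ℓ : ℕ) :
    wsum (n * ℓ) ({y | ζ * n < ((Finset.range n).filter
        fun j => (shiftSFT Tr)^[j * ℓ] y ∈ D).card}.indicator (expPot F q (n * ℓ))) ≤
      (Real.exp (-(s * ζ)) *
        (partSum F q ℓ + Real.exp s * wsum ℓ (D.indicator (expPot F q ℓ)))) ^ n := by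
  set f : SFT Tr → ℝ := fun y => Real.exp (s * if y ∈ D then 1 else 0) * expPot F q ℓ y with hf
  have hf0 : ∀ y, 0 ≤ f y := fun y => mul_nonneg (Real.exp_pos _).le (expPot_pos F q ℓ y).le
  have hfb : BddAbove (range f) := by
    obtain ⟨B, hB⟩ := hF.bddAbove_expPot q ℓ
    refine ⟨Real.exp s * B, ?_⟩
    rintro _ ⟨y, rfl⟩
    refine mul_le_mul (Real.exp_le_exp.2 ?_) (hB (mem_range_self y)) (expPot_pos F q ℓ y).le
      (Real.exp_pos _).le
    split_ifs <;> linarith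
  have h1 : wsum ℓ f ≤ partSum F q ℓ + Real.exp s * wsum ℓ (D.indicator (expPot F q ℓ)) := by
    refine (wsum_add_le (f := expPot F q ℓ)
      (g := fun y => Real.exp s * D.indicator (expPot F q ℓ) y)
      (fun y => (expPot_pos F q ℓ y).le)
      (fun y => mul_nonneg (Real.exp_pos _).le (indicator_expPot_nonneg q ℓ D y))
      (hF.bddAbove_expPot q ℓ) ?_ ?_ ℓ).trans (add_le_add le_rfl ?_)
    · obtain ⟨B, hB⟩ := hF.bddAbove_indicator q ℓ D
      refine ⟨Real.exp s * B, ?_⟩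
      rintro _ ⟨y, rfl⟩
      exact mul_le_mul_of_nonneg_left (hB (mem_range_self y)) (Real.exp_pos _).le
    · intro y
      have := expPot_pos F q ℓ y
      by_cases hy : y ∈ D
      · simp only [hf, hy, if_true, mul_one, indicator_of_mem]
        linarith
      · simp [hf, hy]
    · exact wsum_le_mul (Real.exp_pos _).le (indicator_expPot_nonneg q ℓ D)
        (hF.bddAbove_indicator q ℓ D) (fun _ => le_rfl) ℓ
  have h2 : wsum (n * ℓ) ({y | ζ * n < ((Finset.range n).filter
        fun j => (shiftSFT Tr)^[j * ℓ] y ∈ D).card}.indicator (expPot F q (n * ℓ))) ≤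
      Real.exp (-(s * ζ)) ^ n *
        wsum (n * ℓ) (fun x => ∏ j ∈ Finset.range n, f ((shiftSFT Tr)^[j * ℓ] x)) := by
    refine wsum_le_mul (by positivity) (fun x => Finset.prod_nonneg fun j _ => hf0 _) ?_
      (fun x => ?_) _
    · obtain ⟨B, hB⟩ := hfb
      refine ⟨B ^ n, ?_⟩
      rintro _ ⟨x, rfl⟩
      refine (Finset.prod_le_prod (fun j _ => hf0 _) fun j _ => hB (mem_range_self _)).trans ?_
      simp
    · refine indicator_apply_le' (fun hx => ?_) (fun _ => mul_nonneg (by positivity)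
        (Finset.prod_nonneg fun j _ => hf0 _))
      refine (hF.expPot_mul_le hq n ℓ x).trans ?_
      simp only [hf]
      rw [Finset.prod_mul_distrib, ← mul_assoc, ← Real.exp_sum, ← Finset.mul_sum,
          ← Real.exp_nat_mul,
        ← Real.exp_add]
      refine le_mul_of_one_le_left (Finset.prod_nonneg fun j _ => (expPot_pos F q ℓ _).le)
        (Real.one_le_exp ?_)
      rw [mem_ofPred_eq, Finset.card_filter] at hx
      push_cast at hx
      nlinarith
  refine h2.trans ?_
  rw [mul_pow]
  refine mul_le_mul_of_nonneg_left ?_ (by positivity)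
  exact (wsum_prod_le hf0 hfb n ℓ).trans (pow_le_pow_left₀ (wsum_nonneg hf0 _) h1 n)

theorem SubaddFamily.half_le_wsum_goodSet [Nonempty (SFT Tr)] (hF : SubaddFamily F C)
    {q : ι → ℝ} (hq : ∀ k, 0 ≤ q k) {Λ : ι → ℝ} {η c C' : ℝ} (hc : 0 < c)
    (hC' : 1 ≤ C') (hdev : ∀ n : ℕ, wsum n ((devSet F Λ η n).indicator (expPot F q n)) ≤
        C' * Real.exp (n * (famPressure F q - c))) {ζ : ℝ} (hζ : 0 < ζ) :
    ∃ ℓ₀ : ℕ, ∀ ℓ ≥ ℓ₀, ∃ n₀ : ℕ, ∀ n ≥ n₀,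
      1 / 2 * Real.exp ((n * ℓ : ℕ) * famPressure F q) ≤
        wsum (n * ℓ) ((goodSet F Λ η ζ ℓ n).indicator (expPot F q (n * ℓ))) := by
  classical
  obtain ⟨C₁, hC₁, hu⟩ := hF.partSum_le_exp q (c := c * ζ / 4) (by positivity)
  set P := famPressure F q
  obtain ⟨ℓ₀, hℓ₀⟩ := exists_nat_gt (Real.log (2 * (C₁ + C')) / (c * ζ * (3 / 4)))
  refine ⟨ℓ₀ + 1, fun ℓ hℓ => ?_⟩
  have hℓ1 : (1 : ℝ) ≤ ℓ := by exact_mod_cast (by omega : 1 ≤ ℓ)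
  obtain ⟨n₀, hn₀⟩ := exists_nat_gt (Real.log (4 * C') / c)
  refine ⟨n₀ + 2, fun n hn => ?_⟩
  have hnn : (n₀ : ℝ) + 2 ≤ n := by exact_mod_cast hn
  have hn0 : (0 : ℝ) ≤ n₀ := Nat.cast_nonneg _
  have hn2 : 2 ≤ n := by omega
  set E : ℝ := Real.exp ((n * ℓ : ℕ) * P) with hE
  have hEpos : 0 < E := Real.exp_pos _
  have hbig : E ≤ partSum F q (n * ℓ) := hF.exp_famPressure_le hq (by nlinarith)
  have hb1 : wsum (n * ℓ) ((devSet F Λ η (n * ℓ)).indicator (expPot F q (n * ℓ))) ≤ 1 / 4 * E := by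
    refine (hdev _).trans ?_
    have : C' ≤ 1 / 4 * Real.exp ((n * ℓ : ℕ) * c) := by
      have h1 : Real.log (4 * C') ≤ (n * ℓ : ℕ) * c := by
        rw [div_lt_iff₀ hc] at hn₀
        push_cast
        have : (n₀ : ℝ) ≤ n * ℓ := by nlinarith
        nlinarith
      have h2 := Real.exp_le_exp.2 h1
      rw [Real.exp_log (by linarith)] at h2
      linarith
    calc _ ≤ 1 / 4 * Real.exp ((n * ℓ : ℕ) * c) * Real.exp ((n * ℓ : ℕ) * (P - c)) := by gcongr
      _ = 1 / 4 * E := by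
        rw [mul_assoc, ← Real.exp_add, hE]
        congr 2
        ring
  have hb2 : wsum (n * ℓ) ({y | ζ * n < ((Finset.range n).filter
        fun j => (shiftSFT Tr)^[j * ℓ] y ∈ devSet F Λ η ℓ).card}.indicator
          (expPot F q (n * ℓ))) ≤ 1 / 4 * E := by
    refine (hF.wsum_frequent_deviation_le hq (devSet F Λ η ℓ) (s := c * ℓ) (ζ := ζ) (by positivity)
      n ℓ).trans ?_
    have h1 : Real.exp (-(c * ℓ * ζ)) * (partSum F q ℓ + Real.exp (c * ℓ) *
        wsum ℓ ((devSet F Λ η ℓ).indicator (expPot F q ℓ))) ≤ 1 / 2 * Real.exp (ℓ * P) := by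
      have h2 : Real.exp (c * ℓ) * wsum ℓ ((devSet F Λ η ℓ).indicator (expPot F q ℓ)) ≤
          C' * Real.exp (ℓ * (P + c * ζ / 4)) := by
        refine (mul_le_mul_of_nonneg_left (hdev ℓ) (Real.exp_pos _).le).trans ?_
        rw [mul_left_comm, ← Real.exp_add]
        gcongr
        have : 0 < (ℓ : ℝ) * (c * ζ) := by positivity
        linarith
      have h3 : C₁ + C' ≤ 1 / 2 * Real.exp (ℓ * (c * ζ * (3 / 4))) := by
        have h4 : Real.log (2 * (C₁ + C')) ≤ ℓ * (c * ζ * (3 / 4)) := by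
          rw [div_lt_iff₀ (by positivity)] at hℓ₀
          have : (ℓ₀ : ℝ) ≤ ℓ := by exact_mod_cast (by omega : ℓ₀ ≤ ℓ)
          have : (ℓ₀ : ℝ) * (c * ζ * (3 / 4)) ≤ ℓ * (c * ζ * (3 / 4)) := by gcongr
          linarith
        have h5 := Real.exp_le_exp.2 h4
        rw [Real.exp_log (by linarith)] at h5
        linarith
      calc _ ≤ Real.exp (-(c * ℓ * ζ)) * (C₁ * Real.exp (ℓ * (P + c * ζ / 4)) +
            C' * Real.exp (ℓ * (P + c * ζ / 4))) := by
            gcongr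
            exact hu ℓ
        _ = (C₁ + C') * (Real.exp (-(c * ℓ * ζ)) * Real.exp (ℓ * (P + c * ζ / 4))) := by ring
        _ ≤ (1 / 2 * Real.exp (ℓ * (c * ζ * (3 / 4)))) *
            (Real.exp (-(c * ℓ * ζ)) * Real.exp (ℓ * (P + c * ζ / 4))) := by gcongr
        _ = _ := by
          rw [mul_assoc, ← Real.exp_add, ← Real.exp_add]
          congr 2
          ring
    have h0 : 0 ≤ Real.exp (-(c * ℓ * ζ)) * (partSum F q ℓ + Real.exp (c * ℓ) *
        wsum ℓ ((devSet F Λ η ℓ).indicator (expPot F q ℓ))) :=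
      mul_nonneg (Real.exp_pos _).le (add_nonneg (hF.partSum_pos q ℓ).le
        (mul_nonneg (Real.exp_pos _).le (wsum_nonneg (indicator_expPot_nonneg q ℓ _) _)))
    refine (pow_le_pow_left₀ h0 h1 n).trans ?_
    rw [mul_pow, ← Real.exp_nat_mul, hE]
    have h6 : ((1 : ℝ) / 2) ^ n ≤ (1 / 2) ^ 2 :=
      pow_le_pow_of_le_one (by norm_num) (by norm_num) hn2
    push_cast
    rw [mul_assoc]
    refine mul_le_mul_of_nonneg_right ?_ (Real.exp_pos _).le
    linarith
  have hsplit : partSum F q (n * ℓ) ≤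
      wsum (n * ℓ) ((goodSet F Λ η ζ ℓ n).indicator (expPot F q (n * ℓ))) +
      (wsum (n * ℓ) ((devSet F Λ η (n * ℓ)).indicator (expPot F q (n * ℓ))) +
      wsum (n * ℓ) ({y | ζ * n < ((Finset.range n).filter
        fun j => (shiftSFT Tr)^[j * ℓ] y ∈ devSet F Λ η ℓ).card}.indicator
          (expPot F q (n * ℓ)))) := by
    have h := wsum_sum_le (Finset.univ : Finset (Fin 3)) (ψ := expPot F q (n * ℓ))
      (f := fun i => (![goodSet F Λ η ζ ℓ n, devSet F Λ η (n * ℓ),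
        {y | ζ * n < ((Finset.range n).filter
          fun j => (shiftSFT Tr)^[j * ℓ] y ∈ devSet F Λ η ℓ).card}] i).indicator
          (expPot F q (n * ℓ)))
      (fun i _ x => indicator_expPot_nonneg q _ _ x) (fun i _ => hF.bddAbove_indicator q _ _)
      (fun x => ?_) (n * ℓ)
    · rw [Fin.sum_univ_three, add_assoc] at h
      exact h
    · have key : ∃ i : Fin 3, x ∈ ![goodSet F Λ η ζ ℓ n, devSet F Λ η (n * ℓ),
          {y | ζ * n < ((Finset.range n).filter
            fun j => (shiftSFT Tr)^[j * ℓ] y ∈ devSet F Λ η ℓ).card}] i := by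
        by_contra! hcon
        have c0 := hcon 0
        have c1 := hcon 1
        have c2 := hcon 2
        simp only [Matrix.cons_val] at c0 c1 c2
        refine c0 ⟨fun k => ?_, not_lt.1 c2⟩
        have := not_exists.1 c1 k
        rw [not_lt] at this
        have := (abs_le.1 this).1
        linarith
      obtain ⟨i, hi⟩ := key
      refine le_trans (le_of_eq ?_) (Finset.single_le_sum
        (fun i _ => indicator_expPot_nonneg q (n * ℓ) _ x) (Finset.mem_univ i))
      exact (indicator_of_mem hi _).symm
  linarith

end GoodPoints

section NormFamily

open Module

variable {M : Type*} [NormedAddCommGroup M] [InnerProductSpace ℝ M] [FiniteDimensional ℝ M]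
variable {A : Type*} {Tr : A → A → Prop}

variable (M) in
/-- The logarithmic norms of the cocycle on forms of all degrees. -/
noncomputable def normFam (Amap : SFT Tr → (M →L[ℝ] M)) (k : Fin (finrank ℝ M + 1)) (n : ℕ)
    (x : SFT Tr) : ℝ := logNorm Amap k n x

theorem subaddFamily_normFam {Amap : SFT Tr → (M →L[ℝ] M)} {R : ℝ} (hR : 1 ≤ R)
    (hA : ∀ x, IsUnit (Amap x)) (hb : ∀ x, ‖Amap x‖ ≤ R ∧ ‖Ring.inverse (Amap x)‖ ≤ R) :
    SubaddFamily (normFam M Amap) (Real.log (R ^ finrank ℝ M)) where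
  nonneg := Real.log_nonneg (one_le_pow₀ hR)
  bound k n x := abs_logNorm_le hR hA hb (Nat.lt_succ_iff.1 k.2) n x
  add_le k m n x := logNorm_add_le hA (Nat.lt_succ_iff.1 k.2) m n x

theorem cocPressure_eq_famPressure [Fintype A] [Nonempty (SFT Tr)] {Amap : SFT Tr → (M →L[ℝ] M)}
    (hA : ∀ x, IsUnit (Amap x)) {C : ℝ} (hF : SubaddFamily (normFam M Amap) C) {s : ℝ}
    {q : Fin (finrank ℝ M + 1) → ℝ}
    (hs : ∀ L : M →L[ℝ] M, IsUnit L → phiS L s = Real.exp (∑ k, q k * Real.log (singProd L k))) :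
    cocPressure Tr Amap s = famPressure (normFam M Amap) q := by
  obtain ⟨C₀, hC₀, h₀⟩ := exists_log_norm_extPull_bound M
  set B := C₀ * ∑ k, |q k|
  have hphi : ∀ n x, |(∑ k : Fin (finrank ℝ M + 1),
      q k * Real.log (singProd (cocycle Tr Amap n x) k)) -
      ∑ k, q k * normFam M Amap k n x| ≤ B := by
    intro n x
    rw [← Finset.sum_sub_distrib]
    refine (Finset.abs_sum_le_sum_abs _ _).trans ?_
    rw [show B = ∑ k, C₀ * |q k| from Finset.mul_sum _ _ _]
    refine Finset.sum_le_sum fun k _ => ?_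
    rw [← mul_sub, abs_mul, mul_comm]
    refine mul_le_mul_of_nonneg_right ?_ (abs_nonneg _)
    rw [abs_sub_comm]
    exact (h₀ _ (isUnit_cocycle hA n x) k (Nat.lt_succ_iff.1 k.2)).2
  have hup : ∀ n x, phiS (cocycle Tr Amap n x) s ≤ Real.exp B * expPot (normFam M Amap) q n x := by
    intro n x
    rw [hs _ (isUnit_cocycle hA n x), expPot, ← Real.exp_add, Real.exp_le_exp]
    linarith [(abs_le.1 (hphi n x)).2]
  have hlo : ∀ n x, expPot (normFam M Amap) q n x ≤ Real.exp B * phiS (cocycle Tr Amap n x) s := by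
    intro n x
    rw [hs _ (isUnit_cocycle hA n x), expPot, ← Real.exp_add, Real.exp_le_exp]
    linarith [(abs_le.1 (hphi n x)).1]
  have hpos : ∀ n x, 0 < phiS (cocycle Tr Amap n x) s := by
    intro n x
    rw [hs _ (isUnit_cocycle hA n x)]
    exact Real.exp_pos _
  have hbdd : ∀ n, BddAbove (range fun x => phiS (cocycle Tr Amap n x) s) := by
    intro n
    obtain ⟨b, hb⟩ := hF.bddAbove_expPot q n
    refine ⟨Real.exp B * b, ?_⟩
    rintro _ ⟨x, rfl⟩
    exact (hup n x).trans (mul_le_mul_of_nonneg_left (hb (mem_range_self x)) (Real.exp_pos _).le)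
  have h1 : ∀ n, wordSum Tr Amap s n ≤ Real.exp B * partSum (normFam M Amap) q n := by
    intro n
    rw [wordSum_eq_wsum]
    exact wsum_le_mul (Real.exp_pos _).le (fun x => (expPot_pos _ q n x).le)
      (hF.bddAbove_expPot q n) (hup n) n
  have h2 : ∀ n, partSum (normFam M Amap) q n ≤ Real.exp B * wordSum Tr Amap s n := by
    intro n
    rw [wordSum_eq_wsum]
    exact wsum_le_mul (Real.exp_pos _).le (fun x => (hpos n x).le) (hbdd n) (hlo n) n
  have hZ := hF.partSum_pos q
  have hZ' : ∀ n, 0 < wordSum Tr Amap s n := fun n =>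
    pos_of_mul_pos_right ((hZ n).trans_le (h2 n)) (Real.exp_pos _).le
  obtain ⟨K, hK⟩ : ∃ K, ∀ n : ℕ, |Real.log (partSum (normFam M Amap) q n)| ≤ K * (n + 1) :=
    ⟨_, hF.abs_log_partSum_le q⟩
  have hB : 0 ≤ B := mul_nonneg hC₀ (Finset.sum_nonneg fun k _ => abs_nonneg _)
  have hK' : ∀ n : ℕ, |Real.log (wordSum Tr Amap s n)| ≤ (K + B) * (n + 1) := by
    intro n
    have l1 := Real.log_le_log (hZ' n) (h1 n)
    have l2 := Real.log_le_log (hZ n) (h2 n)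
    rw [Real.log_mul (Real.exp_pos _).ne' (hZ n).ne', Real.log_exp] at l1
    rw [Real.log_mul (Real.exp_pos _).ne' (hZ' n).ne', Real.log_exp] at l2
    have l3 := abs_le.1 (hK n)
    have l4 : 0 ≤ B * n := by positivity
    rw [abs_le]
    constructor <;> linarith
  have e1 := growthRate_mono (p := 0) hZ' hK' hZ hK (Real.exp_pos B).le (by simpa using h1)
  have e2 := growthRate_mono (p := 0) hZ hK hZ' hK' (Real.exp_pos B).le (by simpa using h2)
  rw [add_zero] at e1 e2
  exact le_antisymm e1 e2

end NormFamily

section ConeSteps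

variable {V : Type*} [NormedAddCommGroup V] [NormedSpace ℝ V]

theorem norm_perturb_le {g g' : V →L[ℝ] V} {e : ℝ} (he : ‖g' - g‖ ≤ e) {w x : V} (hw : ‖w‖ = 1)
    (hx : ‖x‖ ≤ 1) : ‖(g' - g) (w + x)‖ ≤ 2 * e := by
  have h1 : ‖w + x‖ ≤ 2 := (norm_add_le _ _).trans (by linarith)
  have he0 := (norm_nonneg _).trans he
  calc _ ≤ ‖g' - g‖ * ‖w + x‖ := (g' - g).le_opNorm _
    _ ≤ e * 2 := mul_le_mul he h1 (norm_nonneg _) he0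
    _ = 2 * e := mul_comm _ _

theorem exists_cone_step_of_norm_le {g g' : V →L[ℝ] V} {e μ Γ : ℝ} {w w' x : V} (hw : ‖w‖ = 1)
    (hμ : 0 < μ) (hg : g w = μ • w') (he : ‖g' - g‖ ≤ e) (hΓ : ‖g‖ ≤ Γ * μ) (hx : ‖x‖ ≤ 1) :
    ∃ (c : ℝ) (x' : V), μ / 2 ≤ c ∧ g' (w + x) = c • (w' + x') ∧
      ‖x'‖ ≤ Γ * ‖x‖ + 4 * e / μ := by
  have hp := norm_perturb_le he hw hx
  have he0 := (norm_nonneg _).trans he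
  refine ⟨μ, μ⁻¹ • (g x + (g' - g) (w + x)), by linarith, ?_, ?_⟩
  · rw [smul_add, smul_inv_smul₀ hμ.ne', ← hg]
    simp only [map_add, sub_apply]
    abel
  · rw [norm_smul, norm_inv, Real.norm_of_nonneg hμ.le, inv_mul_le_iff₀ hμ]
    have h1 : ‖g x‖ ≤ Γ * μ * ‖x‖ :=
      (g.le_opNorm x).trans (mul_le_mul_of_nonneg_right hΓ (norm_nonneg _))
    have h2 : μ * (Γ * ‖x‖ + 4 * e / μ) = Γ * μ * ‖x‖ + 4 * e := by field_simp
    rw [h2]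
    exact (norm_add_le _ _).trans (by linarith)

theorem exists_cone_step_of_rankOne {g g' : V →L[ℝ] V} {e μ Γ β : ℝ} {w w' x : V} (hw : ‖w‖ = 1)
    (hw' : ‖w'‖ = 1) (hμ : 0 < μ) (hg : g w = μ • w') (he : ‖g' - g‖ ≤ e) (hΓ : ‖g‖ ≤ Γ * μ)
    {ξ : V →L[ℝ] ℝ} {a : V} (hβ : ‖g - ξ.smulRight a‖ ≤ β * μ) (hβ' : β ≤ 1 / 2)
    (hx : 8 * Γ * ‖x‖ ≤ 1) :
    ∃ (c : ℝ) (x' : V), μ / 2 ≤ c ∧ g' (w + x) = c • (w' + x') ∧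
      ‖x'‖ ≤ 10 * Γ * β * ‖x‖ + 4 * e / μ := by
  have he0 := (norm_nonneg _).trans he
  set E := g - ξ.smulRight a with hE
  have hgE : ∀ y, g y = ξ y • a + E y := by
    intro y
    simp [hE]
  have hΓ1 : 1 ≤ Γ := by
    have h1 := g.le_opNorm w
    rw [hg, norm_smul, hw', hw, Real.norm_of_nonneg hμ.le] at h1
    by_contra! hcon
    nlinarith
  have hβ0 : 0 ≤ β := by
    by_contra! hcon
    nlinarith [norm_nonneg E]
  have hx1 : ‖x‖ ≤ 1 := by nlinarith [norm_nonneg x]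
  have hEw : ‖E w‖ ≤ β * μ := by
    have := E.le_opNorm w
    rw [hw, mul_one] at this
    exact this.trans hβ
  have hEx : ‖E x‖ ≤ β * μ * ‖x‖ := (E.le_opNorm x).trans
    (mul_le_mul_of_nonneg_right hβ (norm_nonneg _))
  have hξa : μ / 2 ≤ |ξ w| * ‖a‖ := by
    have h1 : ξ w • a = μ • w' - E w := by rw [← hg, hgE w]; abel
    have h2 := norm_sub_norm_le (μ • w') (E w)
    rw [← h1, norm_smul, norm_smul, hw', Real.norm_of_nonneg hμ.le, Real.norm_eq_abs] at h2
    nlinarith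
  have hξw : ξ w ≠ 0 := by
    rintro h
    rw [h, abs_zero, zero_mul] at hξa
    linarith
  have ha : 0 < ‖a‖ := by
    by_contra! hcon
    nlinarith [abs_nonneg (ξ w)]
  have hξx : |ξ x| * ‖a‖ ≤ 2 * Γ * μ * ‖x‖ := by
    have h1 : ξ x • a = g x - E x := by rw [hgE x]; abel
    have h2 : ‖ξ x • a‖ ≤ ‖g x‖ + ‖E x‖ := by rw [h1]; exact norm_sub_le _ _
    rw [norm_smul, Real.norm_eq_abs] at h2
    have h3 : ‖g x‖ ≤ Γ * μ * ‖x‖ :=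
      (g.le_opNorm x).trans (mul_le_mul_of_nonneg_right hΓ (norm_nonneg _))
    have h4 : β * μ * ‖x‖ ≤ Γ * μ * ‖x‖ := by gcongr; linarith
    linarith
  set t := ξ x / ξ w with ht
  have ht1 : |t| ≤ 4 * Γ * ‖x‖ := by
    rw [ht, abs_div, div_le_iff₀ (abs_pos.2 hξw)]
    have h1 : 4 * Γ * ‖x‖ * (μ / 2) ≤ 4 * Γ * ‖x‖ * (|ξ w| * ‖a‖) := by gcongr
    by_contra! hcon
    have h2 := mul_lt_mul_of_pos_right hcon ha
    linarith
  have ht2 : |t| ≤ 1 / 2 := by linarith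
  have ht3 : 1 / 2 ≤ 1 + t := by linarith [(abs_le.1 ht2).1]
  have hc : 0 < μ * (1 + t) := by positivity
  have hp := norm_perturb_le he hw hx1
  refine ⟨μ * (1 + t), (μ * (1 + t))⁻¹ • (E x - t • E w + (g' - g) (w + x)), by nlinarith, ?_, ?_⟩
  · rw [smul_add, smul_inv_smul₀ hc.ne', mul_comm, mul_smul, ← hg]
    have h1 : ξ x = t * ξ w := (div_mul_cancel₀ _ hξw).symm
    have h2 : g x = t • g w - t • E w + E x := by
      rw [hgE x, hgE w, h1, smul_add, mul_smul]
      abel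
    simp only [map_add, sub_apply, h2, add_smul, one_smul]
    abel
  · rw [norm_smul, norm_inv, Real.norm_of_nonneg hc.le, inv_mul_le_iff₀ hc]
    have h1 : ‖t • E w‖ ≤ 4 * Γ * ‖x‖ * (β * μ) := by
      rw [norm_smul, Real.norm_eq_abs]
      gcongr
    have h2 : ‖E x - t • E w + (g' - g) (w + x)‖ ≤ ‖E x‖ + ‖t • E w‖ + ‖(g' - g) (w + x)‖ :=
      (norm_add_le _ _).trans (add_le_add_left (norm_sub_le _ _) _)
    have h3 : β * μ * ‖x‖ ≤ Γ * (β * μ * ‖x‖) := le_mul_of_one_le_left (by positivity) hΓ1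
    have h4 : μ / 2 * (10 * Γ * β * ‖x‖ + 4 * e / μ) ≤
        μ * (1 + t) * (10 * Γ * β * ‖x‖ + 4 * e / μ) := by
      gcongr
      nlinarith
    have h5 : μ / 2 * (10 * Γ * β * ‖x‖ + 4 * e / μ) = 5 * (Γ * (β * μ * ‖x‖)) + 2 * e := by
      field_simp
      ring
    linarith

theorem exists_cone_iterate {N : ℕ} {g H : ℕ → V →L[ℝ] V} {w : ℕ → V} {m S : ℕ → ℝ}
    (hm : ∀ a < N, 0 ≤ m a) (hN : H N = ContinuousLinearMap.id ℝ V)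
    (hH : ∀ a < N, H a = (g a).comp (H (a + 1)))
    (hstep : ∀ a < N, ∀ x, ‖x‖ ≤ S (a + 1) → ∃ (c : ℝ) (x' : V), m a ≤ c ∧
      g a (w (a + 1) + x) = c • (w a + x') ∧ ‖x'‖ ≤ S a) {x : V} (hx : ‖x‖ ≤ S N) {b : ℕ}
    (hb : b ≤ N) :
    ∃ (c : ℝ) (x' : V), ∏ a ∈ Finset.Ico b N, m a ≤ c ∧ H b (w N + x) = c • (w b + x') ∧
      ‖x'‖ ≤ S b := by
  induction hb using Nat.decreasingInduction with
  | self => exact ⟨1, x, by simp, by simp [hN], hx⟩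
  | of_succ b hb ih =>
    obtain ⟨c, x₁, hc, h1, hx₁⟩ := ih
    obtain ⟨c', x', hc', h2, hx'⟩ := hstep b hb x₁ hx₁
    refine ⟨c * c', x', ?_, ?_, hx'⟩
    · rw [Finset.prod_eq_prod_Ico_succ_bot hb]
      have h0 : 0 ≤ ∏ a ∈ Finset.Ico (b + 1) N, m a := Finset.prod_nonneg fun a ha =>
        hm a (Finset.mem_Ico.1 ha).2
      rw [mul_comm c]
      exact mul_le_mul hc' hc h0 ((hm b hb).trans hc')
    · rw [hH b hb, ContinuousLinearMap.comp_apply, h1, map_smul, h2, smul_smul]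

end ConeSteps

section Tracks

theorem exists_track {V : Type*} [NormedAddCommGroup V] [NormedSpace ℝ V] {n : ℕ}
    {g G : ℕ → V →L[ℝ] V} (hn : G n = ContinuousLinearMap.id ℝ V)
    (hG : ∀ a < n, G a = (g a).comp (G (a + 1))) (h0 : 0 < ‖G 0‖) :
    ∃ (w : ℕ → V) (μ : ℕ → ℝ), (∀ a ≤ n, ‖w a‖ = 1) ∧
      (∀ a < n, g a (w (a + 1)) = μ a • w a ∧ 0 < μ a) ∧
      ‖G 0‖ / 2 ≤ ∏ a ∈ Finset.range n, μ a := by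
  obtain ⟨v, hv1, hv2⟩ := (G 0).exists_lt_apply_of_lt_opNorm (half_lt_self h0)
  have hne : ∀ a ≤ n, G a v ≠ 0 := by
    intro a
    induction a with
    | zero =>
      intro _ h
      rw [h, norm_zero] at hv2
      linarith
    | succ a ih =>
      intro ha h
      refine ih (by omega) ?_
      rw [hG a (by omega), ContinuousLinearMap.comp_apply, h, map_zero]
  have hpos : ∀ a ≤ n, 0 < ‖G a v‖ := fun a ha => norm_pos_iff.2 (hne a ha)
  refine ⟨fun a => ‖G a v‖⁻¹ • G a v, fun a => ‖G a v‖ / ‖G (a + 1) v‖, fun a ha => ?_,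
    fun a ha => ⟨?_, ?_⟩, ?_⟩
  · rw [norm_smul, norm_inv, norm_norm, inv_mul_cancel₀ (hpos a ha).ne']
  · have h1 := (hpos a ha.le).ne'
    rw [map_smul, ← ContinuousLinearMap.comp_apply, ← hG a ha, smul_smul]
    congr 1
    field_simp
  · exact div_pos (hpos a ha.le) (hpos (a + 1) ha)
  · have hprod : ∀ m ≤ n, ∏ a ∈ Finset.range m, ‖G a v‖ / ‖G (a + 1) v‖ = ‖G 0 v‖ / ‖G m v‖ := by
      intro m
      induction m with
      | zero =>
        intro _
        rw [Finset.prod_range_zero, div_self (hpos 0 (Nat.zero_le _)).ne']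
      | succ m ih =>
        intro hm
        have h1 := (hpos m (by omega)).ne'
        rw [Finset.prod_range_succ, ih (by omega)]
        field_simp
    rw [hprod n le_rfl, hn, ContinuousLinearMap.id_apply]
    have hvp := hpos n le_rfl
    rw [hn, ContinuousLinearMap.id_apply] at hvp
    rw [le_div_iff₀ hvp]
    nlinarith

theorem card_filter_lt_le {n : ℕ} {lm : ℕ → ℝ} {Nt : ℕ → Prop} [DecidablePred Nt]
    {r η η₀ C : ℝ} (hη₀ : 0 ≤ η₀)
    (h1 : ∀ a < n, ¬ Nt a → lm a ≤ r + η₀) (h2 : ∀ a < n, Nt a → lm a ≤ r + C) :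
    2 * η * ((Finset.range n).filter fun a => ¬ Nt a ∧ lm a < r - 2 * η).card ≤
      n * (r + η₀) + C * ((Finset.range n).filter Nt).card - ∑ a ∈ Finset.range n, lm a := by
  have h : ∀ a ∈ Finset.range n, lm a ≤ (r + η₀) + C * (if Nt a then 1 else 0) -
      2 * η * (if ¬ Nt a ∧ lm a < r - 2 * η then 1 else 0) := by
    intro a ha
    have ha := Finset.mem_range.1 ha
    by_cases hN : Nt a
    · simp only [hN, if_true, not_true, false_and, if_false]
      linarith [h2 a ha hN]
    · have := h1 a ha hN
      by_cases hl : lm a < r - 2 * η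
      · simp only [hN, hl, not_false_iff, and_self, if_true, if_false]
        linarith
      · simp only [hN, hl, not_false_iff, and_false, if_false]
        linarith
  have := Finset.sum_le_sum h
  rw [Finset.sum_sub_distrib, Finset.sum_add_distrib, ← Finset.mul_sum, ← Finset.mul_sum,
    Finset.sum_const, Finset.card_range, nsmul_eq_mul] at this
  rw [Finset.card_filter, Finset.card_filter]
  push_cast
  linarith

/-- Pliss' lemma: if a set of integers is sparse in `[0, n)`, then it is sparse in every interval
ending at `t`, for many times `t ≤ n`. -/
theorem card_sparse_times_ge (Bd : ℕ → Prop) [DecidablePred Bd] {ρ : ℝ} (hρ : 0 ≤ ρ) (n : ℕ)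
    (S : ℕ → Prop) [DecidablePred S]
    (hS : ∀ t, (∀ a < t, (((Finset.Ico a t).filter Bd).card : ℝ) ≤ ρ * (t - a)) → S t) :
    ρ * n - ((Finset.range n).filter Bd).card ≤ ρ * ((Finset.Icc 1 n).filter S).card := by
  set s : ℕ → ℝ := fun a => ((Finset.range a).filter Bd).card - ρ * a with hs
  have hcnt : ∀ a t, a ≤ t → (((Finset.Ico a t).filter Bd).card : ℝ) =
      ((Finset.range t).filter Bd).card - ((Finset.range a).filter Bd).card := by
    intro a t hat
    rw [eq_sub_iff_add_eq, ← Nat.cast_add, Finset.range_eq_Ico, Finset.range_eq_Ico, add_comm,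
      ← Finset.Ico_union_Ico_eq_Ico (Nat.zero_le a) hat, Finset.filter_union,
      Finset.card_union_of_disjoint]
    exact Finset.disjoint_filter_filter (Finset.Ico_disjoint_Ico_consecutive 0 a t)
  have key : ∀ t a, a ≤ t → -(ρ * ((Finset.Icc 1 t).filter S).card) ≤ s a := by
    intro t
    induction t with
    | zero =>
      intro a ha
      obtain rfl : a = 0 := by omega
      simp [hs]
    | succ t ih =>
      have hI : Finset.Icc 1 (t + 1) = insert (t + 1) (Finset.Icc 1 t) :=
        (Finset.insert_Icc_right_eq_Icc_add_one (by omega)).symm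
      have hmono : (((Finset.Icc 1 t).filter S).card : ℝ) ≤
          ((Finset.Icc 1 (t + 1)).filter S).card := by
        rw [hI]
        exact_mod_cast Finset.card_le_card
          (Finset.filter_subset_filter _ (Finset.subset_insert _ _))
      have hmono' : ρ * (((Finset.Icc 1 t).filter S).card : ℝ) ≤
          ρ * ((Finset.Icc 1 (t + 1)).filter S).card := by gcongr
      intro a ha
      rcases Nat.lt_or_ge a (t + 1) with h | h
      · linarith [ih a (by omega)]
      obtain rfl : a = t + 1 := by omega
      by_cases hg : ∀ a < t + 1, s (t + 1) ≤ s a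
      · have hSt : S (t + 1) := by
          refine hS _ fun a ha => ?_
          have := hg a ha
          rw [hcnt a (t + 1) ha.le]
          simp only [hs] at this
          push_cast at this ⊢
          linarith
        rw [hI, Finset.filter_insert, if_pos hSt, Finset.card_insert_of_notMem (by simp)]
        have h1 := ih t le_rfl
        have h2 : s t - ρ ≤ s (t + 1) := by
          have : (((Finset.range t).filter Bd).card : ℝ) ≤
              ((Finset.range (t + 1)).filter Bd).card := by
            exact_mod_cast Finset.card_le_card
              (Finset.filter_subset_filter _ (Finset.range_subset_range.2 (Nat.le_succ t)))
          simp only [hs]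
          push_cast
          linarith
        push_cast
        linarith
      · push Not at hg
        obtain ⟨a, ha, hlt⟩ := hg
        linarith [ih a (by omega)]
  have := key n n le_rfl
  simp only [hs] at this
  linarith

theorem exists_far_pair_of_card_le {κ : Type*} [Fintype κ] {n : ℕ} (S : Finset ℕ)
    (hcard : (n : ℝ) / 2 ≤ S.card) (cl : ℕ → κ) {K : ℕ} (hK : 1 ≤ K)
    (hκ : Fintype.card κ ≤ K) (hn : 4 * K ≤ n) :
    ∃ i j, i ∈ S ∧ j ∈ S ∧ i ≤ j ∧ cl i = cl j ∧ (n : ℝ) ≤ 4 * K * (j - i : ℕ) := by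
  classical
  have hK' : (1 : ℝ) ≤ K := by exact_mod_cast hK
  have hn' : 4 * (K : ℝ) ≤ n := by exact_mod_cast hn
  have hSne : S.Nonempty := by
    rw [← Finset.card_pos]
    have : (0 : ℝ) < S.card := by linarith
    exact_mod_cast this
  have hne : (Finset.univ : Finset κ).Nonempty := ⟨cl hSne.choose, Finset.mem_univ _⟩
  obtain ⟨c, -, hc⟩ := Finset.exists_le_card_fiber_of_nsmul_le_card_of_maps_to
    (s := S) (t := Finset.univ) (f := cl) (b := (n : ℝ) / (2 * K))
    (fun a _ => Finset.mem_univ _) hne (by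
      rw [nsmul_eq_mul]
      refine le_trans ?_ hcard
      have : ((Finset.univ : Finset κ).card : ℝ) ≤ K := by exact_mod_cast hκ
      calc _ ≤ (K : ℝ) * (n / (2 * K)) := by gcongr
        _ = n / 2 := by field_simp)
  set T := S.filter fun a => cl a = c with hT
  have hnK : (2 : ℝ) ≤ n / (2 * K) := by
    rw [le_div_iff₀ (by positivity)]
    linarith
  have hTne : T.Nonempty := by
    rw [← Finset.card_pos]
    have : (0 : ℝ) < T.card := by linarith
    exact_mod_cast this
  have hmin := T.min'_mem hTne
  have hmax := T.max'_mem hTne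
  have hle := T.min'_le _ hmax
  refine ⟨T.min' hTne, T.max' hTne, (Finset.mem_filter.1 hmin).1, (Finset.mem_filter.1 hmax).1,
    hle, (Finset.mem_filter.1 hmin).2.trans (Finset.mem_filter.1 hmax).2.symm, ?_⟩
  have hsub : T ⊆ Finset.Icc (T.min' hTne) (T.max' hTne) := fun a ha =>
    Finset.mem_Icc.2 ⟨T.min'_le a ha, T.le_max' a ha⟩
  have h1 := Finset.card_le_card hsub
  rw [Nat.card_Icc] at h1
  have h2 : (T.card : ℝ) ≤ (T.max' hTne - T.min' hTne : ℕ) + 1 := by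
    exact_mod_cast (by omega : T.card ≤ T.max' hTne - T.min' hTne + 1)
  have h3 : (n : ℝ) / (2 * K) ≤ 2 * (T.max' hTne - T.min' hTne : ℕ) := by linarith
  rw [div_le_iff₀ (by positivity)] at h3
  linarith

end Tracks

section Cores

open Module

variable {M : Type*} [NormedAddCommGroup M] [InnerProductSpace ℝ M] [FiniteDimensional ℝ M]
  {A : Type*} {Tr : A → A → Prop}

/-- A stretch of `N` blocks of length `ℓ` of the orbit of `x`, along which every exterior power of
the cocycle comes with an orbit of unit vectors whose growth is controlled outside a sparse set of
blocks. -/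
structure IsCore (Amap : SFT Tr → (M →L[ℝ] M)) (Λ : Fin (finrank ℝ M + 1) → ℝ) (η C ρ : ℝ)
    (ℓ N : ℕ) (x : SFT Tr) (w : ∀ k : Fin (finrank ℝ M + 1), ℕ → M [⋀^Fin k]→L[ℝ] ℝ)
    (μ : Fin (finrank ℝ M + 1) → ℕ → ℝ) (Bd : Finset ℕ) : Prop where
  norm_eq : ∀ (k : Fin (finrank ℝ M + 1)), ∀ a ≤ N, ‖w k a‖ = 1
  map_eq : ∀ (k : Fin (finrank ℝ M + 1)), ∀ a < N,
    pullCoc Amap k ℓ ((shiftSFT Tr)^[a * ℓ] x) (w k (a + 1)) = μ k a • w k a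
  lower : ∀ (k : Fin (finrank ℝ M + 1)), ∀ a < N, Real.exp (-(ℓ * C)) ≤ μ k a
  typical : ∀ a < N, a ∉ Bd → (shiftSFT Tr)^[a * ℓ] x ∉ devSet (normFam M Amap) Λ η ℓ
  le_of_typical : ∀ a < N, a ∉ Bd → ∀ (k : Fin (finrank ℝ M + 1)),
    Real.exp (ℓ * (Λ k - 2 * η)) ≤ μ k a
  card_le : ∀ a < N, ((Finset.Ico a N ∩ Bd).card : ℝ) ≤ ρ * (N - a)

theorem exists_isCore_of_mem_goodSet {Amap : SFT Tr → (M →L[ℝ] M)} {R : ℝ} (hR : 1 ≤ R)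
    (hA : ∀ x, IsUnit (Amap x)) (hb : ∀ x, ‖Amap x‖ ≤ R ∧ ‖Ring.inverse (Amap x)‖ ≤ R)
    {C : ℝ} (hC : C = Real.log (R ^ finrank ℝ M)) {Λ : Fin (finrank ℝ M + 1) → ℝ}
    (hΛ : ∀ k, |Λ k| ≤ C) {η η₀ ζ ρ : ℝ} (hη₀ : 0 < η₀) (hη : η₀ ≤ η) (hρ : 0 < ρ) {ℓ n : ℕ}
    (hℓ : 1 ≤ ℓ)
    (hpar : ζ * n + (finrank ℝ M + 1) * ((n * (2 * η₀ + 2 * C * ζ) + 1) / (2 * η)) ≤ ρ * n / 2)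
    {κ : Type*} [Fintype κ] {K : ℕ} (hK : 1 ≤ K) (hκ : Fintype.card κ ≤ K) (hn : 4 * K ≤ n)
    (cls : SFT Tr → (∀ k : Fin (finrank ℝ M + 1), M [⋀^Fin k]→L[ℝ] ℝ) → κ)
    {y : SFT Tr} (hy : y ∈ goodSet (normFam M Amap) Λ η₀ ζ ℓ n) :
    ∃ i N w μ Bd, i + N ≤ n ∧ (n : ℝ) ≤ 4 * K * N ∧
      IsCore Amap Λ η C ρ ℓ N ((shiftSFT Tr)^[i * ℓ] y) w μ Bd ∧
      cls ((shiftSFT Tr)^[i * ℓ] y) (fun k => w k 0) =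
        cls ((shiftSFT Tr)^[N * ℓ] ((shiftSFT Tr)^[i * ℓ] y)) (fun k => w k N) := by
  classical
  obtain ⟨hy1, hy2⟩ := hy
  have hℓ' : (1 : ℝ) ≤ ℓ := by exact_mod_cast hℓ
  have hC0 : 0 ≤ C := hC ▸ Real.log_nonneg (one_le_pow₀ hR)
  have hexpC : Real.exp C = R ^ finrank ℝ M := by
    rw [hC, Real.exp_log (by positivity)]
  have htrack : ∀ k : Fin (finrank ℝ M + 1), ∃ (w : ℕ → M [⋀^Fin k]→L[ℝ] ℝ) (μ : ℕ → ℝ),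
      (∀ a ≤ n, ‖w a‖ = 1) ∧
      (∀ a < n, pullCoc Amap k ℓ ((shiftSFT Tr)^[a * ℓ] y) (w (a + 1)) = μ a • w a ∧ 0 < μ a) ∧
      ‖pullCoc Amap k (n * ℓ) y‖ / 2 ≤ ∏ a ∈ Finset.range n, μ a := by
    intro k
    have hk := Nat.lt_succ_iff.1 k.2
    have hG : ∀ a < n, pullCoc Amap k ((n - a) * ℓ) ((shiftSFT Tr)^[a * ℓ] y) =
        (pullCoc Amap k ℓ ((shiftSFT Tr)^[a * ℓ] y)).comp
          (pullCoc Amap k ((n - (a + 1)) * ℓ) ((shiftSFT Tr)^[(a + 1) * ℓ] y)) := by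
      intro a ha
      have e1 : (n - a) * ℓ = ℓ + (n - (a + 1)) * ℓ := by
        have : n - a = (n - (a + 1)) + 1 := by omega
        rw [this]; ring
      have e2 : (shiftSFT Tr)^[(a + 1) * ℓ] y = (shiftSFT Tr)^[ℓ] ((shiftSFT Tr)^[a * ℓ] y) := by
        rw [← Function.iterate_add_apply]; congr 1; ring
      rw [e1, e2]
      exact pullCoc_add ..
    obtain ⟨w, μ, h1, h2, h3⟩ := exists_track (n := n)
      (g := fun a => pullCoc Amap k ℓ ((shiftSFT Tr)^[a * ℓ] y))
      (G := fun a => pullCoc Amap k ((n - a) * ℓ) ((shiftSFT Tr)^[a * ℓ] y))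
      (by simp only [Nat.sub_self, Nat.zero_mul]; exact pullCoc_zero ..) hG
      (pullCoc_norm_pos hA hk _ _)
    exact ⟨w, μ, h1, h2, by simpa using h3⟩
  choose w μ hw hμ hprod using htrack
  have hupper : ∀ k, ∀ a < n,
      Real.log (μ k a) ≤ normFam M Amap k ℓ ((shiftSFT Tr)^[a * ℓ] y) := by
    intro k a ha
    have h1 := (pullCoc Amap k ℓ ((shiftSFT Tr)^[a * ℓ] y)).le_opNorm (w k (a + 1))
    rw [(hμ k a ha).1, norm_smul, hw k a ha.le, hw k (a + 1) ha,
      Real.norm_of_nonneg (hμ k a ha).2.le, mul_one, mul_one] at h1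
    exact Real.log_le_log (hμ k a ha).2 h1
  have hlower : ∀ k, ∀ a < n, Real.exp (-(ℓ * C)) ≤ μ k a := by
    intro k a ha
    have h1 := norm_le_pullCoc hR hA (fun x => (hb x).2) (Nat.lt_succ_iff.1 k.2) ℓ
      ((shiftSFT Tr)^[a * ℓ] y) (w k (a + 1))
    rw [(hμ k a ha).1, norm_smul, hw k a ha.le, hw k (a + 1) ha,
      Real.norm_of_nonneg (hμ k a ha).2.le, mul_one, ← hexpC, ← Real.exp_nat_mul] at h1
    rw [Real.exp_neg, inv_le_iff_one_le_mul₀ (Real.exp_pos _), mul_comm]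
    exact h1
  have hF := subaddFamily_normFam hR hA hb
  rw [← hC] at hF
  set Nt : ℕ → Prop := fun a => (shiftSFT Tr)^[a * ℓ] y ∈ devSet (normFam M Amap) Λ η₀ ℓ with hNt
  set Sl : Fin (finrank ℝ M + 1) → ℕ → Prop :=
    fun k a => ¬ Nt a ∧ Real.log (μ k a) < ℓ * Λ k - 2 * (ℓ * η) with hSl
  have hslow : ∀ k, (((Finset.range n).filter (Sl k)).card : ℝ) ≤
      (n * (2 * η₀ + 2 * C * ζ) + 1) / (2 * η) := by
    intro k
    have h := card_filter_lt_le (n := n) (lm := fun a => Real.log (μ k a)) (Nt := Nt)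
      (r := ℓ * Λ k) (η := ℓ * η) (η₀ := ℓ * η₀) (C := 2 * (ℓ * C)) (by positivity)
      (fun a ha hna => ?_) (fun a ha _ => ?_)
    · have h3 : Real.log (‖pullCoc Amap k (n * ℓ) y‖ / 2) ≤
          ∑ a ∈ Finset.range n, Real.log (μ k a) := by
        rw [← Real.log_prod fun a ha => (hμ k a (Finset.mem_range.1 ha)).2.ne']
        exact Real.log_le_log (half_pos (pullCoc_norm_pos hA (Nat.lt_succ_iff.1 k.2) _ _))
          (hprod k)
      rw [Real.log_div (pullCoc_norm_pos hA (Nat.lt_succ_iff.1 k.2) _ _).ne' (by norm_num)] at h3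
      have h4 := hy1 k
      have h5 : normFam M Amap k (n * ℓ) y = Real.log ‖pullCoc Amap k (n * ℓ) y‖ := rfl
      have h6 : Real.log 2 ≤ 1 := by linarith [Real.log_two_lt_d9]
      have h7 : 2 * (ℓ * C) * (((Finset.range n).filter Nt).card : ℝ) ≤
          2 * (ℓ * C) * (ζ * n) := mul_le_mul_of_nonneg_left hy2 (by positivity)
      have hη' : 0 < η := hη₀.trans_le hη
      rw [le_div_iff₀ (by positivity)]
      refine le_of_mul_le_mul_left ?_ (zero_lt_one.trans_le hℓ')
      push_cast at h4
      nlinarith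
    · have h1 := hupper k a ha
      by_contra! hcon
      refine hna ⟨k, ?_⟩
      refine lt_of_lt_of_le ?_ (le_abs_self _)
      linarith
    · have h1 := hupper k a ha
      have h2 := (abs_le.1 (hF.bound k ℓ ((shiftSFT Tr)^[a * ℓ] y))).2
      have h3 := (abs_le.1 (hΛ k)).1
      nlinarith
  set Bd : Finset ℕ := (Finset.range n).filter fun a => Nt a ∨ ∃ k, Sl k a with hBd
  have hBdcard : (Bd.card : ℝ) ≤ ρ * n / 2 := by
    have hsub : Bd ⊆ (Finset.range n).filter Nt ∪
        Finset.univ.biUnion fun k => (Finset.range n).filter (Sl k) := by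
      intro a ha
      rw [hBd, Finset.mem_filter] at ha
      rcases ha.2 with h | ⟨k, h⟩
      · exact Finset.mem_union_left _ (Finset.mem_filter.2 ⟨ha.1, h⟩)
      · exact Finset.mem_union_right _ (Finset.mem_biUnion.2
          ⟨k, Finset.mem_univ _, Finset.mem_filter.2 ⟨ha.1, h⟩⟩)
    have h1 : Bd.card ≤ ((Finset.range n).filter Nt).card +
        ∑ k, ((Finset.range n).filter (Sl k)).card :=
      (Finset.card_le_card hsub).trans ((Finset.card_union_le _ _).trans
        (Nat.add_le_add_left Finset.card_biUnion_le _))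
    have h2 : ((Bd.card : ℕ) : ℝ) ≤ (((Finset.range n).filter Nt).card : ℝ) +
        ∑ k, (((Finset.range n).filter (Sl k)).card : ℝ) := by exact_mod_cast h1
    refine h2.trans (le_trans (add_le_add hy2 (Finset.sum_le_card_nsmul _ _ _ fun k _ =>
      hslow k)) ?_)
    simpa using hpar
  set S : ℕ → Prop := fun t => ∀ a < t,
    (((Finset.Ico a t).filter (· ∈ Bd)).card : ℝ) ≤ ρ * (t - a) with hS
  have hpliss := card_sparse_times_ge (· ∈ Bd) hρ.le n S (fun t h => h)
  have hScard : (n : ℝ) / 2 ≤ ((Finset.Icc 1 n).filter S).card := by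
    have h1 : ((Finset.range n).filter (· ∈ Bd)).card ≤ Bd.card :=
      Finset.card_le_card fun a ha => (Finset.mem_filter.1 ha).2
    have h1' : (((Finset.range n).filter (· ∈ Bd)).card : ℝ) ≤ Bd.card := by exact_mod_cast h1
    refine le_of_mul_le_mul_left ?_ hρ
    linarith
  obtain ⟨i, j, hi, hj, hij, hcl, hnj⟩ := exists_far_pair_of_card_le ((Finset.Icc 1 n).filter S)
    hScard (fun i => cls ((shiftSFT Tr)^[i * ℓ] y) fun k => w k i) hK hκ hn
  obtain ⟨N, rfl⟩ := Nat.exists_eq_add_of_le hij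
  rw [Nat.add_sub_cancel_left] at hnj
  rw [Finset.mem_filter, Finset.mem_Icc] at hj hi
  have hit : ∀ a, (shiftSFT Tr)^[a * ℓ] ((shiftSFT Tr)^[i * ℓ] y) =
      (shiftSFT Tr)^[(i + a) * ℓ] y := by
    intro a
    rw [← Function.iterate_add_apply]; congr 1; ring
  refine ⟨i, N, fun k a => w k (i + a), fun k a => μ k (i + a),
    (Finset.range n).filter (fun a => i + a ∈ Bd), hj.1.2, hnj, ⟨?_, ?_, ?_, ?_, ?_, ?_⟩, ?_⟩
  · exact fun k a ha => hw k _ (by omega)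
  · intro k a ha
    rw [hit]
    exact (hμ k (i + a) (by omega)).1
  · exact fun k a ha => hlower k _ (by omega)
  · intro a ha hna
    rw [hit]
    have h1 : ¬ Nt (i + a) := fun h => hna (Finset.mem_filter.2 ⟨Finset.mem_range.2 (by omega),
      Finset.mem_filter.2 ⟨Finset.mem_range.2 (by omega), Or.inl h⟩⟩)
    rintro ⟨k, hk⟩
    refine h1 ⟨k, lt_of_le_of_lt ?_ hk⟩
    exact mul_le_mul_of_nonneg_left hη (Nat.cast_nonneg _)
  · intro a ha hna k
    have h1 : ¬ (Nt (i + a) ∨ ∃ k, Sl k (i + a)) := fun h =>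
      hna (Finset.mem_filter.2 ⟨Finset.mem_range.2 (by omega),
        Finset.mem_filter.2 ⟨Finset.mem_range.2 (by omega), h⟩⟩)
    push Not at h1
    have h2 : ¬ Sl k (i + a) := h1.2 k
    have h3 : ℓ * Λ k - 2 * (ℓ * η) ≤ Real.log (μ k (i + a)) := by
      by_contra! hcon
      exact h2 ⟨h1.1, hcon⟩
    rw [← Real.le_log_iff_exp_le (hμ k (i + a) (by omega)).2]
    linarith
  · intro a ha
    have h1 := hj.2 (i + a) (by omega)
    push_cast at h1
    rw [show ((i : ℝ) + N - (i + a)) = N - a by ring] at h1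
    refine le_trans ?_ h1
    have h2 : (Finset.Ico a N ∩ (Finset.range n).filter (fun a => i + a ∈ Bd)).card ≤
        ((Finset.Ico (i + a) (i + N)).filter (· ∈ Bd)).card := by
      refine Finset.card_le_card_of_injOn (fun b => i + b) (fun b hb => ?_)
        (fun b _ c _ h => Nat.add_left_cancel h)
      simp only [Finset.coe_inter, Finset.coe_filter, Finset.coe_Ico, mem_inter_iff,
        Set.mem_Ico, mem_ofPred_eq, Finset.mem_range, Finset.mem_Ico] at hb ⊢
      exact ⟨by omega, hb.2.2⟩
    exact_mod_cast h2
  · simp only [hit]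
    exact hcl

end Cores

section ConeStretch

open Module

theorem exists_cone_stretch {V : Type*} [NormedAddCommGroup V] [NormedSpace ℝ V] {N : ℕ}
    {g g' H : ℕ → V →L[ℝ] V} {w : ℕ → V} {μ e : ℕ → ℝ} {Bd : Finset ℕ} {Γ Γ' β τ σ ρ ς : ℝ}
    (hτ : 0 ≤ τ) (hς : 0 < ς) (hς1 : 2 * ς ≤ 1)
    (hN : H N = ContinuousLinearMap.id ℝ V) (hH : ∀ a < N, H a = (g' a).comp (H (a + 1)))
    (hw : ∀ a ≤ N, ‖w a‖ = 1) (hμ : ∀ a < N, 0 < μ a)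
    (hg : ∀ a < N, g a (w (a + 1)) = μ a • w a) (he : ∀ a < N, ‖g' a - g a‖ ≤ e a)
    (hea : ∀ a < N, 4 * e a / μ a ≤ ς * Real.exp (-(τ * (N - a))))
    (hΓ : ∀ a < N, a ∉ Bd → ‖g a‖ ≤ Γ * μ a)
    (hβ : ∀ a < N, a ∉ Bd → ∃ (ξ : V →L[ℝ] ℝ) (v : V), ‖g a - ξ.smulRight v‖ ≤ β * μ a)
    (hβ1 : β ≤ 1 / 2) (hΓς : 16 * Γ * ς ≤ 1) (hΓ0 : 0 ≤ Γ)
    (hΓβ : 10 * Γ * β ≤ Real.exp (-τ) / 2)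
    (hΓ' : ∀ a < N, a ∈ Bd → ‖g a‖ ≤ Γ' * μ a) (hΓ'Q : Γ' ≤ Real.exp (σ - τ) / 2)
    (hσ : 0 ≤ σ) (hρσ : ρ * σ ≤ τ / 2)
    (hcard : ∀ a < N, ((Finset.Ico a N ∩ Bd).card : ℝ) ≤ ρ * (N - a))
    (hlong : Real.exp (-(τ * N / 2)) ≤ 1 / 2) {x : V} (hx : ‖x‖ ≤ 2 * ς) :
    ∃ (c : ℝ) (x' : V), ∏ a ∈ Finset.range N, μ a / 2 ≤ c ∧ H 0 (w N + x) = c • (w 0 + x') ∧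
      ‖x'‖ ≤ ς := by
  set S : ℕ → ℝ := fun a =>
    2 * ς * Real.exp (-(τ * (N - a)) + σ * (Finset.Ico a N ∩ Bd).card) with hS
  have hSle : ∀ a ≤ N, S a ≤ 2 * ς * Real.exp (-(τ * (N - a) / 2)) := by
    intro a ha
    refine mul_le_mul_of_nonneg_left (Real.exp_le_exp.2 ?_) (by positivity)
    have hNa : (0 : ℝ) ≤ N - a := sub_nonneg.2 (by exact_mod_cast ha)
    rcases ha.lt_or_eq with h | h
    · have h1 := hcard a h
      have h2 : σ * ((Finset.Ico a N ∩ Bd).card : ℝ) ≤ σ * (ρ * (N - a)) :=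
        mul_le_mul_of_nonneg_left h1 hσ
      have h3 : ρ * σ * (N - a) ≤ τ / 2 * (N - a) := mul_le_mul_of_nonneg_right hρσ hNa
      linarith
    · subst h
      simp
  have hSς : ∀ a ≤ N, S a ≤ 2 * ς := by
    intro a ha
    refine (hSle a ha).trans ?_
    have hNa : (0 : ℝ) ≤ N - a := sub_nonneg.2 (by exact_mod_cast ha)
    have h1 : Real.exp (-(τ * (N - a) / 2)) ≤ 1 := Real.exp_le_one_iff.2 (by
      have := mul_nonneg hτ hNa
      linarith)
    nlinarith
  have hSge : ∀ a : ℕ, 2 * ς * Real.exp (-(τ * (N - a))) ≤ S a := by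
    intro a
    refine mul_le_mul_of_nonneg_left (Real.exp_le_exp.2 ?_) (by positivity)
    have : 0 ≤ σ * ((Finset.Ico a N ∩ Bd).card : ℝ) := by positivity
    linarith
  have hsplit : ∀ a < N, Finset.Ico a N = insert a (Finset.Ico (a + 1) N) := fun a ha =>
    (Finset.insert_Ico_add_one_left_eq_Ico ha).symm
  have hstep : ∀ a < N, ∀ x, ‖x‖ ≤ S (a + 1) → ∃ (c : ℝ) (x' : V), μ a / 2 ≤ c ∧
      g' a (w (a + 1) + x) = c • (w a + x') ∧ ‖x'‖ ≤ S a := by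
    intro a ha x hx
    have hx2 : ‖x‖ ≤ 2 * ς := hx.trans (hSς (a + 1) ha)
    have hx1 : ‖x‖ ≤ 1 := hx2.trans hς1
    have hsmall : 4 * e a / μ a ≤ S a / 2 := by
      have := hea a ha
      have := hSge a
      linarith
    have hexp : (-(τ * (N - (a + 1 : ℕ)))) = τ + -(τ * (N - a)) := by push_cast; ring
    by_cases hbad : a ∈ Bd
    · obtain ⟨c, x', h1, h2, h3⟩ := exists_cone_step_of_norm_le (hw (a + 1) ha) (hμ a ha)
        (hg a ha) (he a ha) (hΓ' a ha hbad) hx1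
      refine ⟨c, x', h1, h2, h3.trans ?_⟩
      have hc : ((Finset.Ico a N ∩ Bd).card : ℝ) = (Finset.Ico (a + 1) N ∩ Bd).card + 1 := by
        rw [hsplit a ha, Finset.insert_inter_of_mem hbad, Finset.card_insert_of_notMem (by simp)]
        push_cast
        rfl
      have hSa : Real.exp (σ - τ) * S (a + 1) = S a := by
        simp only [hS]
        rw [hc, hexp, mul_left_comm, ← Real.exp_add]
        ring_nf
      have h4 : Γ' * ‖x‖ ≤ Real.exp (σ - τ) / 2 * S (a + 1) :=
        mul_le_mul hΓ'Q hx (norm_nonneg _) (by positivity)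
      linarith
    · obtain ⟨ξ, v, hξ⟩ := hβ a ha hbad
      have hΓx : 8 * Γ * ‖x‖ ≤ 1 := by nlinarith
      obtain ⟨c, x', h1, h2, h3⟩ := exists_cone_step_of_rankOne (hw (a + 1) ha) (hw a ha.le)
        (hμ a ha) (hg a ha) (he a ha) (hΓ a ha hbad) hξ hβ1 hΓx
      refine ⟨c, x', h1, h2, h3.trans ?_⟩
      have hc : ((Finset.Ico a N ∩ Bd).card : ℝ) = (Finset.Ico (a + 1) N ∩ Bd).card := by
        rw [hsplit a ha, Finset.insert_inter_of_notMem hbad]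
      have hSa : Real.exp (-τ) * S (a + 1) = S a := by
        simp only [hS]
        rw [hc, hexp, mul_left_comm, ← Real.exp_add]
        ring_nf
      have h4 : 10 * Γ * β * ‖x‖ ≤ Real.exp (-τ) / 2 * S (a + 1) :=
        mul_le_mul hΓβ hx (norm_nonneg _) (by positivity)
      linarith
  have hxN : ‖x‖ ≤ S N := by
    have := hSge N
    simp only [sub_self, mul_zero, neg_zero, Real.exp_zero, mul_one] at this
    exact hx.trans this
  obtain ⟨c, x', h1, h2, h3⟩ := exists_cone_iterate (fun a ha => (half_pos (hμ a ha)).le) hN hH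
    hstep hxN (Nat.zero_le N)
  refine ⟨c, x', ?_, h2, h3.trans ?_⟩
  · rwa [Finset.range_eq_Ico]
  · have := hSle 0 (Nat.zero_le N)
    simp only [Nat.cast_zero, sub_zero] at this
    nlinarith

variable {M : Type*} [NormedAddCommGroup M] [InnerProductSpace ℝ M] [FiniteDimensional ℝ M]
  {A : Type*} {Tr : A → A → Prop}

theorem exists_rankOne_of_not_mem_devSet {Amap : SFT Tr → (M →L[ℝ] M)}
    (hA : ∀ x, IsUnit (Amap x)) {C₀ : ℝ}
    (hC₀ : ∀ L : M →L[ℝ] M, IsUnit L → ∀ k ≤ finrank ℝ M, 0 < ‖extPull k L‖ ∧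
      |Real.log ‖extPull k L‖ - Real.log (singProd L k)| ≤ C₀)
    {Λ : Fin (finrank ℝ M + 1) → ℝ} {η κ : ℝ} {ℓ : ℕ} {x : SFT Tr}
    (hx : x ∉ devSet (normFam M Amap) Λ η ℓ) {k : ℕ} (hk : k + 1 < finrank ℝ M)
    (hκ : κ ≤ 2 * Λ ⟨k + 1, by omega⟩ - Λ ⟨k, by omega⟩ - Λ ⟨k + 2, by omega⟩) {m : ℝ}
    (hm : Real.exp (ℓ * (Λ ⟨k + 1, by omega⟩ - 2 * η)) ≤ m) :
    ∃ (ξ : (M [⋀^Fin (k + 1)]→L[ℝ] ℝ) →L[ℝ] ℝ) (a : M [⋀^Fin (k + 1)]→L[ℝ] ℝ),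
      ‖pullCoc Amap (k + 1) ℓ x - ξ.smulRight a‖ ≤
      (finrank ℝ M : ℝ) ^ finrank ℝ M * Real.exp (3 * C₀) * Real.exp (ℓ * (5 * η - κ)) * m := by
  have hL := isUnit_cocycle hA ℓ x
  set L := cocycle Tr Amap ℓ x with hLdef
  obtain ⟨ξ, a, h⟩ := exists_rankOne_extPull L hk
  refine ⟨ξ, a, ?_⟩
  refine h.trans ?_
  have hd : (1 : ℝ) ≤ finrank ℝ M := by
    have : 1 ≤ finrank ℝ M := by omega
    exact_mod_cast this
  have hdev : ∀ j (hj : j ≤ finrank ℝ M),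
      |Real.log ‖extPull j L‖ - ℓ * Λ ⟨j, by omega⟩| ≤ ℓ * η := by
    intro j hj
    by_contra! hcon
    exact hx ⟨⟨j, by omega⟩, hcon⟩
  have hb : ∀ j (hj : j ≤ finrank ℝ M),
      |Real.log (singProd L j) - ℓ * Λ ⟨j, by omega⟩| ≤ ℓ * η + C₀ := by
    intro j hj
    have h1 := abs_le.1 (hdev j hj)
    have h2 := abs_le.1 (hC₀ L hL j hj).2
    exact abs_le.2 ⟨by linarith, by linarith⟩
  have hp0 := singProd_pos hL (show k ≤ finrank ℝ M by omega)
  have hp1 := singProd_pos hL (show k + 1 ≤ finrank ℝ M by omega)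
  have hp2 := singProd_pos hL (show k + 2 ≤ finrank ℝ M by omega)
  have hprod : singProd L k * singVal L (k + 2) =
      singProd L k * singProd L (k + 2) / singProd L (k + 1) := by
    have : singProd L (k + 2) = singProd L (k + 1) * singVal L (k + 2) := by
      rw [singProd, Finset.prod_range_succ]; rfl
    rw [this]
    field_simp
  have hle : singProd L k * singVal L (k + 2) ≤
      Real.exp (3 * C₀) * Real.exp (ℓ * (5 * η - κ)) * m := by
    rw [hprod]
    have h0 := abs_le.1 (hb k (by omega))
    have h1 := abs_le.1 (hb (k + 1) (by omega))
    have h2 := abs_le.1 (hb (k + 2) (by omega))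
    have h3 : singProd L k * singProd L (k + 2) / singProd L (k + 1) = Real.exp
        (Real.log (singProd L k) + Real.log (singProd L (k + 2)) -
          Real.log (singProd L (k + 1))) := by
      rw [Real.exp_sub, Real.exp_add, Real.exp_log hp0, Real.exp_log hp1, Real.exp_log hp2]
    rw [h3]
    refine le_trans ?_ (mul_le_mul_of_nonneg_left hm (by positivity))
    rw [← Real.exp_add, ← Real.exp_add, Real.exp_le_exp]
    have h4 := mul_le_mul_of_nonneg_left hκ (Nat.cast_nonneg (α := ℝ) ℓ)
    linarith
  have hpow : (finrank ℝ M : ℝ) ^ (k + 1) ≤ (finrank ℝ M : ℝ) ^ finrank ℝ M :=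
    pow_le_pow_right₀ hd (by omega)
  have hnn : 0 ≤ singProd L k * singVal L (k + 2) := mul_nonneg hp0.le (singVal_nonneg _ _ hk)
  calc _ ≤ (finrank ℝ M : ℝ) ^ finrank ℝ M *
      (Real.exp (3 * C₀) * Real.exp (ℓ * (5 * η - κ)) * m) := mul_le_mul hpow hle hnn
          (by positivity)
    _ = _ := by ring

end ConeStretch

section ConeCore

open Module

variable {M : Type*} [NormedAddCommGroup M] [InnerProductSpace ℝ M] [FiniteDimensional ℝ M]
  {A : Type*} {Tr : A → A → Prop}

/-- A distortion constant for products of `n` matrices of norm at most `R` acting on forms of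
degree at most `d`. -/
noncomputable def distConst (R : ℝ) (d n : ℕ) : ℝ := d * (R ^ n) ^ d * (n * R ^ n)

theorem distConst_nonneg {R : ℝ} (hR : 1 ≤ R) (d n : ℕ) : 0 ≤ distConst R d n := by
  have : 0 ≤ R := by linarith
  rw [distConst]
  positivity

theorem norm_pullCoc_sub_le_distConst {Amap Bmap : SFT Tr → (M →L[ℝ] M)} {R e : ℝ} (hR : 1 ≤ R)
    (he : 0 ≤ e) (hA : ∀ x, ‖Amap x‖ ≤ R) (hB : ∀ x, ‖Bmap x‖ ≤ R) {k d : ℕ} (hk : k ≤ d) (n : ℕ)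
    (x y : SFT Tr)
    (h : ∀ j < n, ‖Bmap ((shiftSFT Tr)^[j] x) - Amap ((shiftSFT Tr)^[j] y)‖ ≤ e) :
    ‖pullCoc Bmap k n x - pullCoc Amap k n y‖ ≤ distConst R d n * e := by
  have hR0 : 0 ≤ R := by linarith
  refine (norm_pullCoc_sub_le hR he hA hB k n x y h).trans ?_
  rw [distConst, mul_assoc (d * (R ^ n) ^ d : ℝ)]
  have h1 : (k : ℝ) ≤ d := by exact_mod_cast hk
  have h2 : (R ^ n) ^ k ≤ (R ^ n) ^ d := pow_le_pow_right₀ (one_le_pow₀ hR) hk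
  have h3 : (k : ℝ) * (R ^ n) ^ k ≤ d * (R ^ n) ^ d := by gcongr
  exact mul_le_mul_of_nonneg_right h3 (by positivity)

theorem norm_pullCoc_sub_le_of_agree {Amap Bmap : SFT Tr → (M →L[ℝ] M)} {R Ch θ δ : ℝ} (hR : 1 ≤ R)
    (hA : ∀ x, ‖Amap x‖ ≤ R) (hB : ∀ x, ‖Bmap x‖ ≤ R) (hCh : 0 ≤ Ch) (hθ0 : 0 ≤ θ)
    (hH : ∀ x y : SFT Tr, ∀ n : ℕ, (∀ i < n, x.1 i = y.1 i) → ‖Amap x - Amap y‖ ≤ Ch * θ ^ n)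
    (hδ : ∀ x, ‖Amap x - Bmap x‖ ≤ δ) {k d : ℕ} (hk : k ≤ d) {n m : ℕ} {z x : SFT Tr}
    (hzx : ∀ j < n + m, z.1 j = x.1 j) :
    ‖pullCoc Bmap k n z - pullCoc Amap k n x‖ ≤ distConst R d n * (δ + Ch * θ ^ m) := by
  have hδ0 : 0 ≤ δ := (norm_nonneg _).trans (hδ z)
  refine norm_pullCoc_sub_le_distConst hR (by positivity) hA hB hk n z x fun j hj => ?_
  have h1 : ‖Bmap ((shiftSFT Tr)^[j] z) - Amap ((shiftSFT Tr)^[j] z)‖ ≤ δ := by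
    rw [norm_sub_rev]; exact hδ _
  have h2 : ‖Amap ((shiftSFT Tr)^[j] z) - Amap ((shiftSFT Tr)^[j] x)‖ ≤ Ch * θ ^ m := by
    refine hH _ _ m fun i hi => ?_
    rw [shift_iterate_apply, shift_iterate_apply]
    exact hzx _ (by omega)
  calc _ = ‖(Bmap ((shiftSFT Tr)^[j] z) - Amap ((shiftSFT Tr)^[j] z)) +
        (Amap ((shiftSFT Tr)^[j] z) - Amap ((shiftSFT Tr)^[j] x))‖ := by rw [sub_add_sub_cancel]
    _ ≤ _ := (norm_add_le _ _).trans (add_le_add h1 h2)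

theorem IsCore.exists_map_add_eq {Amap Bmap : SFT Tr → (M →L[ℝ] M)}
    {Λ : Fin (finrank ℝ M + 1) → ℝ} {η C ρ : ℝ} {ℓ N : ℕ} {x : SFT Tr}
    {w : ∀ k : Fin (finrank ℝ M + 1), ℕ → M [⋀^Fin k]→L[ℝ] ℝ}
    {μ : Fin (finrank ℝ M + 1) → ℕ → ℝ} {Bd : Finset ℕ}
    (hc : IsCore Amap Λ η C ρ ℓ N x w μ Bd)
    (hAu : ∀ x, IsUnit (Amap x)) (hF : SubaddFamily (normFam M Amap) C) (hΛ : ∀ k, |Λ k| ≤ C)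
    {R Ch θ δ : ℝ} (hR : 1 ≤ R)
    (hA : ∀ x, ‖Amap x‖ ≤ R) (hB : ∀ x, ‖Bmap x‖ ≤ R) (hCh : 0 ≤ Ch) (hθ0 : 0 ≤ θ)
    (hH : ∀ x y : SFT Tr, ∀ n : ℕ, (∀ i < n, x.1 i = y.1 i) → ‖Amap x - Amap y‖ ≤ Ch * θ ^ n)
    (hδ : ∀ x, ‖Amap x - Bmap x‖ ≤ δ) {τ σ β ς : ℝ} {L : ℕ} (hlη : 1 ≤ ℓ * η)
    (hρη : 2 * C * ρ ≤ η) (hτ : 0 ≤ τ) (hς : 0 < ς) (hς1 : 2 * ς ≤ 1) (hβ1 : β ≤ 1 / 2)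
    (hΓς : 16 * Real.exp (3 * (ℓ * η)) * ς ≤ 1)
    (hΓβ : 10 * Real.exp (3 * (ℓ * η)) * β ≤ Real.exp (-τ) / 2)
    (hσC : Real.exp (2 * (ℓ * C)) ≤ Real.exp (σ - τ) / 2) (hσ : 0 ≤ σ) (hρσ : ρ * σ ≤ τ / 2)
    (hlong : Real.exp (-(τ * N / 2)) ≤ 1 / 2) (hθτ : θ ^ ℓ ≤ Real.exp (-τ))
    (hLς : 8 * Real.exp (ℓ * C) * distConst R (finrank ℝ M) ℓ * (Ch * (θ ^ ℓ) ^ L) ≤ ς)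
    (hδς : 8 * Real.exp (ℓ * C) * distConst R (finrank ℝ M) ℓ * δ ≤ ς * Real.exp (-(τ * N)))
    {k : Fin (finrank ℝ M + 1)}
    (hk : ∀ y : SFT Tr, y ∉ devSet (normFam M Amap) Λ η ℓ → ∀ m : ℝ,
      Real.exp (ℓ * (Λ k - 2 * η)) ≤ m → ∃ (ξ : (M [⋀^Fin k]→L[ℝ] ℝ) →L[ℝ] ℝ)
        (a : M [⋀^Fin k]→L[ℝ] ℝ), ‖pullCoc Amap k ℓ y - ξ.smulRight a‖ ≤ β * m)
    {z : SFT Tr} (hzx : ∀ j < (N + (L + 1)) * ℓ, z.1 j = x.1 j)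
    {v : M [⋀^Fin k]→L[ℝ] ℝ} (hv : ‖v‖ ≤ 2 * ς) :
    ∃ (c : ℝ) (v' : M [⋀^Fin k]→L[ℝ] ℝ), Real.exp ((N * ℓ : ℕ) * (Λ k - 4 * η)) ≤ c ∧
      pullCoc Bmap k (N * ℓ) z (w k N + v) = c • (w k 0 + v') ∧ ‖v'‖ ≤ ς := by
  have hC0 := hF.nonneg
  have hkd := Nat.lt_succ_iff.1 k.2
  have hμ : ∀ a < N, 0 < μ k a := fun a ha => (Real.exp_pos _).trans_le (hc.lower k a ha)
  have hpow : ∀ a, a < N → (θ ^ ℓ) ^ (N - a) ≤ Real.exp (-(τ * (N - a))) := by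
    intro a ha
    refine (pow_le_pow_left₀ (by positivity) hθτ _).trans_eq ?_
    rw [← Real.exp_nat_mul, Nat.cast_sub ha.le]
    ring_nf
  have hnorm : ∀ a, a < N → ‖pullCoc Amap k ℓ ((shiftSFT Tr)^[a * ℓ] x)‖ =
      Real.exp (normFam M Amap k ℓ ((shiftSFT Tr)^[a * ℓ] x)) := fun a ha =>
    (Real.exp_log (pullCoc_norm_pos hAu hkd _ _)).symm
  set D := distConst R (finrank ℝ M) ℓ
  have hD : 0 ≤ D := distConst_nonneg hR _ _
  obtain ⟨c, v', h1, h2, h3⟩ := exists_cone_stretch (N := N)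
    (g := fun a => pullCoc Amap k ℓ ((shiftSFT Tr)^[a * ℓ] x))
    (g' := fun a => pullCoc Bmap k ℓ ((shiftSFT Tr)^[a * ℓ] z))
    (H := fun a => pullCoc Bmap k ((N - a) * ℓ) ((shiftSFT Tr)^[a * ℓ] z))
    (w := w k) (μ := μ k) (e := fun a => D * (δ + Ch * (θ ^ ℓ) ^ (N - a + L))) (Bd := Bd)
    (Γ := Real.exp (3 * (ℓ * η))) (Γ' := Real.exp (2 * (ℓ * C))) (β := β) (τ := τ) (σ := σ) (ρ := ρ)
    (ς := ς) hτ hς hς1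
    (by simp only [Nat.sub_self, Nat.zero_mul]; exact pullCoc_zero ..)
    (by
      intro a ha
      have e1 : (N - a) * ℓ = ℓ + (N - (a + 1)) * ℓ := by
        have : N - a = (N - (a + 1)) + 1 := by omega
        rw [this]; ring
      have e2 : (shiftSFT Tr)^[(a + 1) * ℓ] z = (shiftSFT Tr)^[ℓ] ((shiftSFT Tr)^[a * ℓ] z) := by
        rw [← Function.iterate_add_apply]; congr 1; ring
      simp only [e2]
      rw [e1]
      exact pullCoc_add ..)
    (hc.norm_eq k) hμ (hc.map_eq k)
    (by
      intro a ha
      rw [← pow_mul]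
      refine norm_pullCoc_sub_le_of_agree hR hA hB hCh hθ0 hH hδ hkd fun j hj => ?_
      rw [shift_iterate_apply, shift_iterate_apply]
      refine hzx _ ?_
      obtain ⟨b, rfl⟩ := Nat.exists_eq_add_of_lt ha
      have hb : a + b + 1 - a = b + 1 := by omega
      rw [hb] at hj
      nlinarith)
    (by
      intro a ha
      have h1 := hc.lower k a ha
      have h2 : (D * (δ + Ch * (θ ^ ℓ) ^ (N - a + L))) * 4 * Real.exp (ℓ * C) ≤
          ς * Real.exp (-(τ * (N - a))) := by
        have h3 : Real.exp (-(τ * N)) ≤ Real.exp (-(τ * (N - a))) := by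
          rw [Real.exp_le_exp]
          have : 0 ≤ τ * (a : ℝ) := by positivity
          linarith
        have h4 : 8 * Real.exp (ℓ * C) * D * (Ch * (θ ^ ℓ) ^ L) * (θ ^ ℓ) ^ (N - a) ≤
            ς * Real.exp (-(τ * (N - a))) :=
          mul_le_mul hLς (hpow a ha) (by positivity) hς.le
        have h5 : ς * Real.exp (-(τ * N)) ≤ ς * Real.exp (-(τ * (N - a))) :=
          mul_le_mul_of_nonneg_left h3 hς.le
        rw [pow_add]
        nlinarith
      rw [div_le_iff₀ (hμ a ha)]
      refine le_of_mul_le_mul_right ?_ (Real.exp_pos (ℓ * C))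
      have h6 : 1 ≤ μ k a * Real.exp (ℓ * C) := by
        rw [Real.exp_neg, inv_le_iff_one_le_mul₀ (Real.exp_pos _)] at h1
        exact h1
      have h7 : 0 ≤ ς * Real.exp (-(τ * (N - a))) := by positivity
      nlinarith)
    (by
      intro a ha hna
      rw [hnorm a ha]
      have h1 : normFam M Amap k ℓ ((shiftSFT Tr)^[a * ℓ] x) ≤ 3 * (ℓ * η) + ℓ * (Λ k - 2 * η) := by
        by_contra! hcon
        refine hc.typical a ha hna ⟨k, lt_of_lt_of_le ?_ (le_abs_self _)⟩
        linarith
      refine (Real.exp_le_exp.2 h1).trans ?_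
      rw [Real.exp_add]
      exact mul_le_mul_of_nonneg_left (hc.le_of_typical a ha hna k) (Real.exp_pos _).le)
    (fun a ha hna => hk _ (hc.typical a ha hna) _ (hc.le_of_typical a ha hna k))
    hβ1 hΓς (Real.exp_pos _).le hΓβ
    (by
      intro a ha _
      rw [hnorm a ha]
      have h1 := (abs_le.1 (hF.bound k ℓ ((shiftSFT Tr)^[a * ℓ] x))).2
      have h2 : normFam M Amap k ℓ ((shiftSFT Tr)^[a * ℓ] x) ≤ 2 * (ℓ * C) + -(ℓ * C) := by
        linarith
      refine (Real.exp_le_exp.2 h2).trans ?_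
      rw [Real.exp_add]
      exact mul_le_mul_of_nonneg_left (hc.lower k a ha) (Real.exp_pos _).le)
    hσC hσ hρσ hc.card_le hlong hv
  refine ⟨c, v', le_trans ?_ h1, by simpa using h2, h3⟩
  rcases Nat.eq_zero_or_pos N with rfl | hN
  · simp
  have hcard := hc.card_le 0 hN
  simp only [Nat.cast_zero, sub_zero] at hcard
  have hlog2 : Real.exp (-(ℓ * η)) ≤ 1 / 2 := by
    have h1 : Real.exp (-(ℓ * η)) ≤ Real.exp (-Real.log 2) := by
      rw [Real.exp_le_exp]
      linarith [Real.log_two_lt_d9]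
    rw [Real.exp_neg (Real.log 2), Real.exp_log (by norm_num)] at h1
    linarith
  have hfac : ∀ a ∈ Finset.range N, Real.exp (ℓ * (Λ k - 3 * η) -
      (if a ∈ Finset.Ico 0 N ∩ Bd then 2 * (ℓ * C) else 0)) ≤ μ k a / 2 := by
    intro a ha
    have ha' := Finset.mem_range.1 ha
    have h4 : ∀ t : ℝ, Real.exp t ≤ μ k a → Real.exp (t - ℓ * η) ≤ μ k a / 2 := by
      intro t ht
      rw [sub_eq_add_neg, Real.exp_add, div_eq_mul_one_div]
      exact mul_le_mul ht hlog2 (Real.exp_pos _).le (hμ a ha').le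
    split_ifs with h
    · refine le_trans (Real.exp_le_exp.2 ?_) (h4 _ (hc.lower k a ha'))
      have h5 := (abs_le.1 (hΛ k)).2
      have h6 : (ℓ : ℝ) * Λ k ≤ ℓ * C := mul_le_mul_of_nonneg_left h5 (Nat.cast_nonneg _)
      nlinarith
    · have hna : a ∉ Bd := fun hb => h (Finset.mem_inter.2
        ⟨Finset.mem_Ico.2 ⟨Nat.zero_le _, ha'⟩, hb⟩)
      refine le_trans (Real.exp_le_exp.2 ?_) (h4 _ (hc.le_of_typical a ha' hna k))
      linarith
  refine le_trans ?_ (Finset.prod_le_prod (fun a _ => (Real.exp_pos _).le) hfac)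
  rw [← Real.exp_sum, Real.exp_le_exp, Finset.sum_sub_distrib, Finset.sum_const, Finset.card_range,
    nsmul_eq_mul, ← Finset.sum_filter, Finset.sum_const, nsmul_eq_mul]
  have h8 : (((Finset.range N).filter (· ∈ Finset.Ico 0 N ∩ Bd)).card : ℝ) ≤ ρ * N := by
    refine le_trans ?_ hcard
    exact_mod_cast Finset.card_le_card fun a ha => (Finset.mem_filter.1 ha).2
  have h9 := mul_le_mul_of_nonneg_right h8 (show 0 ≤ 2 * (ℓ * C) by positivity)
  have h10 := mul_le_mul_of_nonneg_left hρη (show (0 : ℝ) ≤ N * ℓ by positivity)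
  push_cast
  nlinarith

end ConeCore

section Concatenation

open Module

theorem nonneg_of_midpoint_le {d : ℕ} {u : Fin (d + 1) → ℝ}
    (h : ∀ k, 0 ≤ u k ∨ ∃ (j : ℕ) (hj : j + 2 < d + 1), k = ⟨j + 1, by omega⟩ ∧
      u ⟨j, by omega⟩ + u ⟨j + 2, hj⟩ ≤ 2 * u ⟨j + 1, by omega⟩) (k : Fin (d + 1)) : 0 ≤ u k := by
  classical
  obtain ⟨m, hm⟩ := Finite.exists_min u
  have hne : (Finset.univ.filter fun i => u i = u m).Nonempty := ⟨m, by simp⟩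
  set i := (Finset.univ.filter fun i => u i = u m).min' hne with hi
  have him : u i = u m := (Finset.mem_filter.1 (Finset.min'_mem _ hne)).2
  rcases h i with h0 | ⟨j, hj, hij, hle⟩
  · exact h0.trans (him ▸ hm k)
  · exfalso
    have h1 : u m < u ⟨j, by omega⟩ := by
      refine lt_of_le_of_ne (hm _) fun heq => ?_
      have h2 : i ≤ (⟨j, by omega⟩ : Fin (d + 1)) :=
        Finset.min'_le (Finset.univ.filter fun i => u i = u m) ⟨j, by omega⟩
          (Finset.mem_filter.2 ⟨Finset.mem_univ _, heq.symm⟩)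
      rw [hij, Fin.mk_le_mk] at h2
      omega
    have h3 := hm ⟨j + 2, hj⟩
    rw [← hij, him] at hle
    linarith

theorem exists_concat {A : Type*} {Tr : A → A → Prop} {ι : Type*} {n P : ℕ} (hP : 1 ≤ P)
    (hPn : P ≤ n) (Y : ι → SFT Tr) (hY : ∀ u u', ∀ j < P, (Y u).1 (n + j) = (Y u').1 j)
    (ω : ℕ → ι) :
    ∃ z : SFT Tr, ∀ i, ∀ j < n + P, z.1 (i * n + j) = (Y (ω i)).1 j := by
  have hn : 0 < n := by omega
  have hdm : ∀ i j, j < n → (i * n + j) / n = i ∧ (i * n + j) % n = j := by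
    intro i j hj
    constructor
    · rw [Nat.add_comm, Nat.add_mul_div_right _ _ hn, Nat.div_eq_of_lt hj, Nat.zero_add]
    · rw [Nat.add_comm, Nat.add_mul_mod_self_right, Nat.mod_eq_of_lt hj]
  set f : ℕ → A := fun j => (Y (ω (j / n))).1 (j % n) with hf
  have hf1 : ∀ i j, j < n → f (i * n + j) = (Y (ω i)).1 j := by
    intro i j hj
    simp only [hf]
    rw [(hdm i j hj).1, (hdm i j hj).2]
  have hf2 : ∀ i, ∀ j < n + P, f (i * n + j) = (Y (ω i)).1 j := by
    intro i j hj
    rcases lt_or_ge j n with h | h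
    · exact hf1 i j h
    · obtain ⟨t, rfl⟩ := Nat.exists_eq_add_of_le h
      rw [show i * n + (n + t) = (i + 1) * n + t by ring, hf1 _ t (by omega)]
      exact (hY _ _ t (by omega)).symm
  refine ⟨⟨f, fun j => ?_⟩, hf2⟩
  have hj : j = (j / n) * n + j % n := by rw [Nat.mul_comm, Nat.div_add_mod]
  have hlt := Nat.mod_lt j hn
  have h1 : f j = (Y (ω (j / n))).1 (j % n) := rfl
  have h2 : f (j + 1) = (Y (ω (j / n))).1 (j % n + 1) := by
    rw [← hf2 (j / n) (j % n + 1) (by omega)]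
    congr 1
    omega
  rw [h1, h2]
  exact (Y (ω (j / n))).2 _

variable {M : Type*} [NormedAddCommGroup M] [InnerProductSpace ℝ M] [FiniteDimensional ℝ M]
  {A : Type*} {Tr : A → A → Prop}

theorem half_exp_le_norm_pullCoc_concat {Bmap : SFT Tr → (M →L[ℝ] M)} {ι : Type*} {n P k : ℕ}
    {Y : ι → SFT Tr} {p ς : ℝ} (hς0 : 0 ≤ ς) (hς1 : 2 * ς ≤ 1) {a b : ι → M [⋀^Fin k]→L[ℝ] ℝ}
    (ha : ∀ u, ‖a u‖ = 1) (hab : ∀ u u', ‖a u' - b u‖ ≤ ς)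
    (hstep : ∀ u, ∀ z : SFT Tr, (∀ j < n + P, z.1 j = (Y u).1 j) → ∀ v, ‖v‖ ≤ 2 * ς →
      ∃ (c : ℝ) (v' : M [⋀^Fin k]→L[ℝ] ℝ), Real.exp (n * p) ≤ c ∧
        pullCoc Bmap k n z (b u + v) = c • (a u + v') ∧ ‖v'‖ ≤ ς)
    {ω : ℕ → ι} {z : SFT Tr} (hz : ∀ i, ∀ j < n + P, z.1 (i * n + j) = (Y (ω i)).1 j) (m : ℕ) :
    1 / 2 * Real.exp ((m * n : ℕ) * p) ≤ ‖pullCoc Bmap k (m * n) z‖ := by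
  have hG : ∀ i < m, pullCoc Bmap k ((m - i) * n) ((shiftSFT Tr)^[i * n] z) =
      (pullCoc Bmap k n ((shiftSFT Tr)^[i * n] z)).comp
        (pullCoc Bmap k ((m - (i + 1)) * n) ((shiftSFT Tr)^[(i + 1) * n] z)) := by
    intro i hi
    have e1 : (m - i) * n = n + (m - (i + 1)) * n := by
      have : m - i = (m - (i + 1)) + 1 := by omega
      rw [this]; ring
    have e2 : (shiftSFT Tr)^[(i + 1) * n] z = (shiftSFT Tr)^[n] ((shiftSFT Tr)^[i * n] z) := by
      rw [← Function.iterate_add_apply]; congr 1; ring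
    rw [e1, e2]
    exact pullCoc_add ..
  obtain ⟨c, v', h1, h2, h3⟩ := exists_cone_iterate (N := m)
    (g := fun i => pullCoc Bmap k n ((shiftSFT Tr)^[i * n] z))
    (H := fun i => pullCoc Bmap k ((m - i) * n) ((shiftSFT Tr)^[i * n] z))
    (w := fun i => a (ω i)) (m := fun _ => Real.exp (n * p)) (S := fun _ => ς)
    (fun _ _ => (Real.exp_pos _).le)
    (by simp only [Nat.sub_self, Nat.zero_mul]; exact pullCoc_zero ..) hG
    (by
      intro i hi x hx
      obtain ⟨c, v', h1, h2, h3⟩ := hstep (ω i) ((shiftSFT Tr)^[i * n] z)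
        (fun j hj => by rw [shift_iterate_apply]; exact hz i j hj)
        (a (ω (i + 1)) - b (ω i) + x)
        ((norm_add_le _ _).trans (by linarith [hab (ω i) (ω (i + 1))]))
      refine ⟨c, v', h1, ?_, h3⟩
      rw [← h2]
      congr 1
      abel)
    (x := 0) (by rw [norm_zero]; exact hς0) (Nat.zero_le m)
  simp only [Nat.sub_zero, Nat.zero_mul, Function.iterate_zero, id_eq, add_zero,
    Finset.prod_const, Nat.card_Ico] at h1 h2
  rw [← Real.exp_nat_mul] at h1
  have hle := (pullCoc Bmap k (m * n) z).le_opNorm (a (ω m))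
  have hc : 0 ≤ c := (Real.exp_pos _).le.trans h1
  rw [ha, mul_one, h2, norm_smul, Real.norm_of_nonneg hc] at hle
  have h4 : 1 / 2 ≤ ‖a (ω 0) + v'‖ := by
    have := norm_sub_norm_le (a (ω 0)) (-v')
    rw [sub_neg_eq_add, norm_neg, ha] at this
    linarith
  refine le_trans ?_ hle
  rw [mul_comm]
  refine mul_le_mul (le_trans (le_of_eq ?_) h1) h4 (by norm_num) hc
  congr 1
  push_cast
  ring

theorem le_famPressure_of_concat [Fintype A] [Nonempty (SFT Tr)] {Bmap : SFT Tr → (M →L[ℝ] M)}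
    (hBu : ∀ x, IsUnit (Bmap x)) {C' : ℝ} (hF : SubaddFamily (normFam M Bmap) C')
    {ι : Type*} [Fintype ι] [Nonempty ι] {n P : ℕ} (hP : 1 ≤ P) (hPn : P ≤ n) {Y : ι → SFT Tr}
    (hY : ∀ u u', ∀ j < P, (Y u).1 (n + j) = (Y u').1 j)
    (hinj : ∀ u u', (∀ j < n, (Y u).1 j = (Y u').1 j) → u = u')
    {q Λ : Fin (finrank ℝ M + 1) → ℝ} (hq : ∀ k, 0 ≤ q k) (hq1 : ∑ k, q k = 1) {c₁ ς : ℝ}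
    (hς0 : 0 ≤ ς) (hς1 : 2 * ς ≤ 1)
    (hgood : ∀ k : Fin (finrank ℝ M + 1),
      (∃ a b : ι → M [⋀^Fin k]→L[ℝ] ℝ, (∀ u, ‖a u‖ = 1) ∧ (∀ u u', ‖a u' - b u‖ ≤ ς) ∧
        ∀ u, ∀ z : SFT Tr, (∀ j < n + P, z.1 j = (Y u).1 j) → ∀ v, ‖v‖ ≤ 2 * ς →
          ∃ (c : ℝ) (v' : M [⋀^Fin k]→L[ℝ] ℝ), Real.exp (n * (Λ k - c₁)) ≤ c ∧
            pullCoc Bmap k n z (b u + v) = c • (a u + v') ∧ ‖v'‖ ≤ ς) ∨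
      ∃ (j : ℕ) (hj : j + 2 < finrank ℝ M + 1), k = ⟨j + 1, by omega⟩ ∧
        2 * Λ ⟨j + 1, by omega⟩ ≤ Λ ⟨j, by omega⟩ + Λ ⟨j + 2, hj⟩) :
    Real.log (Fintype.card ι) / n + ∑ k, q k * Λ k - c₁ ≤ famPressure (normFam M Bmap) q := by
  classical
  obtain ⟨C₀, hC₀, h₀⟩ := exists_log_norm_extPull_bound M
  have hn : 1 ≤ n := hP.trans hPn
  have hn' : (0 : ℝ) < n := by exact_mod_cast hn
  have hz : ∀ (ω : ℕ → ι) (z : SFT Tr), (∀ i, ∀ j < n + P, z.1 (i * n + j) = (Y (ω i)).1 j) →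
      ∀ m : ℕ, Real.exp (-(2 * C₀ + Real.log 2)) *
        Real.exp ((m * n : ℕ) * (∑ k, q k * Λ k - c₁)) ≤ expPot (normFam M Bmap) q (m * n) z := by
    intro ω z hz m
    have hL := isUnit_cocycle hBu (m * n) z
    set L := cocycle Tr Bmap (m * n) z with hLdef
    have hu := nonneg_of_midpoint_le (u := fun k : Fin (finrank ℝ M + 1) =>
      Real.log (singProd L k) - (m * n : ℕ) * (Λ k - c₁) + C₀ + Real.log 2) (by
        intro k
        rcases hgood k with ⟨a, b, ha, hab, hstep⟩ | ⟨j, hj, hkj, hΛ⟩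
        · left
          have h1 := half_exp_le_norm_pullCoc_concat hς0 hς1 ha hab hstep hz m
          have h2 := Real.log_le_log (by positivity) h1
          rw [Real.log_mul (by norm_num) (Real.exp_pos _).ne', Real.log_exp, one_div,
            Real.log_inv] at h2
          have h3 := (abs_le.1 (h₀ L hL k (Nat.lt_succ_iff.1 k.2)).2).2
          have h4 : Real.log ‖pullCoc Bmap k (m * n) z‖ = Real.log ‖extPull (k : ℕ) L‖ := rfl
          linarith
        · right
          refine ⟨j, hj, hkj, ?_⟩
          have h1 := log_singProd_concave hL (show j + 1 < finrank ℝ M by omega)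
          have h2 := mul_le_mul_of_nonneg_left hΛ (Nat.cast_nonneg (α := ℝ) (m * n))
          simp only
          linarith)
    rw [expPot, ← Real.exp_add, Real.exp_le_exp]
    have h5 : ∀ k, q k * ((m * n : ℕ) * (Λ k - c₁) - (2 * C₀ + Real.log 2)) ≤
        q k * normFam M Bmap k (m * n) z := by
      intro k
      refine mul_le_mul_of_nonneg_left ?_ (hq k)
      have h1 := hu k
      have h3 := (abs_le.1 (h₀ L hL k (Nat.lt_succ_iff.1 k.2)).2).1
      have h4 : normFam M Bmap k (m * n) z = Real.log ‖extPull (k : ℕ) L‖ := rfl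
      linarith
    refine le_trans (le_of_eq ?_) (Finset.sum_le_sum fun k _ => h5 k)
    have h6 : ∀ k, q k * ((m * n : ℕ) * (Λ k - c₁) - (2 * C₀ + Real.log 2)) =
        (m * n : ℕ) * (q k * Λ k) - ((m * n : ℕ) * c₁ + (2 * C₀ + Real.log 2)) * q k := by
      intro k; ring
    simp only [h6]
    rw [Finset.sum_sub_distrib, ← Finset.mul_sum, ← Finset.mul_sum, hq1]
    ring
  refine le_growthRate (hF.partSum_pos q) (hF.abs_log_partSum_le q) hn
    (Real.exp_pos (-(2 * C₀ + Real.log 2))) fun m hm => ?_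
  obtain ⟨u₀⟩ := ‹Nonempty ι›
  have hext : ∀ ω : Fin m → ι, ∃ z : SFT Tr, ∀ i, ∀ j < n + P,
      z.1 (i * n + j) = (Y (if h : i < m then ω ⟨i, h⟩ else u₀)).1 j := fun ω =>
    exists_concat hP hPn Y hY fun i => if h : i < m then ω ⟨i, h⟩ else u₀
  choose Z hZ using hext
  have hcount := card_mul_le_wsum (Tr := Tr) (ψ := expPot (normFam M Bmap) q (m * n))
    (fun x => (expPot_pos _ _ _ x).le) (hF.bddAbove_expPot q _) (n := m * n)
    (fun (ω : Fin m → ι) (i : Fin (m * n)) => (Z ω).1 i)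
    (by
      intro ω ω' h
      funext i
      refine hinj _ _ fun j hj => ?_
      have hlt : i * n + j < m * n := by
        have := i.2
        nlinarith
      have h1 := congrFun h ⟨i * n + j, hlt⟩
      simp only at h1
      rw [hZ ω i j (by omega), hZ ω' i j (by omega), dif_pos i.2, dif_pos i.2] at h1
      exact h1)
    (c := Real.exp (-(2 * C₀ + Real.log 2)) *
      Real.exp ((m * n : ℕ) * (∑ k, q k * Λ k - c₁)))
    (fun ω => ⟨Z ω, fun i => rfl, hz _ _ (hZ ω) m⟩)
  refine le_trans (le_of_eq ?_) hcount
  have hcard : (0 : ℝ) < Fintype.card ι := by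
    have : 0 < Fintype.card ι := Fintype.card_pos_iff.2 ⟨u₀⟩
    exact_mod_cast this
  have h7 : ((Fintype.card (Fin m → ι) : ℕ) : ℝ) = Real.exp (m * Real.log (Fintype.card ι)) := by
    rw [Fintype.card_fun, Fintype.card_fin, Real.exp_nat_mul, Real.exp_log hcard]
    push_cast
    rfl
  rw [h7, ← Real.exp_add, ← Real.exp_add, ← Real.exp_add]
  congr 1
  push_cast
  field_simp
  ring

end Concatenation

section Splitting

variable {A ι : Type*} [Fintype A] [Fintype ι] {Tr : A → A → Prop}
  {F : ι → ℕ → SFT Tr → ℝ} {C : ℝ}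

theorem SubaddFamily.abs_le_of_deviation_bound [Nonempty (SFT Tr)] (hF : SubaddFamily F C)
    {q : ι → ℝ} (hq : ∀ k, 0 ≤ q k) {Λ : ι → ℝ}
    (hdev : ∀ η : ℝ, 0 < η → ∃ c : ℝ, 0 < c ∧ ∃ C' : ℝ, 1 ≤ C' ∧ ∀ n : ℕ,
      wsum n ((devSet F Λ η n).indicator (expPot F q n)) ≤
        C' * Real.exp (n * (famPressure F q - c))) (k : ι) : |Λ k| ≤ C := by
  refine le_of_forall_pos_le_add fun η hη => ?_
  obtain ⟨c, hc, C', hC', h⟩ := hdev η hη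
  obtain ⟨m, hm⟩ := exists_nat_gt (Real.log C' / c)
  set n := m + 1 with hn
  have hn' : (0 : ℝ) < n := by positivity
  have hmn : (m : ℝ) ≤ n := by exact_mod_cast Nat.le_succ m
  have hex : ∃ x : SFT Tr, x ∉ devSet F Λ η n := by
    by_contra! hall
    have h1 := (hF.exp_famPressure_le hq (show 1 ≤ n by omega)).trans
      ((wsum_mono (fun x => indicator_expPot_nonneg q n _ x) (hF.bddAbove_indicator q n _)
        (fun x => (indicator_of_mem (hall x) _).ge) n).trans (h n))
    have h2 := Real.log_le_log (Real.exp_pos _) h1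
    rw [Real.log_mul (by positivity) (Real.exp_pos _).ne', Real.log_exp, Real.log_exp] at h2
    rw [div_lt_iff₀ hc] at hm
    nlinarith
  obtain ⟨x, hx⟩ := hex
  simp only [devSet, mem_ofPred_eq] at hx
  push Not at hx
  have h1 := abs_le.1 (hx k)
  have h2 := abs_le.1 (hF.bound k n x)
  rw [abs_le]
  constructor
  · refine le_of_mul_le_mul_left ?_ hn'
    linarith
  · refine le_of_mul_le_mul_left ?_ hn'
    linarith

theorem SubaddFamily.exists_le_wsum_of_split [Nonempty (SFT Tr)] (hF : SubaddFamily F C)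
    {q : ι → ℝ} (hq : ∀ k, 0 ≤ q k) {κ : Type*} [Fintype κ] {S : Set (SFT Tr)}
    {E : ℕ → κ → Set (SFT Tr)} {p : ℕ → Prop} {n ℓ : ℕ} {C₁ c : ℝ} (hC₁ : 1 ≤ C₁) (hc : 0 ≤ c)
    (hu : ∀ j : ℕ, partSum F q j ≤ C₁ * Real.exp (j * (famPressure F q + c)))
    (hS : ∀ y ∈ S, ∃ i N k, i + N ≤ n ∧ p N ∧ (shiftSFT Tr)^[i * ℓ] y ∈ E N k)
    (hw : 1 / 2 * Real.exp ((n * ℓ : ℕ) * famPressure F q) ≤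
      wsum (n * ℓ) (S.indicator (expPot F q (n * ℓ)))) :
    ∃ N k, N ≤ n ∧ p N ∧ Real.exp ((N * ℓ : ℕ) * famPressure F q) ≤
      2 * ((n + 1) ^ 2 * Fintype.card κ * C₁ ^ 2) * Real.exp ((n * ℓ : ℕ) * c) *
        wsum (N * ℓ) ((E N k).indicator (expPot F q (N * ℓ))) := by
  classical
  set P := famPressure F q
  let I : Finset (ℕ × ℕ × κ) := (Finset.range (n + 1) ×ˢ Finset.range (n + 1) ×ˢ Finset.univ).filter
    fun t => t.1 + t.2.1 ≤ n ∧ p t.2.1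
  let f : ℕ × ℕ × κ → SFT Tr → ℝ := fun t =>
    {y | (shiftSFT Tr)^[t.1 * ℓ] y ∈ E t.2.1 t.2.2}.indicator (expPot F q (n * ℓ))
  have hf0 : ∀ t x, 0 ≤ f t x := fun t x => indicator_expPot_nonneg q (n * ℓ) _ x
  have hfb : ∀ t, BddAbove (range (f t)) := fun t => hF.bddAbove_indicator q (n * ℓ) _
  have hfS : ∀ x, S.indicator (expPot F q (n * ℓ)) x ≤ ∑ t ∈ I, f t x := by
    intro x
    by_cases hx : x ∈ S
    · obtain ⟨i, N, k, h1, h2, h3⟩ := hS x hx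
      have hmem : (i, N, k) ∈ I := by
        rw [Finset.mem_filter, Finset.mem_product, Finset.mem_product]
        exact ⟨⟨Finset.mem_range.2 (show i < n + 1 by omega),
          Finset.mem_range.2 (show N < n + 1 by omega), Finset.mem_univ _⟩, h1, h2⟩
      have h4 : f (i, N, k) x = expPot F q (n * ℓ) x :=
        indicator_of_mem (s := {y | (shiftSFT Tr)^[i * ℓ] y ∈ E N k}) h3 _
      rw [indicator_of_mem hx, ← h4]
      exact Finset.single_le_sum (f := fun t => f t x) (fun t _ => hf0 t x) hmem
    · rw [indicator_of_notMem hx]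
      exact Finset.sum_nonneg fun t _ => hf0 t x
  have hsum : wsum (n * ℓ) (S.indicator (expPot F q (n * ℓ))) ≤ ∑ t ∈ I, wsum (n * ℓ) (f t) :=
    wsum_sum_le I (fun t _ x => hf0 t x) (fun t _ => hfb t) hfS (n * ℓ)
  have hterm : ∀ t ∈ I, wsum (n * ℓ) (f t) ≤ C₁ ^ 2 * Real.exp (((n - t.2.1) * ℓ : ℕ) * (P + c)) *
      wsum (t.2.1 * ℓ) ((E t.2.1 t.2.2).indicator (expPot F q (t.2.1 * ℓ))) := by
    rintro ⟨i, N, k⟩ ht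
    have h1 : i + N ≤ n := (Finset.mem_filter.1 ht).2.1
    obtain ⟨r, rfl⟩ := Nat.exists_eq_add_of_le h1
    have e1 : (i + N + r) * ℓ = i * ℓ + (N * ℓ + r * ℓ) := by ring
    have e2 : i + N + r - N = i + r := by omega
    simp only [f, e1, e2]
    set g : SFT Tr → ℝ := (E N k).indicator (expPot F q (N * ℓ + r * ℓ))
    have hw0 := wsum_nonneg (indicator_expPot_nonneg (F := F) q (N * ℓ) (E N k)) (N * ℓ)
    have hf1 : wsum (i * ℓ + (N * ℓ + r * ℓ)) ({y | (shiftSFT Tr)^[i * ℓ] y ∈ E N k}.indicator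
        (expPot F q (i * ℓ + (N * ℓ + r * ℓ)))) ≤ partSum F q (i * ℓ) * wsum (N * ℓ + r * ℓ) g := by
      refine wsum_submul (fun x => (expPot_pos _ _ _ x).le)
        (fun x => indicator_expPot_nonneg _ _ _ x) (hF.bddAbove_expPot _ _)
        (hF.bddAbove_indicator _ _ _) _ _ fun x => ?_
      refine indicator_apply_le' (fun hx => ?_) (fun _ =>
        mul_nonneg (expPot_pos _ _ _ x).le (indicator_expPot_nonneg _ _ _ _))
      rw [indicator_of_mem (show (shiftSFT Tr)^[i * ℓ] x ∈ E N k from hx)]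
      exact hF.expPot_add_le hq _ _ x
    have hf2 : wsum (N * ℓ + r * ℓ) g ≤
        wsum (N * ℓ) ((E N k).indicator (expPot F q (N * ℓ))) * partSum F q (r * ℓ) := by
      refine wsum_submul (fun x => indicator_expPot_nonneg _ _ _ x)
        (fun x => (expPot_pos _ _ _ x).le) (hF.bddAbove_indicator _ _ _)
        (hF.bddAbove_expPot _ _) _ _ fun x => ?_
      refine indicator_apply_le' (fun hx => ?_) (fun _ =>
        mul_nonneg (indicator_expPot_nonneg _ _ _ _) (expPot_pos _ _ _ _).le)
      rw [indicator_of_mem hx]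
      exact hF.expPot_add_le hq _ _ x
    have h0 := (hF.partSum_pos q (i * ℓ)).le
    have h0' := (hF.partSum_pos q (r * ℓ)).le
    calc _ ≤ partSum F q (i * ℓ) * wsum (N * ℓ + r * ℓ) g := hf1
      _ ≤ partSum F q (i * ℓ) *
          (wsum (N * ℓ) ((E N k).indicator (expPot F q (N * ℓ))) * partSum F q (r * ℓ)) := by
        gcongr
      _ = (partSum F q (i * ℓ) * partSum F q (r * ℓ)) *
          wsum (N * ℓ) ((E N k).indicator (expPot F q (N * ℓ))) := by ring
      _ ≤ ((C₁ * Real.exp ((i * ℓ : ℕ) * (P + c))) * (C₁ * Real.exp ((r * ℓ : ℕ) * (P + c)))) *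
          wsum (N * ℓ) ((E N k).indicator (expPot F q (N * ℓ))) := by
        gcongr
        · exact hu _
        · exact hu _
      _ = _ := by
        rw [mul_mul_mul_comm, ← Real.exp_add, ← sq]
        congr 3
        push_cast
        ring
  have hlow := hw.trans hsum
  have hIne : I.Nonempty := by
    rw [Finset.nonempty_iff_ne_empty]
    intro h
    rw [h, Finset.sum_empty] at hlow
    have := Real.exp_pos ((n * ℓ : ℕ) * P)
    linarith
  obtain ⟨t₀, ht₀⟩ := hIne
  have hcard : (0 : ℝ) < Fintype.card κ := by
    have : 0 < Fintype.card κ := Fintype.card_pos_iff.2 ⟨t₀.2.2⟩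
    exact_mod_cast this
  have hIcard : (I.card : ℝ) ≤ (n + 1) ^ 2 * Fintype.card κ := by
    have : I.card ≤ (n + 1) ^ 2 * Fintype.card κ := by
      refine (Finset.card_filter_le _ _).trans (le_of_eq ?_)
      rw [Finset.card_product, Finset.card_product, Finset.card_range, Finset.card_univ]
      ring
    exact_mod_cast this
  set D : ℝ := (n + 1) ^ 2 * Fintype.card κ with hD
  have hDpos : 0 < D := by positivity
  have hconst : ∑ _t ∈ I, Real.exp ((n * ℓ : ℕ) * P) / (2 * D) ≤ ∑ t ∈ I, wsum (n * ℓ) (f t) := by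
    refine le_trans ?_ hlow
    rw [Finset.sum_const, nsmul_eq_mul]
    calc (I.card : ℝ) * (Real.exp ((n * ℓ : ℕ) * P) / (2 * D))
        ≤ D * (Real.exp ((n * ℓ : ℕ) * P) / (2 * D)) := by gcongr
      _ = _ := by field_simp
  obtain ⟨⟨i, N, k⟩, ht, hle⟩ := Finset.exists_le_of_sum_le ⟨t₀, ht₀⟩ hconst
  have h1 : i + N ≤ n := (Finset.mem_filter.1 ht).2.1
  refine ⟨N, k, by omega, (Finset.mem_filter.1 ht).2.2, ?_⟩
  have h2 := hle.trans (hterm _ ht)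
  simp only at h2
  set Wt := wsum (N * ℓ) ((E N k).indicator (expPot F q (N * ℓ)))
  have hw0 : 0 ≤ Wt := wsum_nonneg (indicator_expPot_nonneg (F := F) q (N * ℓ) (E N k)) (N * ℓ)
  have hcast : (((n - N) * ℓ : ℕ) : ℝ) = (n * ℓ : ℕ) - (N * ℓ : ℕ) := by
    push_cast [Nat.cast_sub (show N ≤ n by omega)]
    ring
  rw [div_le_iff₀ (by positivity)] at h2
  have h3 : Real.exp ((N * ℓ : ℕ) * P) =
      Real.exp ((n * ℓ : ℕ) * P) * Real.exp (-(((n * ℓ : ℕ) - (N * ℓ : ℕ)) * P)) := by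
    rw [← Real.exp_add]; congr 1; ring
  rw [h3]
  calc Real.exp ((n * ℓ : ℕ) * P) * Real.exp (-(((n * ℓ : ℕ) - (N * ℓ : ℕ)) * P))
      ≤ (C₁ ^ 2 * Real.exp (((n - N) * ℓ : ℕ) * (P + c)) * Wt * (2 * D)) *
          Real.exp (-(((n * ℓ : ℕ) - (N * ℓ : ℕ)) * P)) := by gcongr
    _ = 2 * (D * C₁ ^ 2) * (Real.exp (((n - N) * ℓ : ℕ) * (P + c)) *
          Real.exp (-(((n * ℓ : ℕ) - (N * ℓ : ℕ)) * P))) * Wt := by ring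
    _ ≤ 2 * (D * C₁ ^ 2) * Real.exp ((n * ℓ : ℕ) * c) * Wt := by
        gcongr
        rw [← Real.exp_add, Real.exp_le_exp, hcast]
        have : (0 : ℝ) ≤ (N * ℓ : ℕ) * c := by positivity
        linarith

end Splitting

section CorePotential

open Module

variable {M : Type*} [NormedAddCommGroup M] [InnerProductSpace ℝ M] [FiniteDimensional ℝ M]
  {A : Type*} {Tr : A → A → Prop}

theorem IsCore.normFam_le {Amap : SFT Tr → (M →L[ℝ] M)} {Λ : Fin (finrank ℝ M + 1) → ℝ}
    {η C ρ : ℝ} {ℓ N : ℕ} {x : SFT Tr} {w : ∀ k : Fin (finrank ℝ M + 1), ℕ → M [⋀^Fin k]→L[ℝ] ℝ}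
    {μ : Fin (finrank ℝ M + 1) → ℕ → ℝ} {Bd : Finset ℕ}
    (hc : IsCore Amap Λ η C ρ ℓ N x w μ Bd) (hF : SubaddFamily (normFam M Amap) C)
    (hη : 0 ≤ η) (hΛ : ∀ k, |Λ k| ≤ C) (hN : 1 ≤ N) (k : Fin (finrank ℝ M + 1)) :
    normFam M Amap k (N * ℓ) x ≤ (N * ℓ : ℕ) * (Λ k + η + 2 * C * ρ) := by
  have hC := hF.nonneg
  have h1 : ∀ a ∈ Finset.range N, normFam M Amap k ℓ ((shiftSFT Tr)^[a * ℓ] x) ≤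
      ℓ * (Λ k + η) + if a ∈ Bd then ℓ * (2 * C) else 0 := by
    intro a ha
    split_ifs with hb
    · have h2 := (abs_le.1 (hF.bound k ℓ ((shiftSFT Tr)^[a * ℓ] x))).2
      have h3 := mul_le_mul_of_nonneg_left (abs_le.1 (hΛ k)).1 (Nat.cast_nonneg (α := ℝ) ℓ)
      have h4 : 0 ≤ ℓ * η := by positivity
      linarith
    · have h2 := hc.typical a (Finset.mem_range.1 ha) hb
      simp only [devSet, mem_ofPred_eq] at h2
      push Not at h2
      linarith [(abs_le.1 (h2 k)).2]
  refine (hF.mul_le_sum k N ℓ x).trans ((Finset.sum_le_sum h1).trans ?_)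
  rw [Finset.sum_add_distrib, Finset.sum_const, Finset.card_range, nsmul_eq_mul,
    ← Finset.sum_filter, Finset.sum_const, nsmul_eq_mul]
  have h5 : (((Finset.range N).filter (· ∈ Bd)).card : ℝ) ≤ ρ * N := by
    have := hc.card_le 0 hN
    rw [Nat.cast_zero, sub_zero] at this
    convert this using 3
    ext a
    simp
  have h6 := mul_le_mul_of_nonneg_right h5 (show (0 : ℝ) ≤ ℓ * (2 * C) by positivity)
  push_cast
  linarith

theorem IsCore.expPot_le {Amap : SFT Tr → (M →L[ℝ] M)} {Λ : Fin (finrank ℝ M + 1) → ℝ}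
    {η C ρ : ℝ} {ℓ N : ℕ} {x : SFT Tr} {w : ∀ k : Fin (finrank ℝ M + 1), ℕ → M [⋀^Fin k]→L[ℝ] ℝ}
    {μ : Fin (finrank ℝ M + 1) → ℕ → ℝ} {Bd : Finset ℕ}
    (hc : IsCore Amap Λ η C ρ ℓ N x w μ Bd) (hF : SubaddFamily (normFam M Amap) C)
    (hη : 0 ≤ η) (hΛ : ∀ k, |Λ k| ≤ C) (hN : 1 ≤ N) {q : Fin (finrank ℝ M + 1) → ℝ}
    (hq : ∀ k, 0 ≤ q k) :
    expPot (normFam M Amap) q (N * ℓ) x ≤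
      Real.exp ((N * ℓ : ℕ) * (∑ k, q k * Λ k + (η + 2 * C * ρ) * ∑ k, q k)) := by
  rw [expPot, Real.exp_le_exp, mul_add, Finset.mul_sum, Finset.mul_sum, Finset.mul_sum,
    ← Finset.sum_add_distrib]
  refine Finset.sum_le_sum fun k _ => ?_
  have := mul_le_mul_of_nonneg_left (hc.normFam_le hF hη hΛ hN k) (hq k)
  linarith

end CorePotential

section CoreWords

open Module

variable {M : Type*} [NormedAddCommGroup M] [InnerProductSpace ℝ M] [FiniteDimensional ℝ M]
  {A : Type*} {Tr : A → A → Prop}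

/-- The initial points of cores of length `N` both of whose ends have class `t`. -/
def coreSet {κ : Type*} (Amap : SFT Tr → (M →L[ℝ] M)) (Λ : Fin (finrank ℝ M + 1) → ℝ)
    (η C ρ : ℝ) (ℓ : ℕ) (cls : SFT Tr → (∀ k : Fin (finrank ℝ M + 1), M [⋀^Fin k]→L[ℝ] ℝ) → κ)
    (N : ℕ) (t : κ) : Set (SFT Tr) :=
  {x | ∃ w μ Bd, IsCore Amap Λ η C ρ ℓ N x w μ Bd ∧ cls x (fun k => w k 0) = t ∧
    cls ((shiftSFT Tr)^[N * ℓ] x) (fun k => w k N) = t}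

theorem exists_sq_le_exp {a b : ℝ} (hb : 0 < b) :
    ∃ n₀ : ℕ, ∀ n ≥ n₀, a * ((n : ℝ) + 1) ^ 2 ≤ Real.exp (b * n) := by
  have h1 : Real.exp (-b) < 1 := by
    rw [← Real.exp_zero]
    exact Real.exp_lt_exp.2 (by linarith)
  have h2 := (tendsto_pow_const_mul_const_pow_of_abs_lt_one 2
    (show |Real.exp (-b)| < 1 by rwa [abs_of_pos (Real.exp_pos _)])).const_mul (4 * |a|)
  rw [mul_zero] at h2
  obtain ⟨n₀, hn₀⟩ := ((h2.eventually_lt_const zero_lt_one).and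
    (eventually_ge_atTop 1)).exists_forall_of_atTop
  refine ⟨n₀, fun n hn => ?_⟩
  obtain ⟨h3, h4⟩ := hn₀ n hn
  have h5 : (1 : ℝ) ≤ n := by exact_mod_cast h4
  have h6 : Real.exp (-b) ^ n * Real.exp (b * n) = 1 := by
    rw [← Real.exp_nat_mul, ← Real.exp_add]
    simp [mul_comm]
  have h7 : a * ((n : ℝ) + 1) ^ 2 ≤ 4 * |a| * (n : ℝ) ^ 2 := by
    have : ((n : ℝ) + 1) ^ 2 ≤ 4 * (n : ℝ) ^ 2 := by nlinarith
    calc a * ((n : ℝ) + 1) ^ 2 ≤ |a| * ((n : ℝ) + 1) ^ 2 := by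
          gcongr
          exact le_abs_self a
      _ ≤ |a| * (4 * (n : ℝ) ^ 2) := by gcongr
      _ = _ := by ring
  have h8 := mul_le_mul_of_nonneg_right h3.le (Real.exp_pos (b * n)).le
  have h9 : 4 * |a| * (↑n ^ 2 * Real.exp (-b) ^ n) * Real.exp (b * n) = 4 * |a| * (n : ℝ) ^ 2 := by
    linear_combination (4 * |a| * (n : ℝ) ^ 2) * h6
  linarith

theorem exists_core_words [Fintype A] [Nonempty (SFT Tr)] {Amap : SFT Tr → (M →L[ℝ] M)} {R : ℝ}
    (hR : 1 ≤ R) (hA : ∀ x, IsUnit (Amap x))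
    (hb : ∀ x, ‖Amap x‖ ≤ R ∧ ‖Ring.inverse (Amap x)‖ ≤ R)
    {C : ℝ} (hC : C = Real.log (R ^ finrank ℝ M)) {Λ : Fin (finrank ℝ M + 1) → ℝ}
    (hΛ : ∀ k, |Λ k| ≤ C) {η η₀ ζ ρ : ℝ} (hη₀ : 0 < η₀) (hη : η₀ ≤ η) (hρ : 0 < ρ) {ℓ : ℕ}
    (hℓ : 1 ≤ ℓ)
    (hpar : ζ + (finrank ℝ M + 1) * ((2 * η₀ + 2 * C * ζ) / (2 * η)) < ρ / 2)
    {q : Fin (finrank ℝ M + 1) → ℝ} (hq : ∀ k, 0 ≤ q k)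
    (hgood : ∃ n₀ : ℕ, ∀ n ≥ n₀,
      1 / 2 * Real.exp ((n * ℓ : ℕ) * famPressure (normFam M Amap) q) ≤
        wsum (n * ℓ) ((goodSet (normFam M Amap) Λ η₀ ζ ℓ n).indicator
          (expPot (normFam M Amap) q (n * ℓ))))
    {κ : Type*} [Fintype κ]
    (cls : SFT Tr → (∀ k : Fin (finrank ℝ M + 1), M [⋀^Fin k]→L[ℝ] ℝ) → κ)
    {e : ℝ} (he : 0 < e) (N₀ : ℕ) :
    ∃ N, N₀ ≤ N ∧ ∃ t, ∃ W : Finset (Fin (N * ℓ) → A), W.Nonempty ∧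
      famPressure (normFam M Amap) q - (∑ k, q k * Λ k + (η + 2 * C * ρ) * ∑ k, q k) - e ≤
        Real.log W.card / (N * ℓ : ℕ) ∧
      ∀ u ∈ W, ∃ x ∈ coreSet Amap Λ η C ρ ℓ cls N t, ∀ i : Fin (N * ℓ), x.1 i = u i := by
  classical
  have hF : SubaddFamily (normFam M Amap) C := hC ▸ subaddFamily_normFam hR hA hb
  have hη' : 0 < η := hη₀.trans_le hη
  obtain ⟨n₀, hn₀⟩ := hgood
  set P := famPressure (normFam M Amap) q
  set K := Fintype.card κ + 1 with hK
  have hK' : (0 : ℝ) < K := by positivity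
  set c := e / (8 * K) with hc
  have hcpos : 0 < c := by positivity
  obtain ⟨C₁, hC₁, hu⟩ := hF.partSum_le_exp q hcpos
  obtain ⟨n₁, hn₁⟩ := exists_sq_le_exp (a := 2 * (Fintype.card κ * C₁ ^ 2)) hcpos
  set g := ρ / 2 - (ζ + (finrank ℝ M + 1) * ((2 * η₀ + 2 * C * ζ) / (2 * η))) with hg
  have hgpos : 0 < g := by linarith
  obtain ⟨n₂, hn₂⟩ := exists_nat_gt (((finrank ℝ M + 1) / (2 * η)) / g)
  set n := n₀ + n₁ + n₂ + 4 * K * (N₀ + 1) with hn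
  have hpar' : ζ * n + (finrank ℝ M + 1) * ((n * (2 * η₀ + 2 * C * ζ) + 1) / (2 * η)) ≤
      ρ * n / 2 := by
    rw [div_lt_iff₀ hgpos] at hn₂
    have h1 : (n₂ : ℝ) ≤ n := by exact_mod_cast (by omega : n₂ ≤ n)
    have h2 : (finrank ℝ M + 1) / (2 * η) ≤ n * g :=
      hn₂.le.trans (mul_le_mul_of_nonneg_right h1 hgpos.le)
    have h3 : ζ * n + (finrank ℝ M + 1) * ((n * (2 * η₀ + 2 * C * ζ) + 1) / (2 * η)) =
        ρ * n / 2 - n * g + (finrank ℝ M + 1) / (2 * η) := by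
      rw [hg]; field_simp; ring
    linarith
  have hn4 : 4 * K ≤ n := by
    have : 4 * K * (N₀ + 1) = 4 * K * N₀ + 4 * K := by ring
    have h0 := Nat.zero_le (4 * K * N₀)
    omega
  obtain ⟨N, t, hNn, hpN, hle⟩ := hF.exists_le_wsum_of_split hq (κ := κ)
    (S := goodSet (normFam M Amap) Λ η₀ ζ ℓ n) (E := coreSet Amap Λ η C ρ ℓ cls)
    (p := fun N => (n : ℝ) ≤ 4 * K * N) (n := n) (ℓ := ℓ) hC₁ hcpos.le hu
    (by
      intro y hy
      obtain ⟨i, N, w, μ, Bd, h1, h2, h3, h4⟩ := exists_isCore_of_mem_goodSet hR hA hb hC hΛ hη₀ hη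
        hρ hℓ hpar' (K := K) (by omega) (by omega) hn4 cls hy
      exact ⟨i, N, _, h1, h2, w, μ, Bd, h3, rfl, h4.symm⟩)
    (hn₀ n (by omega))
  have hN0 : N₀ + 1 ≤ N := by
    have h1 : n ≤ 4 * K * N := by exact_mod_cast hpN
    have h2 : 4 * K * (N₀ + 1) ≤ 4 * K * N := by omega
    exact Nat.le_of_mul_le_mul_left h2 (by omega)
  have hℓ' : (1 : ℝ) ≤ ℓ := by exact_mod_cast hℓ
  have hnc : (n : ℝ) * c ≤ N * (e / 2) := by
    calc (n : ℝ) * c ≤ 4 * K * N * c := by gcongr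
      _ = N * (e / 2) := by rw [hc]; field_simp; ring
  have hnlc : ((n * ℓ : ℕ) : ℝ) * c ≤ (N * ℓ : ℕ) * (e / 2) := by
    have := mul_le_mul_of_nonneg_right hnc (show (0 : ℝ) ≤ ℓ by positivity)
    push_cast
    linarith
  have hpoly : 2 * (((n : ℝ) + 1) ^ 2 * Fintype.card κ * C₁ ^ 2) ≤
      Real.exp ((N * ℓ : ℕ) * (e / 2)) := by
    refine le_trans (le_of_eq (by ring)) ((hn₁ n (by omega)).trans (Real.exp_le_exp.2 ?_))
    have : (N : ℝ) * (e / 2) ≤ (N * ℓ : ℕ) * (e / 2) := by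
      push_cast
      have : (0 : ℝ) ≤ N * (e / 2) := by positivity
      nlinarith
    linarith
  set E := coreSet Amap Λ η C ρ ℓ cls N t
  set Wt := wsum (N * ℓ) (E.indicator (expPot (normFam M Amap) q (N * ℓ)))
  have hWt : 0 ≤ Wt := wsum_nonneg (indicator_expPot_nonneg _ _ _) _
  have hle' : Real.exp ((N * ℓ : ℕ) * P) ≤ Real.exp ((N * ℓ : ℕ) * e) * Wt := by
    refine hle.trans (mul_le_mul_of_nonneg_right ?_ hWt)
    calc _ ≤ Real.exp ((N * ℓ : ℕ) * (e / 2)) * Real.exp ((N * ℓ : ℕ) * (e / 2)) := by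
          gcongr
      _ = _ := by rw [← Real.exp_add]; congr 1; ring
  let W : Finset (Fin (N * ℓ) → A) := Finset.univ.filter fun u =>
      ∃ x ∈ E, ∀ i : Fin (N * ℓ), x.1 i = u i
  set D := ∑ k, q k * Λ k + (η + 2 * C * ρ) * ∑ k, q k
  have hup : Wt ≤ W.card * Real.exp ((N * ℓ : ℕ) * D) := by
    refine wsum_le_card_mul E (Real.exp_pos _).le (fun x hx => indicator_of_notMem hx _)
      (fun x hx => ?_) _ W fun x hx => ?_
    · rw [indicator_of_mem hx]
      obtain ⟨w, μ, Bd, h1, -⟩ := hx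
      exact h1.expPot_le hF hη'.le hΛ (by omega) hq
    · exact Finset.mem_filter.2 ⟨Finset.mem_univ _, x, hx, fun i => rfl⟩
  have hfin := hle'.trans (mul_le_mul_of_nonneg_left hup (Real.exp_pos _).le)
  have hWne : W.Nonempty := by
    rw [Finset.nonempty_iff_ne_empty]
    intro h
    rw [h, Finset.card_empty, Nat.cast_zero, zero_mul, mul_zero] at hfin
    exact absurd hfin (not_le.2 (Real.exp_pos _))
  have hWpos : (0 : ℝ) < W.card := by exact_mod_cast hWne.card_pos
  refine ⟨N, by omega, t, W, hWne, ?_, fun u hu => (Finset.mem_filter.1 hu).2⟩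
  have hlog := Real.log_le_log (Real.exp_pos _) hfin
  rw [Real.log_mul (Real.exp_pos _).ne' (mul_pos hWpos (Real.exp_pos _)).ne',
    Real.log_mul hWpos.ne' (Real.exp_pos _).ne', Real.log_exp, Real.log_exp, Real.log_exp] at hlog
  have hNl : (0 : ℝ) < (N * ℓ : ℕ) := by
    have : 0 < N * ℓ := Nat.mul_pos (by omega) hℓ
    exact_mod_cast this
  rw [le_div_iff₀ hNl]
  linarith

theorem exists_sphere_class (V : Type*) [NormedAddCommGroup V] [NormedSpace ℝ V]
    [FiniteDimensional ℝ V] {ς : ℝ} (hς : 0 < ς) :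
    ∃ (m : ℕ) (cl : V → Fin m), ∀ v v', ‖v‖ = 1 → ‖v'‖ = 1 → cl v = cl v' → ‖v - v'‖ ≤ ς := by
  classical
  have : ProperSpace V := FiniteDimensional.proper ℝ V
  obtain ⟨t, ht, hcov⟩ := Metric.totallyBounded_iff.1
    (isCompact_sphere (0 : V) 1).totallyBounded (ς / 2) (half_pos hς)
  have hex : ∀ v : V, ∃ c : Option t, ‖v‖ = 1 → ∃ y : t, c = some y ∧ dist v y < ς / 2 := by
    intro v
    by_cases hv : ‖v‖ = 1
    · obtain ⟨y, hy, hvy⟩ := mem_iUnion₂.1 (hcov (mem_sphere_zero_iff_norm.2 hv))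
      exact ⟨some ⟨y, hy⟩, fun _ => ⟨⟨y, hy⟩, rfl, hvy⟩⟩
    · exact ⟨none, fun h => absurd h hv⟩
  choose c hc using hex
  have := ht.fintype
  refine ⟨Fintype.card (Option t), fun v => Fintype.equivFin _ (c v), fun v v' hv hv' h => ?_⟩
  obtain ⟨y, hy, hvy⟩ := hc v hv
  obtain ⟨y', hy', hvy'⟩ := hc v' hv'
  have h1 := (Fintype.equivFin (Option t)).injective h
  rw [hy, hy', Option.some_inj] at h1
  subst h1
  rw [← dist_eq_norm]
  linarith [dist_triangle_right v v' (y : V)]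

theorem exists_gap (f : ℕ → ℝ) (n : ℕ) : ∃ κ : ℝ, 0 < κ ∧ ∀ j < n, f j ≤ 0 ∨ κ ≤ f j := by
  induction n with
  | zero => exact ⟨1, one_pos, by simp⟩
  | succ n ih =>
    obtain ⟨κ, hκ, h⟩ := ih
    rcases le_or_gt (f n) 0 with hn | hn
    · refine ⟨κ, hκ, fun j hj => ?_⟩
      rcases Nat.lt_succ_iff_lt_or_eq.1 hj with h1 | rfl
      exacts [h j h1, Or.inl hn]
    · refine ⟨min κ (f n), lt_min hκ hn, fun j hj => ?_⟩
      rcases Nat.lt_succ_iff_lt_or_eq.1 hj with h1 | rfl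
      exacts [(h j h1).imp_right (min_le_left _ _).trans, Or.inr (min_le_right _ _)]

end CoreWords

section LowerBound

open Module

variable {M : Type*} [NormedAddCommGroup M] [InnerProductSpace ℝ M] [FiniteDimensional ℝ M]
  {A : Type*} {Tr : A → A → Prop}

theorem exists_core_parameters {κ η C C₀ θ D : ℝ} (hη : 0 < η) (h8 : 8 * η ≤ κ / 4)
    (hC : 0 ≤ C) (hθ0 : 0 < θ) (hθ1 : θ < 1) :
    ∃ t ρ : ℝ, 0 < t ∧ 0 < ρ ∧ 2 * C * ρ ≤ η ∧ ρ * (2 * C + t + 1) ≤ t / 2 ∧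
      (∀ ℓ : ℕ, θ ^ ℓ ≤ Real.exp (-(t * ℓ))) ∧
      ∃ ℓ₀ : ℕ, 1 ≤ ℓ₀ ∧ ∀ ℓ ≥ ℓ₀, 1 ≤ ℓ * η ∧
        10 * Real.exp (3 * (ℓ * η)) * (D * Real.exp (3 * C₀) * Real.exp (ℓ * (5 * η - κ))) ≤
          Real.exp (-(t * ℓ)) / 2 := by
  set t := min (κ / 4) (-Real.log θ) with ht
  have htpos : 0 < t := lt_min (by linarith) (by linarith [Real.log_neg hθ0 hθ1])
  have htκ : t ≤ κ / 4 := min_le_left _ _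
  have htθ : t ≤ -Real.log θ := min_le_right _ _
  have h2C : 0 < 2 * C + 1 := by linarith
  have h2Ct : 0 < 2 * C + t + 1 := by linarith
  refine ⟨t, min (t / (2 * (2 * C + t + 1))) (η / (2 * C + 1)), htpos,
    lt_min (by positivity) (by positivity), ?_, ?_, fun ℓ => ?_, ?_⟩
  · calc 2 * C * min (t / (2 * (2 * C + t + 1))) (η / (2 * C + 1))
        ≤ (2 * C + 1) * (η / (2 * C + 1)) :=
          mul_le_mul (by linarith) (min_le_right _ _)
            (le_min (by positivity) (by positivity)) h2C.le
      _ = η := by field_simp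
  · calc min (t / (2 * (2 * C + t + 1))) (η / (2 * C + 1)) * (2 * C + t + 1)
        ≤ t / (2 * (2 * C + t + 1)) * (2 * C + t + 1) :=
          mul_le_mul_of_nonneg_right (min_le_left _ _) h2Ct.le
      _ = t / 2 := by field_simp
  · calc θ ^ ℓ = Real.exp (ℓ * Real.log θ) := by rw [Real.exp_nat_mul, Real.exp_log hθ0]
      _ ≤ _ := by
        refine Real.exp_le_exp.2 ?_
        have := mul_le_mul_of_nonneg_right htθ (Nat.cast_nonneg (α := ℝ) ℓ)
        linarith
  · set B := 20 * D * Real.exp (3 * C₀) with hB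
    obtain ⟨n₁, hn₁⟩ := exists_nat_gt (1 / η)
    obtain ⟨n₂, hn₂⟩ := exists_nat_gt (B / (κ / 2))
    rw [div_lt_iff₀ hη] at hn₁
    rw [div_lt_iff₀ (by linarith)] at hn₂
    refine ⟨n₁ + n₂ + 1, by omega, fun ℓ hℓ => ?_⟩
    have h1 : (n₁ : ℝ) ≤ ℓ := by exact_mod_cast (by omega : n₁ ≤ ℓ)
    have h2 : (n₂ : ℝ) ≤ ℓ := by exact_mod_cast (by omega : n₂ ≤ ℓ)
    refine ⟨hn₁.le.trans (mul_le_mul_of_nonneg_right h1 hη.le), ?_⟩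
    have h3 : B ≤ Real.exp (ℓ * (κ / 2)) := by
      have h4 := Real.add_one_le_exp ((ℓ : ℝ) * (κ / 2))
      have h5 := mul_le_mul_of_nonneg_right h2 (show 0 ≤ κ / 2 by linarith)
      linarith
    have h6 : 10 * Real.exp (3 * (ℓ * η)) *
        (D * Real.exp (3 * C₀) * Real.exp (ℓ * (5 * η - κ))) =
        B * Real.exp (ℓ * (8 * η - κ)) / 2 := by
      rw [hB, show (ℓ : ℝ) * (8 * η - κ) = 3 * (ℓ * η) + ℓ * (5 * η - κ) by ring, Real.exp_add]
      ring
    rw [h6]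
    refine div_le_div_of_nonneg_right ?_ (by norm_num)
    calc B * Real.exp (ℓ * (8 * η - κ)) ≤ Real.exp (ℓ * (κ / 2)) * Real.exp (ℓ * (8 * η - κ)) := by
          gcongr
      _ ≤ _ := by
        rw [← Real.exp_add, Real.exp_le_exp]
        have h7 : κ / 2 + (8 * η - κ) ≤ -t := by linarith
        have := mul_le_mul_of_nonneg_left h7 (Nat.cast_nonneg (α := ℝ) ℓ)
        linarith

theorem exists_lower_bound_of_deviation_bound [Fintype A] [Nonempty (SFT Tr)]
    {Amap : SFT Tr → (M →L[ℝ] M)} (hAH : HolderCocycle Tr Amap) {R : ℝ}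
    (hR : 1 ≤ R) (hA : ∀ x, IsUnit (Amap x))
    (hb : ∀ x, ‖Amap x‖ ≤ R ∧ ‖Ring.inverse (Amap x)‖ ≤ R)
    {C : ℝ} (hC : C = Real.log (R ^ finrank ℝ M)) {q Λ : Fin (finrank ℝ M + 1) → ℝ}
    (hq : ∀ k, 0 ≤ q k)
    (hdev : ∀ η : ℝ, 0 < η → ∃ c : ℝ, 0 < c ∧ ∃ C' : ℝ, 1 ≤ C' ∧ ∀ n : ℕ,
      wsum n ((devSet (normFam M Amap) Λ η n).indicator (expPot (normFam M Amap) q n)) ≤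
        C' * Real.exp (n * (famPressure (normFam M Amap) q - c)))
    {e : ℝ} (he : 0 < e) :
    ∃ δ : ℝ, 0 < δ ∧ ∀ Bmap : SFT Tr → (M →L[ℝ] M), (∀ x, IsUnit (Bmap x)) →
      (∃ C', SubaddFamily (normFam M Bmap) C') → (∀ x, ‖Amap x - Bmap x‖ ≤ δ) →
      ∀ q₀ : Fin (finrank ℝ M + 1) → ℝ, (∀ k, 0 ≤ q₀ k) → ∑ k, q₀ k = 1 →
        famPressure (normFam M Amap) q - ∑ k, q k * Λ k + ∑ k, q₀ k * Λ k -
          e * (2 + ∑ k, q k) ≤ famPressure (normFam M Bmap) q₀ := by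
  classical
  have hF : SubaddFamily (normFam M Amap) C := hC ▸ subaddFamily_normFam hR hA hb
  have hC0 := hF.nonneg
  have hΛ : ∀ k, |Λ k| ≤ C := hF.abs_le_of_deviation_bound hq hdev
  obtain ⟨Ch, hCh, θ, hθ0, hθ1, hH⟩ := hAH
  obtain ⟨C₀, hC₀, h₀⟩ := exists_log_norm_extPull_bound M
  obtain ⟨κ, hκ, hgap⟩ := exists_gap (fun j => if h : j + 2 < finrank ℝ M + 1 then
    2 * Λ ⟨j + 1, by omega⟩ - Λ ⟨j, by omega⟩ - Λ ⟨j + 2, h⟩ else 0) (finrank ℝ M)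
  set η := min (κ / 32) (e / 8) with hη
  have hηpos : 0 < η := lt_min (by linarith) (by linarith)
  have hηκ : 8 * η ≤ κ / 4 := by linarith [min_le_left (κ / 32) (e / 8)]
  have hηe : 8 * η ≤ e := by linarith [min_le_right (κ / 32) (e / 8)]
  obtain ⟨t, ρ, ht, hρ, hρη, hρt, hθt, ℓ₀, hℓ₀, hℓbig⟩ := exists_core_parameters (C₀ := C₀)
    (D := (finrank ℝ M : ℝ) ^ finrank ℝ M) hηpos hηκ hC0 hθ0 hθ1
  set G : ℝ := 1 + (finrank ℝ M + 1) * (1 + C) / η with hG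
  have hGpos : 0 < G := by positivity
  set η₀ := min η (ρ / (4 * G)) with hη₀
  have hη₀pos : 0 < η₀ := lt_min hηpos (by positivity)
  have hpar : η₀ + (finrank ℝ M + 1) * ((2 * η₀ + 2 * C * η₀) / (2 * η)) < ρ / 2 := by
    have h1 : η₀ + (finrank ℝ M + 1) * ((2 * η₀ + 2 * C * η₀) / (2 * η)) = η₀ * G := by
      rw [hG]; field_simp
    have h2 : η₀ * G ≤ ρ / (4 * G) * G := mul_le_mul_of_nonneg_right (min_le_right _ _) hGpos.le
    have h3 : ρ / (4 * G) * G = ρ / 4 := by field_simp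
    linarith
  obtain ⟨c, hc, C', hC', hdev'⟩ := hdev η₀ hη₀pos
  obtain ⟨ℓ₁, hℓ₁⟩ := hF.half_le_wsum_goodSet hq hc hC' hdev' hη₀pos
  set ℓ := ℓ₀ + ℓ₁ with hℓ
  have hℓ1 : 1 ≤ ℓ := by omega
  have hℓ1' : (1 : ℝ) ≤ ℓ := by exact_mod_cast hℓ1
  obtain ⟨hlη, hΓβ⟩ := hℓbig ℓ (by omega)
  set β := (finrank ℝ M : ℝ) ^ finrank ℝ M * Real.exp (3 * C₀) * Real.exp (ℓ * (5 * η - κ)) with hβ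
  have hβ0 : 0 ≤ β := by positivity
  have hΓ1 : 1 ≤ Real.exp (3 * (ℓ * η)) := Real.one_le_exp (by positivity)
  have hβ1 : β ≤ 1 / 2 := by
    have h1 : Real.exp (-(t * ℓ)) ≤ 1 := Real.exp_le_one_iff.2 (by
      have : 0 ≤ t * ℓ := by positivity
      linarith)
    have h2 := mul_le_mul_of_nonneg_right hΓ1 hβ0
    linarith
  set ς := Real.exp (-(3 * (ℓ * η))) / 16 with hς
  have hςpos : 0 < ς := by positivity
  have hΓς : 16 * Real.exp (3 * (ℓ * η)) * ς = 1 := by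
    have : Real.exp (3 * (ℓ * η)) * Real.exp (-(3 * (ℓ * η))) = 1 := by
      rw [← Real.exp_add, add_neg_cancel, Real.exp_zero]
    rw [hς]
    linarith
  have hς1 : 2 * ς ≤ 1 := by
    have := mul_le_mul_of_nonneg_right hΓ1 hςpos.le
    linarith
  have hR1 : 1 ≤ R + 1 := by linarith
  set Q := 8 * Real.exp (ℓ * C) * distConst (R + 1) (finrank ℝ M) ℓ with hQ
  have hQ0 : 0 ≤ Q := mul_nonneg (by positivity) (distConst_nonneg hR1 (finrank ℝ M) ℓ)
  have hθℓ : θ ^ ℓ < 1 := pow_lt_one₀ hθ0.le hθ1 (by omega)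
  obtain ⟨L, hL⟩ : ∃ L : ℕ, Q * (Ch * (θ ^ ℓ) ^ L) ≤ ς := by
    have h1 := ((tendsto_pow_atTop_nhds_zero_of_lt_one (pow_nonneg hθ0.le ℓ) hθℓ).const_mul
      Ch).const_mul Q
    rw [mul_zero, mul_zero] at h1
    obtain ⟨L, hL⟩ := (h1.eventually_lt_const hςpos).exists
    exact ⟨L, hL.le⟩
  choose m cl hcl using fun k : Fin (finrank ℝ M + 1) =>
      exists_sphere_class (M [⋀^Fin k]→L[ℝ] ℝ) hςpos
  set P := (L + 1) * ℓ with hP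
  let cls : SFT Tr → (∀ k : Fin (finrank ℝ M + 1), M [⋀^Fin k]→L[ℝ] ℝ) →
      (Fin P → A) × (∀ k : Fin (finrank ℝ M + 1), Fin (m k)) :=
    fun x v => (fun j => x.1 j, fun k => cl k (v k))
  obtain ⟨N₁, hN₁⟩ := exists_nat_gt (2 / (t * ℓ))
  obtain ⟨N, hN, s₀, W, hWne, hWlow, hW⟩ := exists_core_words hR hA hb hC hΛ hη₀pos
    (min_le_left _ _) hρ hℓ1 hpar hq (hℓ₁ ℓ (by omega)) cls he (L + 1 + N₁)
  have hlong : Real.exp (-(t * ℓ * N / 2)) ≤ 1 / 2 := by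
    have htl : 0 < t * ℓ := by positivity
    rw [div_lt_iff₀ htl] at hN₁
    have h1 : (N₁ : ℝ) ≤ N := by exact_mod_cast (by omega : N₁ ≤ N)
    have h2 := mul_le_mul_of_nonneg_right h1 htl.le
    have h3 : 1 ≤ t * ℓ * N / 2 := by linarith
    have h4 := Real.add_one_le_exp (t * ℓ * N / 2)
    rw [Real.exp_neg, one_div]
    exact inv_anti₀ (by norm_num) (by linarith)
  set δ := min 1 (ς * Real.exp (-(t * ℓ * N)) / (Q + 1)) with hδ
  have hδpos : 0 < δ := lt_min one_pos (by positivity)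
  have hδς : Q * δ ≤ ς * Real.exp (-(t * ℓ * N)) := by
    calc Q * δ ≤ (Q + 1) * (ς * Real.exp (-(t * ℓ * N)) / (Q + 1)) :=
          mul_le_mul (by linarith) (min_le_right _ _) hδpos.le (by linarith)
      _ = _ := by field_simp
  refine ⟨δ, hδpos, fun Bmap hB hFB hAB q₀ hq₀ hq₀1 => ?_⟩
  obtain ⟨CB, hFB⟩ := hFB
  have hBb : ∀ x, ‖Bmap x‖ ≤ R + 1 := fun x => by
    have h1 := norm_le_norm_add_norm_sub (Amap x) (Bmap x)
    linarith [(hb x).1, hAB x, min_le_left 1 (ς * Real.exp (-(t * ℓ * N)) / (Q + 1))]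
  have hAb : ∀ x, ‖Amap x‖ ≤ R + 1 := fun x => by linarith [(hb x).1]
  have hσC : Real.exp (2 * (ℓ * C)) ≤ Real.exp ((2 * C + t + 1) * ℓ - t * ℓ) / 2 := by
    rw [show (2 * C + t + 1) * ℓ - t * ℓ = 2 * (ℓ * C) + ℓ by ring, Real.exp_add]
    have h1 : 2 ≤ Real.exp (ℓ : ℝ) := by linarith [Real.add_one_le_exp (ℓ : ℝ)]
    have h2 := mul_le_mul_of_nonneg_left h1 (Real.exp_pos (2 * (ℓ * C))).le
    linarith
  have hρσ : ρ * ((2 * C + t + 1) * ℓ) ≤ t * ℓ / 2 := by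
    have := mul_le_mul_of_nonneg_right hρt (show (0 : ℝ) ≤ ℓ by positivity)
    linarith
  have hcore : ∀ u : W, ∃ (x : SFT Tr) (w : ∀ k : Fin (finrank ℝ M + 1), ℕ → M [⋀^Fin k]→L[ℝ] ℝ)
      (μ : Fin (finrank ℝ M + 1) → ℕ → ℝ) (Bd : Finset ℕ), IsCore Amap Λ η C ρ ℓ N x w μ Bd ∧
      cls x (fun k => w k 0) = s₀ ∧ cls ((shiftSFT Tr)^[N * ℓ] x) (fun k => w k N) = s₀ ∧
      ∀ i : Fin (N * ℓ), x.1 i = u.1 i := by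
    intro u
    obtain ⟨x, ⟨w, μ, Bd, h1, h2, h3⟩, h4⟩ := hW u.1 u.2
    exact ⟨x, w, μ, Bd, h1, h2, h3, h4⟩
  choose Y w μ Bd hY1 hY2 hY3 hY4 using hcore
  have : Nonempty W := hWne.to_subtype
  have hfinal := le_famPressure_of_concat (ι := W) hB hFB (n := N * ℓ) (P := P)
    (Nat.mul_pos (by omega) hℓ1) (Nat.mul_le_mul_right ℓ (by omega)) (Y := Y)
    (by
      intro u u' j hj
      have h1 := congrFun (congrArg Prod.fst ((hY3 u).trans (hY2 u').symm)) ⟨j, hj⟩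
      simpa only [cls, shift_iterate_apply] using h1)
    (by
      intro u u' h
      refine Subtype.ext (funext fun i => ?_)
      rw [← hY4 u i, ← hY4 u' i]
      exact h i i.2)
    hq₀ hq₀1 (Λ := Λ) (c₁ := 4 * η) (ς := ς) hςpos.le hς1
    (by
      intro k
      have hstep : (∀ y : SFT Tr, y ∉ devSet (normFam M Amap) Λ η ℓ → ∀ m : ℝ,
          Real.exp (ℓ * (Λ k - 2 * η)) ≤ m → ∃ (ξ : (M [⋀^Fin k]→L[ℝ] ℝ) →L[ℝ] ℝ)
            (a : M [⋀^Fin k]→L[ℝ] ℝ), ‖pullCoc Amap k ℓ y - ξ.smulRight a‖ ≤ β * m) →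
          ∃ a b : W → M [⋀^Fin k]→L[ℝ] ℝ, (∀ u, ‖a u‖ = 1) ∧ (∀ u u', ‖a u' - b u‖ ≤ ς) ∧
            ∀ u, ∀ z : SFT Tr, (∀ j < N * ℓ + P, z.1 j = (Y u).1 j) → ∀ v, ‖v‖ ≤ 2 * ς →
              ∃ (c : ℝ) (v' : M [⋀^Fin k]→L[ℝ] ℝ), Real.exp ((N * ℓ : ℕ) * (Λ k - 4 * η)) ≤ c ∧
                pullCoc Bmap k (N * ℓ) z (b u + v) = c • (a u + v') ∧ ‖v'‖ ≤ ς := by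
        intro hk
        refine ⟨fun u => w u k 0, fun u => w u k N, fun u => (hY1 u).norm_eq k 0 (Nat.zero_le _),
          fun u u' => ?_, fun u z hz v hv => ?_⟩
        · refine hcl k _ _ ((hY1 u').norm_eq k 0 (Nat.zero_le _)) ((hY1 u).norm_eq k N le_rfl) ?_
          exact congrFun (congrArg Prod.snd ((hY2 u').trans (hY3 u).symm)) k
        · exact (hY1 u).exists_map_add_eq hA hF hΛ hR1 hAb hBb hCh.le hθ0.le hH hAB hlη hρη
            (by positivity) hςpos hς1 hβ1 hΓς.le hΓβ hσC (by positivity) hρσ hlong (hθt ℓ) hL hδς hk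
            (fun j hj => hz j (by rw [hP, ← Nat.add_mul]; exact hj)) hv
      by_cases hext : (k : ℕ) = 0 ∨ (k : ℕ) = finrank ℝ M
      · refine Or.inl (hstep fun y _ m hm => ?_)
        obtain ⟨ξ, a, h⟩ := exists_rankOne_extPull_extreme (cocycle Tr Amap ℓ y) hext
        refine ⟨ξ, a, ?_⟩
        have h1 : pullCoc Amap k ℓ y - ξ.smulRight a = 0 := sub_eq_zero.2 h
        rw [h1]
        exact ContinuousLinearMap.opNorm_zero.trans_le (mul_nonneg hβ0
            ((Real.exp_pos _).le.trans hm))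
      · obtain ⟨j, hj, rfl⟩ : ∃ (j : ℕ) (hj : j + 2 < finrank ℝ M + 1), k = ⟨j + 1, by omega⟩ := by
          have := k.2
          push Not at hext
          refine ⟨k - 1, by omega, Fin.ext ?_⟩
          simp only
          omega
        have hg := hgap j (by omega)
        rw [dif_pos hj] at hg
        rcases hg with hg | hg
        · exact Or.inr ⟨j, hj, rfl, by linarith⟩
        · exact Or.inl (hstep fun y hy m hm =>
            exists_rankOne_of_not_mem_devSet hA h₀ hy (by omega) hg hm))
  rw [Fintype.card_coe] at hfinal
  have hsq : 0 ≤ ∑ k, q k := Finset.sum_nonneg fun k _ => hq k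
  have h1 : (η + 2 * C * ρ) * ∑ k, q k ≤ e * ∑ k, q k :=
    mul_le_mul_of_nonneg_right (by linarith) hsq
  linarith

end LowerBound

section Continuity

open Module

variable {M : Type*} [NormedAddCommGroup M] [InnerProductSpace ℝ M] [FiniteDimensional ℝ M]
  {A : Type*} {Tr : A → A → Prop}

theorem exists_upper_bound [Fintype A] [Nonempty (SFT Tr)]
    {Amap : SFT Tr → (M →L[ℝ] M)} {R : ℝ} (hR : 1 ≤ R) (hA : ∀ x, IsUnit (Amap x))
    (hb : ∀ x, ‖Amap x‖ ≤ R) {C : ℝ} (hF : SubaddFamily (normFam M Amap) C)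
    {q : Fin (finrank ℝ M + 1) → ℝ} (hq : ∀ k, 0 ≤ q k) (hq1 : ∑ k, q k = 1)
    {ε : ℝ} (hε : 0 < ε) :
    ∃ δ : ℝ, 0 < δ ∧ ∀ Bmap : SFT Tr → (M →L[ℝ] M), (∀ x, IsUnit (Bmap x)) →
      (∃ C', SubaddFamily (normFam M Bmap) C') → (∀ x, ‖Amap x - Bmap x‖ ≤ δ) →
      famPressure (normFam M Bmap) q < famPressure (normFam M Amap) q + ε := by
  obtain ⟨C', hC', hu⟩ := hF.partSum_le_exp q (c := ε / 4) (by positivity)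
  obtain ⟨n, hn⟩ := exists_nat_gt (Real.log C' / (ε / 4))
  have hn0 : (0 : ℝ) < n :=
    (div_nonneg (Real.log_nonneg hC') (by positivity)).trans_lt hn
  have hn1 : 1 ≤ n := by exact_mod_cast hn0
  have hn1' : (1 : ℝ) ≤ n := by exact_mod_cast hn1
  rw [div_lt_iff₀ (by positivity)] at hn
  set D := distConst (R + 1) (finrank ℝ M) n * Real.exp (n * C) with hD
  have hdc := distConst_nonneg (show 1 ≤ R + 1 by linarith) (finrank ℝ M) n
  have hD0 : 0 ≤ D := mul_nonneg hdc (Real.exp_pos _).le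
  refine ⟨min 1 (ε / 4 / (D + 1)), lt_min one_pos (by positivity), fun Bmap hB hFB hAB => ?_⟩
  set δ := min 1 (ε / 4 / (D + 1)) with hδ
  obtain ⟨CB, hFB⟩ := hFB
  have hδ0 : 0 < δ := lt_min one_pos (by positivity)
  have hDδ : D * δ ≤ ε / 4 := by
    calc D * δ ≤ (D + 1) * (ε / 4 / (D + 1)) :=
          mul_le_mul (by linarith) (min_le_right _ _) hδ0.le (by linarith)
      _ = ε / 4 := by field_simp
  have hBb : ∀ x, ‖Bmap x‖ ≤ R + 1 := fun x => by
    have h1 := norm_le_norm_add_norm_sub (Amap x) (Bmap x)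
    linarith [hb x, hAB x, min_le_left 1 (ε / 4 / (D + 1))]
  have hAb : ∀ x, ‖Amap x‖ ≤ R + 1 := fun x => by linarith [hb x]
  have hlog : ∀ k x, normFam M Bmap k n x ≤ normFam M Amap k n x + ε / 4 := by
    intro k x
    have hk : (k : ℕ) ≤ finrank ℝ M := Nat.lt_succ_iff.1 k.2
    have hpA := pullCoc_norm_pos hA hk n x
    have hpB := pullCoc_norm_pos hB hk n x
    have h1 : ‖pullCoc Bmap k n x - pullCoc Amap k n x‖ ≤
        distConst (R + 1) (finrank ℝ M) n * δ :=
      norm_pullCoc_sub_le_distConst (by linarith) hδ0.le hAb hBb hk n x x fun j _ => by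
        rw [norm_sub_rev]; exact hAB _
    have h2 : 1 ≤ Real.exp (n * C) * ‖pullCoc Amap k n x‖ := by
      have h3 := (abs_le.1 (hF.bound k n x)).1
      have h4 : Real.exp (-(n * C)) ≤ ‖pullCoc Amap k n x‖ := by
        rw [← Real.exp_log hpA]
        exact Real.exp_le_exp.2 h3
      have h5 := mul_le_mul_of_nonneg_left h4 (Real.exp_pos (n * C)).le
      rwa [← Real.exp_add, add_neg_cancel, Real.exp_zero] at h5
    have h3 : ‖pullCoc Bmap k n x‖ ≤ ‖pullCoc Amap k n x‖ * Real.exp (ε / 4) := by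
      have h4 := norm_le_norm_add_norm_sub' (pullCoc Bmap k n x) (pullCoc Amap k n x)
      have h5 := mul_le_mul_of_nonneg_left h2 (mul_nonneg hdc hδ0.le)
      have h6 := mul_le_mul_of_nonneg_right hDδ hpA.le
      have h7 := mul_le_mul_of_nonneg_left (Real.add_one_le_exp (ε / 4)) hpA.le
      rw [hD] at h6
      linarith
    have h4 := Real.log_le_log hpB h3
    rwa [Real.log_mul hpA.ne' (Real.exp_pos _).ne', Real.log_exp] at h4
  have hpart : partSum (normFam M Bmap) q n ≤
      Real.exp (ε / 4) * partSum (normFam M Amap) q n := by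
    refine wsum_le_mul (Real.exp_pos _).le (fun x => (expPot_pos _ _ n x).le)
      (hF.bddAbove_expPot q n) (fun x => ?_) n
    rw [expPot, expPot, ← Real.exp_add, Real.exp_le_exp]
    have h1 : ∑ k, q k * normFam M Bmap k n x ≤ ∑ k, q k * (normFam M Amap k n x + ε / 4) :=
      Finset.sum_le_sum fun k _ => mul_le_mul_of_nonneg_left (hlog k x) (hq k)
    simp only [mul_add, Finset.sum_add_distrib, ← Finset.sum_mul, hq1] at h1
    linarith
  have h1 : Real.exp (n * famPressure (normFam M Bmap) q) ≤ Real.exp (ε / 4) *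
      (Real.exp (Real.log C') * Real.exp (n * (famPressure (normFam M Amap) q + ε / 4))) := by
    rw [Real.exp_log (by linarith)]
    exact ((hFB.exp_famPressure_le hq hn1).trans hpart).trans
      (mul_le_mul_of_nonneg_left (hu n) (Real.exp_pos _).le)
  rw [← Real.exp_add, ← Real.exp_add, Real.exp_le_exp] at h1
  refine lt_of_mul_lt_mul_left (a := (n : ℝ)) ?_ hn0.le
  have h2 := mul_le_mul_of_nonneg_right hn1' (show 0 ≤ ε / 4 by positivity)
  have h3 : 0 < n * ε := by positivity
  linarith

theorem exists_lower_bound [Fintype A] [Nonempty (SFT Tr)]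
    {Amap : SFT Tr → (M →L[ℝ] M)} (hAH : HolderCocycle Tr Amap) {R : ℝ} (hR : 1 ≤ R)
    (hA : ∀ x, IsUnit (Amap x)) (hb : ∀ x, ‖Amap x‖ ≤ R ∧ ‖Ring.inverse (Amap x)‖ ≤ R)
    {q₀ : Fin (finrank ℝ M + 1) → ℝ} (hq₀ : ∀ k, 0 ≤ q₀ k) (hq₀1 : ∑ k, q₀ k = 1)
    {ε : ℝ} (hε : 0 < ε) :
    ∃ δ : ℝ, 0 < δ ∧ ∀ Bmap : SFT Tr → (M →L[ℝ] M), (∀ x, IsUnit (Bmap x)) →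
      (∃ C', SubaddFamily (normFam M Bmap) C') → (∀ x, ‖Amap x - Bmap x‖ ≤ δ) →
      famPressure (normFam M Amap) q₀ - ε < famPressure (normFam M Bmap) q₀ := by
  obtain ⟨C, hC⟩ : ∃ C, C = Real.log (R ^ finrank ℝ M) := ⟨_, rfl⟩
  have hF : SubaddFamily (normFam M Amap) C := hC ▸ subaddFamily_normFam hR hA hb
  have hC0 := hF.nonneg
  obtain ⟨e₁, he₁⟩ : ∃ e₁ : ℝ, e₁ = min 1 (ε / (8 * (C + 1))) / (finrank ℝ M + 1) := ⟨_, rfl⟩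
  have hmin : 0 < min 1 (ε / (8 * (C + 1))) := lt_min one_pos (by positivity)
  have he₁pos : 0 < e₁ := he₁ ▸ by positivity
  have hde : (finrank ℝ M + 1) * e₁ = min 1 (ε / (8 * (C + 1))) := by
    rw [he₁]; field_simp
  obtain ⟨q, hqpos, hqe, hdiff⟩ := hF.exists_differentiableAt hq₀ he₁pos
  have hq : ∀ k, 0 ≤ q k := fun k => (hqpos k).le
  have hsum : ∑ k, |q k - q₀ k| ≤ min 1 (ε / (8 * (C + 1))) := by
    rw [← hde]
    refine (Finset.sum_le_card_nsmul _ _ e₁ fun k _ => (hqe k).le).trans ?_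
    simp
  have hsumC : C * ∑ k, |q k - q₀ k| ≤ ε / 8 := by
    calc C * ∑ k, |q k - q₀ k| ≤ (C + 1) * (ε / (8 * (C + 1))) :=
          mul_le_mul (by linarith) (hsum.trans (min_le_right _ _))
            (Finset.sum_nonneg fun k _ => abs_nonneg _) (by linarith)
      _ = ε / 8 := by field_simp
  have hq2 : ∑ k, q k ≤ 2 := by
    have h1 : ∑ k, (q k - q₀ k) ≤ ∑ k, |q k - q₀ k| := Finset.sum_le_sum fun k _ => le_abs_self _
    rw [Finset.sum_sub_distrib, hq₀1] at h1
    linarith [hsum.trans (min_le_left _ _)]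
  obtain ⟨Λ, hdev⟩ := hF.exists_deviation_bound hdiff
  have hΛ : ∀ k, |Λ k| ≤ C := hF.abs_le_of_deviation_bound hq hdev
  have hqΛ : ∑ k, q k * Λ k - ∑ k, q₀ k * Λ k ≤ ε / 8 := by
    rw [← Finset.sum_sub_distrib]
    refine le_trans ?_ hsumC
    rw [Finset.mul_sum]
    refine Finset.sum_le_sum fun k _ => ?_
    calc q k * Λ k - q₀ k * Λ k = Λ k * (q k - q₀ k) := by ring
      _ ≤ |Λ k * (q k - q₀ k)| := le_abs_self _
      _ = |Λ k| * |q k - q₀ k| := abs_mul _ _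
      _ ≤ _ := mul_le_mul_of_nonneg_right (hΛ k) (abs_nonneg _)
  have hPq := (abs_le.1 ((hF.abs_famPressure_sub_le q q₀).trans hsumC)).1
  obtain ⟨δ, hδ, h⟩ := exists_lower_bound_of_deviation_bound hAH hR hA hb hC hq hdev
    (show 0 < ε / 16 by positivity)
  refine ⟨δ, hδ, fun Bmap hB hFB hAB => ?_⟩
  have h1 := h Bmap hB hFB hAB q₀ hq₀ hq₀1
  have h2 := mul_le_mul_of_nonneg_left hq2 (show 0 ≤ ε / 16 by positivity)
  linarith

end Continuity

/-- Let `(X,T)` be a subshift of finite type on a finite alphabet and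
`A : X → GL(m₀,ℝ)` a Hölder continuous matrix cocycle (realized as a cocycle of invertible
operators on an `m₀`-dimensional real inner product space). Then for each `s ∈ [0,m₀]` the
map `A ↦ P(A,s)` is continuous: for every `ε > 0` there is `δ > 0` such that
`|P(B,s) − P(A,s)| < ε` for every Hölder continuous invertible cocycle `B` with
`sup_x ‖A(x) − B(x)‖ < δ`. -/
theorem stmt18 {M : Type*} [NormedAddCommGroup M] [InnerProductSpace ℝ M]
    [FiniteDimensional ℝ M]
    (m₀ : ℕ) (hdim : Module.finrank ℝ M = m₀)
    {A : Type*} [Fintype A] (Tr : A → A → Prop)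
    (Amap : SFT Tr → (M →L[ℝ] M)) (hA : HolderCocycle Tr Amap)
    (hAinv : ∀ x : SFT Tr, IsUnit (Amap x))
    (s : ℝ) (hs0 : 0 ≤ s) (hs1 : s ≤ m₀) :
    ∀ ε : ℝ, 0 < ε → ∃ δ : ℝ, 0 < δ ∧
      ∀ Bmap : SFT Tr → (M →L[ℝ] M), HolderCocycle Tr Bmap →
        (∀ x : SFT Tr, IsUnit (Bmap x)) →
        (∀ x : SFT Tr, ‖Amap x - Bmap x‖ < δ) →
        |cocPressure Tr Bmap s - cocPressure Tr Amap s| < ε := by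
  intro ε hε
  rcases isEmpty_or_nonempty (SFT Tr) with hempty | hne
  · refine ⟨1, one_pos, fun Bmap _ _ _ => ?_⟩
    rw [Subsingleton.elim Bmap Amap, sub_self, abs_zero]
    exact hε
  obtain ⟨R, hR, hb⟩ := exists_uniform_bound hA hAinv
  have hF := subaddFamily_normFam hR hAinv hb
  subst hdim
  obtain ⟨q₀, hq₀, hq₀1, hs⟩ := phiS_eq_exp (M := M) hs0 hs1
  obtain ⟨δ₁, hδ₁, hup⟩ := exists_upper_bound hR hAinv (fun x => (hb x).1) hF hq₀ hq₀1 hε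
  obtain ⟨δ₂, hδ₂, hlow⟩ := exists_lower_bound hA hR hAinv hb hq₀ hq₀1 hε
  refine ⟨min δ₁ δ₂, lt_min hδ₁ hδ₂, fun Bmap hB hBinv hAB => ?_⟩
  obtain ⟨RB, hRB, hbB⟩ := exists_uniform_bound hB hBinv
  have hFB := subaddFamily_normFam hRB hBinv hbB
  rw [cocPressure_eq_famPressure hAinv hF hs, cocPressure_eq_famPressure hBinv hFB hs, abs_lt]
  have h1 := hup Bmap hBinv ⟨_, hFB⟩ fun x => (hAB x).le.trans (min_le_left _ _)
  have h2 := hlow Bmap hBinv ⟨_, hFB⟩ fun x => (hAB x).le.trans (min_le_right _ _)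
  constructor <;> linarith
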